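/- The theory NFU^{-AC} has a model if and only if the theory NFU has a model, where NFU is NFU^{-AC} together with the Axiom of Choice (the L_NFU-sentence asserting that every set of pairwise disjoint nonempty sets has a transversal, i.e. a set meeting each of its members in exactly one element). Moreover, for every L_PA-sentence φ, the relativization φ^ℕ of φ to the internal arithmetic (ℕ, +, ·, 0, 1) holds in every model of NFU^{-AC} if and only if it holds in every model of NFU. -/

import Mathlib

open FirstOrder Language

namespace NFUweak

/-! ## The language L_NFU -/

/-- Function symbols of `L_NFU`: a single binary (type-level) pairing function. -/
inductive NFUFunc : ℕ → Type
  | pair : NFUFunc 2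

/-- Relation symbols of `L_NFU`: binary membership `∈` and unary sethood `S`. -/
inductive NFURel : ℕ → Type
  | mem : NFURel 2
  | isSet : NFURel 1

/-- The language `L_NFU`. -/
def LNFU : Language := ⟨NFUFunc, NFURel⟩

/-- The membership relation symbol. -/
def memR : LNFU.Relations 2 := NFURel.mem

/-- The sethood relation symbol. -/
def setR : LNFU.Relations 1 := NFURel.isSet

/-- The pairing function symbol. -/
def pairF : LNFU.Functions 2 := NFUFunc.pair

/-! ## Stratification -/

/-- `termLevel σ t k` says that, relative to the assignment `σ` of levels (types)
to variables, the term `t` (and all of its subterms) receives level `k`. -/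
def termLevel {α : Type} (σ : α → ℕ) : LNFU.Term α → ℕ → Prop
  | Term.var v, k => σ v = k
  | Term.func _ ts, k => ∀ i, termLevel σ (ts i) k

/-- The stratification condition on an atomic formula `R(ts)`:
for `s ∈ t` the level of `t` is one more than that of `s`; `S(t)` imposes only
that `t` has a well-defined level. -/
def atomOK {α : Type} (σ : α → ℕ) : ∀ {l : ℕ}, LNFU.Relations l → (Fin l → LNFU.Term α) → Prop
  | _, NFURel.mem, ts => ∃ k, termLevel σ (ts 0) k ∧ termLevel σ (ts 1) (k + 1)
  | _, NFURel.isSet, ts => ∃ k, termLevel σ (ts 0) k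

/-- `stratifiedFrom σ φ` : the formula `φ` is stratified, where the free
variables receive the levels given by `σ` (each quantified variable may receive
any level). -/
def stratifiedFrom : ∀ {n : ℕ}, ((Empty ⊕ Fin n) → ℕ) → LNFU.BoundedFormula Empty n → Prop
  | _, _, BoundedFormula.falsum => True
  | _, σ, BoundedFormula.equal t s => ∃ k, termLevel σ t k ∧ termLevel σ s k
  | _, σ, BoundedFormula.rel R ts => atomOK σ R ts
  | _, σ, BoundedFormula.imp f g => stratifiedFrom σ f ∧ stratifiedFrom σ g
  | _, σ, BoundedFormula.all f =>
      ∃ k, stratifiedFrom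
        (Sum.elim (fun e => σ (Sum.inl e)) (Fin.snoc (fun i => σ (Sum.inr i)) k)) f

/-- A formula of `L_NFU` is stratified if some assignment of levels to its
variables witnesses the stratification conditions. -/
def IsStratified {n : ℕ} (φ : LNFU.BoundedFormula Empty n) : Prop :=
  ∃ σ, stratifiedFrom σ φ

/-! ## The axioms of NFU⁻ᴬᶜ -/

/-- Weak extensionality: sets with the same members are equal. -/
def weakExtAx : LNFU.Sentence :=
  ∀' ∀' ((setR.boundedFormula₁ &0 ⊓
          setR.boundedFormula₁ &1) ⟹
    (Term.bdEqual &0 &1 ⇔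
      ∀' (memR.boundedFormula₂ &2 &0 ⇔
          memR.boundedFormula₂ &2 &1)))

/-- The pairing axiom: `⟨x,y⟩ = ⟨w,z⟩ → x = w ∧ y = z`. -/
def pairingAx : LNFU.Sentence :=
  ∀' ∀' ∀' ∀' (Term.bdEqual
      (pairF.apply₂ &0 &1)
      (pairF.apply₂ &2 &3) ⟹
    (Term.bdEqual &0 &2 ⊓ Term.bdEqual &1 &3))

/-- The comprehension axiom for a formula `φ(x, z₀, …, z_{m-1})`, where the
variable `x` is (de Bruijn) variable `m` of `φ` and `z₀, …, z_{m-1}` are the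
parameters: `∀ z⃗ ∃ y (S(y) ∧ ∀ x (x ∈ y ↔ φ(x, z⃗)))`. -/
def comprehensionAx (m : ℕ) (φ : LNFU.BoundedFormula Empty (m + 1)) : LNFU.Sentence :=
  BoundedFormula.alls (∃'
    (setR.boundedFormula₁ (Term.var (Sum.inr ⟨m, by omega⟩)) ⊓
      ∀' (memR.boundedFormula₂
            (Term.var (Sum.inr ⟨m + 1, by omega⟩)) (Term.var (Sum.inr ⟨m, by omega⟩)) ⇔
          φ.liftAt 1 m)))

/-- The theory NFU⁻ᴬᶜ : weak extensionality, pairing and stratified comprehension. -/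
def NFUmAC : LNFU.Theory :=
  {weakExtAx, pairingAx} ∪
    {s | ∃ (m : ℕ) (φ : LNFU.BoundedFormula Empty (m + 1)),
      IsStratified φ ∧ s = comprehensionAx m φ}

/-- The axiom `∀x S(x)` ("everything is a set"), turning NFU⁻ᴬᶜ into NF. -/
def allSetAx : LNFU.Sentence :=
  ∀' (setR.boundedFormula₁ &0)

/-- The theory NF. -/
def NF : LNFU.Theory := NFUmAC ∪ {allSetAx}

end NFUweak
namespace NFUweak

/-! ## Semantic notions inside a model of NFU⁻ᴬᶜ -/

section Semantics

variable {M : Type} [LNFU.Structure M]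

/-- The membership relation of the model. -/
def smem (x y : M) : Prop := Structure.RelMap memR ![x, y]

/-- The sethood predicate of the model. -/
def sset (x : M) : Prop := Structure.RelMap setR ![x]

/-- The (type-level) pairing function of the model. -/
def spair (x y : M) : M := Structure.funMap pairF ![x, y]

/-- `s` is the singleton `{x}`. -/
def isSingletonOf (s x : M) : Prop := sset s ∧ ∀ z, smem z s ↔ z = x

/-- `e` is the empty set. -/
def isEmptySet (e : M) : Prop := sset e ∧ ∀ z, ¬ smem z e

/-- `v` is the universal set `V`. -/
def isUniverseOf (v : M) : Prop := sset v ∧ ∀ x, smem x v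

/-- `f` is an internal function from (the members of) `X` to `Y`, coded as a set of
type-level ordered pairs `⟨a, b⟩`. -/
def isFunc (f X Y : M) : Prop :=
  sset f ∧ (∀ p, smem p f → ∃ a b, p = spair a b ∧ smem a X ∧ smem b Y) ∧
    (∀ a, smem a X → ∃ b, smem (spair a b) f) ∧
    (∀ a b b', smem (spair a b) f → smem (spair a b') f → b = b')

/-- `f` is an internal injection from `X` into `Y`. -/
def isInjFunc (f X Y : M) : Prop :=
  isFunc f X Y ∧ ∀ a a' b, smem (spair a b) f → smem (spair a' b) f → a = a'

/-- `f` is an internal bijection between `X` and `Y`. -/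
def isBijFunc (f X Y : M) : Prop :=
  isInjFunc f X Y ∧ ∀ b, smem b Y → ∃ a, smem (spair a b) f

/-- `X` and `Y` are equipollent (internally). -/
def equipollent (X Y : M) : Prop := ∃ f, isBijFunc f X Y

/-- `c` is the cardinal `|X|`, i.e. the equivalence class of `X` under equipollence. -/
def isCardOf (c X : M) : Prop := sset c ∧ ∀ y, smem y c ↔ equipollent y X

/-- `c` is a cardinal. -/
def isCardinal (c : M) : Prop := ∃ X, sset X ∧ isCardOf c X

/-- `κ ≤ μ` for cardinals: some member of `κ` injects into some member of `μ`. -/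
def cardLe (κ μ : M) : Prop := ∃ X Y f, smem X κ ∧ smem Y μ ∧ isInjFunc f X Y

/-- `Y = ι``X` is the set of singletons of members of `X`. -/
def isIotaImageOf (Y X : M) : Prop :=
  sset Y ∧ ∀ z, smem z Y ↔ ∃ x, smem x X ∧ isSingletonOf z x

/-- `t = T(c)` for a cardinal `c`:  `T(|X|) = |ι``X|`. -/
def isTOf (t c : M) : Prop :=
  ∃ X Y, smem X c ∧ isIotaImageOf Y X ∧ isCardOf t Y

/-- `t = T⁴(c)`. -/
def isT4Of (t c : M) : Prop :=
  ∃ t₁ t₂ t₃, isTOf t₁ c ∧ isTOf t₂ t₁ ∧ isTOf t₃ t₂ ∧ isTOf t t₃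

/-- `z` is the cardinal `0`, the set of all objects with no members. -/
def isZeroCard (z : M) : Prop := sset z ∧ ∀ y, smem y z ↔ ∀ w, ¬ smem w y

/-- `s = S(x)` is the cardinal successor:  `S(x) = {y : (∃z∈y)(y∖{z} ∈ x)}`. -/
def isSuccOf (s x : M) : Prop :=
  sset s ∧ ∀ y, smem y s ↔
    ∃ z, smem z y ∧ ∃ d, sset d ∧ (∀ w, smem w d ↔ (smem w y ∧ w ≠ z)) ∧ smem d x

/-- `o` is the cardinal `1 = S(0)`. -/
def isOneCard (o : M) : Prop := ∃ z, isZeroCard z ∧ isSuccOf o z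

/-- `I` is an inductive set: it contains `0` and is closed under `S`. -/
def isInductiveSet (I : M) : Prop :=
  sset I ∧ (∀ z, isZeroCard z → smem z I) ∧ ∀ a b, smem a I → isSuccOf b a → smem b I

/-- `n` is an internal natural number: it belongs to every inductive set. -/
def isNat (n : M) : Prop := ∀ I, isInductiveSet I → smem n I

/-- `N` is the set `ℕ` of internal natural numbers. -/
def isNatSet (N : M) : Prop := sset N ∧ ∀ y, smem y N ↔ isNat y

/-- `m + k = n` on cardinals, via disjoint unions. -/
def cardAdd (m k n : M) : Prop :=
  ∃ x y u, smem x m ∧ smem y k ∧ (∀ w, ¬ (smem w x ∧ smem w y)) ∧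
    sset u ∧ (∀ w, smem w u ↔ (smem w x ∨ smem w y)) ∧ smem u n

/-- `P` is the cartesian product `x × y` (with type-level pairs). -/
def isProdOf (P x y : M) : Prop :=
  sset P ∧ ∀ p, smem p P ↔ ∃ a b, smem a x ∧ smem b y ∧ p = spair a b

/-- `k · m = n` on cardinals, via cartesian products. -/
def cardMul (k m n : M) : Prop :=
  ∃ x y P, smem x k ∧ smem y m ∧ isProdOf P x y ∧ smem P n

/-- `m ≤ n` on internal natural numbers: `∃k∈ℕ, m + k = n`. -/
def natLe (m n : M) : Prop := ∃ k, isNat k ∧ cardAdd m k n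

/-- The model satisfies `AxCount₍≥₎ : (∀n∈ℕ)(T(n) ≤ n)`. -/
def axCountGeqHolds (M : Type) [LNFU.Structure M] : Prop :=
  ∀ n : M, isNat n → ∀ t, isTOf t n → natLe t n

/-- The model satisfies `AxCount₍≤₎ : (∀n∈ℕ)(n ≤ T(n))`. -/
def axCountLeqHolds (M : Type) [LNFU.Structure M] : Prop :=
  ∀ n : M, isNat n → ∀ t, isTOf t n → natLe n t

/-- The model satisfies `AxCount : (∀n∈ℕ)(T(n) = n)`. -/
def axCountHolds (M : Type) [LNFU.Structure M] : Prop :=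
  ∀ n : M, isNat n → ∀ t, isTOf t n → t = n

/-- The model satisfies the Axiom of Choice: every set of pairwise disjoint
nonempty sets has a transversal. -/
def acHolds (M : Type) [LNFU.Structure M] : Prop :=
  ∀ X : M, sset X →
    (∀ y, smem y X → sset y ∧ ∃ z, smem z y) →
    (∀ y y', smem y X → smem y' X → y ≠ y' → ∀ z, ¬ (smem z y ∧ smem z y')) →
    ∃ t, sset t ∧ ∀ y, smem y X → ∃! z, smem z y ∧ smem z t

/-- `2^κ` is defined (i.e. `2^κ ≠ ∅`): there is a set `X` with `|ι``X| = κ`. -/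
def twoPowDefined (κ : M) : Prop := ∃ X Y, isIotaImageOf Y X ∧ isCardOf κ Y

/-- `P` is the power set of `X`. -/
def isPowerSetOf (P X : M) : Prop :=
  sset P ∧ ∀ z, smem z P ↔ (sset z ∧ ∀ w, smem w z → smem w X)

/-- `μ = 2^κ` (in the nonempty case): `μ = |P(X)|` for some `X` with `|ι``X| = κ`. -/
def isTwoPowOf (μ κ : M) : Prop :=
  ∃ X Y P, isIotaImageOf Y X ∧ isCardOf κ Y ∧ isPowerSetOf P X ∧ isCardOf μ P

/-- `f` is the internal function `beth : ℕ → NC ∪ {∅}` with `beth(0) = ℵ₀` and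
`beth(n+1) = 2^{beth(n)}` (with value `∅` once undefined). -/
def isBethFun (f : M) : Prop :=
  sset f ∧
    (∀ p, smem p f → ∃ n y, isNat n ∧ p = spair n y) ∧
    (∀ n, isNat n → ∃ y, smem (spair n y) f) ∧
    (∀ n y y', smem (spair n y) f → smem (spair n y') f → y = y') ∧
    (∀ z y, isZeroCard z → smem (spair z y) f → ∃ N, isNatSet N ∧ isCardOf y N) ∧
    (∀ n n' y y', isNat n → isSuccOf n' n →
      smem (spair n y) f → smem (spair n' y') f →
        ((isEmptySet y ∧ isEmptySet y') ∨
          (¬ isEmptySet y ∧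
            (isTwoPowOf y' y ∨ (isEmptySet y' ∧ ¬ twoPowDefined y)))))

end Semantics

end NFUweak
namespace NFUweak

/-! ## BFEXTs and the structure ⟨BF, E⟩ inside a model of NFU⁻ᴬᶜ -/

section BF

variable {M : Type} [LNFU.Structure M]

/-- `R` is an internal binary relation: a set of (type-level) ordered pairs. -/
def isRel (R : M) : Prop := sset R ∧ ∀ p, smem p R → ∃ x y, p = spair x y

/-- `x` belongs to the field `Dom(R) = dom(R) ∪ rng(R)` of the relation `R`. -/
def inField (x R : M) : Prop := ∃ y, smem (spair x y) R ∨ smem (spair y x) R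

/-- `D` is the field `Dom(R)` of `R`, as a set. -/
def isFieldSetOf (D R : M) : Prop := sset D ∧ ∀ x, smem x D ↔ inField x R

/-- `R` is a BFEXT: a binary relation that is well-founded (every nonempty
subset of its field has an `R`-minimal element) and extensional. -/
def isBFEXT (R : M) : Prop :=
  isRel R ∧
    (∀ B, sset B → (∃ b, smem b B) → (∀ b, smem b B → inField b R) →
      ∃ b, smem b B ∧ ∀ c, smem c B → ¬ smem (spair c b) R) ∧
    (∀ a b, inField a R → inField b R →
      (∀ c, smem (spair c a) R ↔ smem (spair c b) R) → a = b)

/-- `x` belongs to the smallest subset of `Dom(R)` containing `a` and closed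
under `R`-predecessors. -/
def inSeg (x R a : M) : Prop :=
  ∀ B, sset B → (∀ b, smem b B → inField b R) → smem a B →
    (∀ b c, smem b B → smem (spair c b) R → smem c B) → smem x B

/-- `s = seg_R(a)`: the restriction of `R` to the smallest subset of `Dom(R)`
containing `a` and closed under `R`-predecessors. -/
def isSegOf (s R a : M) : Prop :=
  sset s ∧ ∀ p, smem p s ↔
    (smem p R ∧ ∃ x y, p = spair x y ∧ inSeg x R a ∧ inSeg y R a)

/-- `R ∈ Ω`: `R` is a BFEXT with `R = seg_R(a)` for some `a ∈ Dom(R)`. -/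
def inOmega (R : M) : Prop := isBFEXT R ∧ ∃ a, inField a R ∧ isSegOf R R a

/-- `a = 1_R` is the (unique) top of `R ∈ Ω`. -/
def isTopOf (a R : M) : Prop := inField a R ∧ isSegOf R R a

/-- `f` is an internal isomorphism between the relations `R` and `S`. -/
def isIsoRel (f R S : M) : Prop :=
  sset f ∧
    (∀ p, smem p f → ∃ x y, p = spair x y ∧ inField x R ∧ inField y S) ∧
    (∀ x, inField x R → ∃ y, smem (spair x y) f) ∧
    (∀ x y y', smem (spair x y) f → smem (spair x y') f → y = y') ∧
    (∀ x x' y, smem (spair x y) f → smem (spair x' y) f → x = x') ∧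
    (∀ y, inField y S → ∃ x, smem (spair x y) f) ∧
    (∀ x y x' y', smem (spair x x') f → smem (spair y y') f →
      (smem (spair x y) R ↔ smem (spair x' y') S))

/-- `R` and `S` are isomorphic relations. -/
def relIso (R S : M) : Prop := ∃ f, isIsoRel f R S

/-- `t = [R]` is the set of all relations isomorphic to `R`. -/
def isTypeOf (t R : M) : Prop := sset t ∧ ∀ S, smem S t ↔ relIso S R

/-- `a ∈ BF`: `a = [R]` for some `R ∈ Ω`. -/
def inBF (a : M) : Prop := ∃ R, inOmega R ∧ isTypeOf a R

/-- `a E b` for `a, b ∈ BF`: for `R ∈ a`, `S ∈ b` there is `x ∈ Dom(S)` with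
`⟨x, 1_S⟩ ∈ S` and `R ≅ seg_S(x)`. -/
def erel (a b : M) : Prop :=
  ∃ R S, smem R a ∧ smem S b ∧
    ∃ x oneS, isTopOf oneS S ∧ smem (spair x oneS) S ∧
      ∃ sg, isSegOf sg S x ∧ relIso R sg

/-- `e` is the set `E ⊆ BF × BF`. -/
def isESet (e : M) : Prop :=
  sset e ∧ ∀ p, smem p e ↔ ∃ a b, p = spair a b ∧ inBF a ∧ inBF b ∧ erel a b

/-- `R' = T(R)`: the relation `{⟨{x},{y}⟩ : ⟨x,y⟩ ∈ R}`. -/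
def isTRelOf (R' R : M) : Prop :=
  sset R' ∧ ∀ p, smem p R' ↔
    ∃ x y sx sy, smem (spair x y) R ∧ isSingletonOf sx x ∧ isSingletonOf sy y ∧
      p = spair sx sy

/-- `t' = T(t)` for (isomorphism) types `t` of well-founded relations:
`T([R]) = [{⟨{x},{y}⟩ : ⟨x,y⟩ ∈ R}]`. -/
def isTTypeOf (t' t : M) : Prop :=
  ∃ R R', smem R t ∧ isTRelOf R' R ∧ isTypeOf t' R'

/-- `y = M₀ = E^ω`, the set of types of BFEXTs with finite domain. -/
def isM0Set (y : M) : Prop :=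
  sset y ∧ ∀ a, smem a y ↔
    (inBF a ∧ ∃ R D c, smem R a ∧ isFieldSetOf D R ∧ isCardOf c D ∧ isNat c)

/-- `g` is the internal function `n ↦ M_n = E^{ω+n}` on the internal naturals:
`M_0 = E^ω` and `M_{n+1} = {a ∈ BF : every E-predecessor of a lies in M_n}`. -/
def isMFun (g : M) : Prop :=
  sset g ∧
    (∀ p, smem p g → ∃ n y, isNat n ∧ p = spair n y) ∧
    (∀ n, isNat n → ∃ y, smem (spair n y) g) ∧
    (∀ n y y', smem (spair n y) g → smem (spair n y') g → y = y') ∧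
    (∀ z y, isZeroCard z → smem (spair z y) g → isM0Set y) ∧
    (∀ n n' y y', isNat n → isSuccOf n' n →
      smem (spair n y) g → smem (spair n' y') g →
        (sset y' ∧ ∀ a, smem a y' ↔ (inBF a ∧ ∀ b, inBF b → erel b a → smem b y)))

end BF

end NFUweak
namespace NFUweak

/-! ## The Simple Theory of Types with Infinity (TSTI) -/

/-- Formulae of the many-sorted language `L_TST`, with named variables:
`mem n i j` is `x^n_i ∈_n x^{n+1}_j`, `eq n i j` is `x^n_i = x^n_j`, and
`all n i φ` is `∀ x^n_i, φ`. -/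
inductive TSTFormula : Type
  | mem (n i j : ℕ)
  | eq (n i j : ℕ)
  | fal
  | imp (φ ψ : TSTFormula)
  | all (n i : ℕ) (φ : TSTFormula)

/-- Update a many-sorted valuation at variable `x^n_i`. -/
def tstUpd {M : ℕ → Type} (v : ∀ n, ℕ → M n) (n i : ℕ) (a : M n) : ∀ m, ℕ → M m :=
  fun m j => if h : m = n ∧ j = i then (congrArg M h.1).symm ▸ a else v m j

/-- Satisfaction of an `L_TST`-formula in the many-sorted structure `⟨M, E⟩`
under the valuation `v`. -/
def TSTFormula.Realize {M : ℕ → Type} (E : ∀ n, M n → M (n + 1) → Prop) :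
    TSTFormula → (∀ n, ℕ → M n) → Prop
  | .mem n i j, v => E n (v n i) (v (n + 1) j)
  | .eq n i j, v => v n i = v n j
  | .fal, _ => False
  | .imp φ ψ, v => φ.Realize E v → ψ.Realize E v
  | .all n i φ, v => ∀ a : M n, φ.Realize E (tstUpd v n i a)

/-- All sorts mentioned in the formula are `< k` (so it is an `L_k`-formula). -/
def TSTFormula.sortsLT : TSTFormula → ℕ → Prop
  | .mem n _ _, k => n + 1 < k
  | .eq n _ _, k => n < k
  | .fal, _ => True
  | .imp φ ψ, k => φ.sortsLT k ∧ ψ.sortsLT k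
  | .all n _ φ, k => n < k ∧ φ.sortsLT k

/-- `p : M 2` is the Kuratowski ordered pair `⟨a, b⟩ = {{a},{a,b}}`. -/
def isKPair {M : ℕ → Type} (E : ∀ n, M n → M (n + 1) → Prop)
    (p : M 2) (a b : M 0) : Prop :=
  ∀ s : M 1, E 1 s p ↔
    ((∀ z, E 0 z s ↔ z = a) ∨ (∀ z, E 0 z s ↔ (z = a ∨ z = b)))

/-- The axiom of Infinity: there are `x¹` and `f³` such that `f³` codes an
injective, non-surjective function from `x¹` to `x¹` (with Kuratowski pairs). -/
def TSTInfinity {M : ℕ → Type} (E : ∀ n, M n → M (n + 1) → Prop) : Prop :=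
  ∃ (X : M 1) (f : M 3),
    (∀ p : M 2, E 2 p f → ∃ a b, E 0 a X ∧ E 0 b X ∧ isKPair E p a b) ∧
    (∀ a, E 0 a X → ∃ b p, E 0 b X ∧ E 2 p f ∧ isKPair E p a b) ∧
    (∀ a b b' p p', E 2 p f → E 2 p' f → isKPair E p a b → isKPair E p' a b' → b = b') ∧
    (∀ a a' b p p', E 2 p f → E 2 p' f → isKPair E p a b → isKPair E p' a' b → a = a') ∧
    (∃ b, E 0 b X ∧ ∀ a p, E 2 p f → ¬ isKPair E p a b)

/-- `⟨M, E⟩` is a model of TSTI: all sorts are nonempty and Extensionality,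
Comprehension (for every `L_TST`-formula) and Infinity hold. -/
def IsTSTIModel (M : ℕ → Type) (E : ∀ n, M n → M (n + 1) → Prop) : Prop :=
  (∀ n, Nonempty (M n)) ∧
    (∀ n, ∀ x y : M (n + 1), (∀ z, E n z x ↔ E n z y) → x = y) ∧
    (∀ (φ : TSTFormula) (n i : ℕ) (v : ∀ m, ℕ → M m),
      ∃ y : M (n + 1), ∀ x : M n, E n x y ↔ φ.Realize E (tstUpd v n i x)) ∧
    TSTInfinity E

/-- `⟨M, E⟩` is a model of the fragment TSTI_k, which only refers to the sorts
`< k` (so `k ≥ 4` is needed for the axiom of Infinity to be expressible). -/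
def IsTSTIModelBelow (k : ℕ) (M : ℕ → Type) (E : ∀ n, M n → M (n + 1) → Prop) : Prop :=
  (∀ n, n < k → Nonempty (M n)) ∧
    (∀ n, n + 1 < k → ∀ x y : M (n + 1), (∀ z, E n z x ↔ E n z y) → x = y) ∧
    (∀ (φ : TSTFormula), φ.sortsLT k → ∀ (n i : ℕ), n + 1 < k →
      ∀ v : ∀ m, ℕ → M m,
        ∃ y : M (n + 1), ∀ x : M n, E n x y ↔ φ.Realize E (tstUpd v n i x)) ∧
    TSTInfinity E

/-! ## The language of arithmetic and the internal arithmetic of a model -/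

/-- Function symbols of `L_PA`: `0`, `1`, `+` and `·`. -/
inductive PAFunc : ℕ → Type
  | zero : PAFunc 0
  | one : PAFunc 0
  | add : PAFunc 2
  | mul : PAFunc 2

/-- The language `L_PA` of arithmetic. -/
def LPA : Language := ⟨PAFunc, fun _ => Empty⟩

/-- The type of internal natural numbers of a model of NFU⁻ᴬᶜ. -/
def NatSub (M : Type) [LNFU.Structure M] : Type := {n : M // isNat n}

/-- An `L_PA`-structure on the internal natural numbers of `M` is the internal
arithmetic if its operations are given by the internal graphs of `0`, `1`,
cardinal addition and cardinal multiplication. -/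
def InternalArithOn (M : Type) [LNFU.Structure M] (A : LPA.Structure (NatSub M)) : Prop :=
  isZeroCard (A.funMap PAFunc.zero ![]).val ∧
    isOneCard (A.funMap PAFunc.one ![]).val ∧
    (∀ a b : NatSub M, cardAdd a.val b.val (A.funMap PAFunc.add ![a, b]).val) ∧
    (∀ a b : NatSub M, cardMul a.val b.val (A.funMap PAFunc.mul ![a, b]).val)

/-- `φ^ℕ` holds in `M`: the sentence `φ` of `L_PA` is true in the internal
arithmetic `⟨ℕ, +, ·, 0, 1⟩` of `M`. -/
def internalPASat (M : Type) [LNFU.Structure M] (φ : LPA.Sentence) : Prop :=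
  ∀ A : LPA.Structure (NatSub M), InternalArithOn M A →
    @Sentence.Realize LPA (NatSub M) A φ

end NFUweak
open FirstOrder Language
namespace NFUweak
set_option linter.unusedSectionVars false

/-! ## Definability machinery -/

/-- An auxiliary type-level binary relation. -/
class HasLt (K : Type) where
  ltx : K → K → Prop

abbrev VS (Γ K : Type) := (Γ → K) → ℕ → Prop

/-- extension of a context by one variable -/
def Ext {Γ K : Type} (V : VS Γ K) (k : ℕ) : VS (Γ × K) K := fun f i =>
  (∃ g, V g i ∧ f = fun p => g p.1) ∨ (f = Prod.snd ∧ i = k)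

def V0 {K : Type} : VS Unit K := fun _ _ => False

section Defn
variable {K : Type} [LNFU.Structure K] [HasLt K]

inductive Tm {Γ : Type} (V : VS Γ K) : VS Γ K
  | var {f i} : V f i → Tm V f i
  | cst (c : K) (i : ℕ) : Tm V (fun _ => c) i
  | pair {f g i} : Tm V f i → Tm V g i → Tm V (fun γ => spair (f γ) (g γ)) i

inductive Def : ∀ {Γ : Type}, VS Γ K → (Γ → Prop) → Prop
  | fal {Γ} {V : VS Γ K} : Def V (fun _ => False)
  | eq {Γ} {V : VS Γ K} {f g i} : Tm V f i → Tm V g i → Def V (fun γ => f γ = g γ)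
  | mem {Γ} {V : VS Γ K} {f g i} : Tm V f i → Tm V g (i+1) → Def V (fun γ => smem (f γ) (g γ))
  | set {Γ} {V : VS Γ K} {f i} : Tm V f i → Def V (fun γ => sset (f γ))
  | lt {Γ} {V : VS Γ K} {f g i} : Tm V f i → Tm V g i →
      Def V (fun γ => HasLt.ltx (f γ) (g γ))
  | imp {Γ} {V : VS Γ K} {P Q} : Def V P → Def V Q → Def V (fun γ => P γ → Q γ)
  | all {Γ} {V : VS Γ K} (k : ℕ) {Q : Γ → K → Prop} :
      Def (Ext V k) (fun p => Q p.1 p.2) → Def V (fun γ => ∀ x, Q γ x)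

variable {Γ Γ' : Type} {V : VS Γ K} {V' : VS Γ' K}

theorem Def.congr {P Q : Γ → Prop} (h : Def V P) (e : ∀ γ, P γ ↔ Q γ) : Def V Q := by
  have : P = Q := funext fun γ => propext (e γ)
  exact this ▸ h

theorem Tm.rename (e : Γ' → Γ) (he : ∀ f i, V f i → V' (f ∘ e) i) {f i} (h : Tm V f i) :
    Tm V' (f ∘ e) i := by
  induction h with
  | var h => exact .var (he _ _ h)
  | cst c i => exact .cst c i
  | pair _ _ h1 h2 => exact .pair h1 h2

theorem Def.rename {P : Γ → Prop} (h : Def V P) : ∀ {Γ' : Type} {V' : VS Γ' K} (e : Γ' → Γ)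
    (_ : ∀ f i, V f i → V' (f ∘ e) i), Def V' (P ∘ e) := by
  induction h with
  | fal => intros; exact .fal
  | eq h1 h2 => intro _ _ e he; exact .eq (h1.rename e he) (h2.rename e he)
  | mem h1 h2 => intro _ _ e he; exact .mem (h1.rename e he) (h2.rename e he)
  | set h1 => intro _ _ e he; exact .set (h1.rename e he)
  | lt h1 h2 => intro _ _ e he; exact .lt (h1.rename e he) (h2.rename e he)
  | imp _ _ h1 h2 => intro _ _ e he; exact .imp (h1 e he) (h2 e he)
  | @all Γ V k Q _ ih =>
    intro Γ' V' e he
    refine Def.all (V := V') k (Q := fun γ x => Q (e γ) x) ?_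
    refine ih (V' := Ext V' k) (fun p => (e p.1, p.2)) ?_
    rintro f i (⟨g, hg, rfl⟩ | ⟨rfl, rfl⟩)
    · exact Or.inl ⟨g ∘ e, he _ _ hg, rfl⟩
    · exact Or.inr ⟨rfl, rfl⟩

theorem Def.wk {P : Γ → Prop} (h : Def V P) (k) : Def (Ext V k) (fun p => P p.1) :=
  h.rename (V' := Ext V k) Prod.fst (fun f _ hf => Or.inl ⟨f, hf, rfl⟩)

theorem Def.nott {P : Γ → Prop} (h : Def V P) : Def V (fun γ => ¬ P γ) := .imp h .fal
theorem Def.and {P Q : Γ → Prop} (h : Def V P) (h' : Def V Q) : Def V (fun γ => P γ ∧ Q γ) :=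
  (Def.nott (.imp h (.nott h'))).congr (fun γ => by tauto)
theorem Def.or {P Q : Γ → Prop} (h : Def V P) (h' : Def V Q) : Def V (fun γ => P γ ∨ Q γ) :=
  (Def.imp h.nott h').congr (fun γ => by tauto)
theorem Def.iff {P Q : Γ → Prop} (h : Def V P) (h' : Def V Q) : Def V (fun γ => P γ ↔ Q γ) :=
  ((Def.imp h h').and (.imp h' h)).congr (fun γ => by tauto)
theorem Def.tru : Def V (fun _ => True) := (Def.nott .fal).congr (fun γ => by tauto)
theorem Def.prop (p : Prop) : Def V (fun _ => p) := by
  by_cases h : p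
  · simpa [h] using Def.tru
  · simpa [h] using Def.fal

theorem Def.ex (k : ℕ) {Q : Γ → K → Prop} (h : Def (Ext V k) (fun p => Q p.1 p.2)) :
    Def V (fun γ => ∃ x, Q γ x) :=
  (Def.nott (Def.all k (Q := fun γ x => ¬ Q γ x) h.nott)).congr (fun γ => by push Not; rfl)

/-- graph-definability of a function into `K` -/
def DFnM (V : VS Γ K) (g : Γ → K) (i : ℕ) : Prop := Def (Ext V i) (fun p => p.2 = g p.1)

theorem vsnd {k} : Tm (Ext V k) Prod.snd k := .var (Or.inr ⟨rfl, rfl⟩)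
theorem vfst {k f i} (h : Tm V f i) : Tm (Ext V k) (fun p => f p.1) i :=
  h.rename (V' := Ext V k) Prod.fst (fun f _ hf => Or.inl ⟨f, hf, rfl⟩)

theorem DFnM.rename {g i} (h : DFnM V g i) (e : Γ' → Γ) (he : ∀ f i, V f i → V' (f ∘ e) i) :
    DFnM V' (g ∘ e) i := by
  refine Def.rename (V' := Ext V' i) h (fun p => (e p.1, p.2)) ?_
  rintro f i (⟨g, hg, rfl⟩ | ⟨rfl, rfl⟩)
  · exact Or.inl ⟨g ∘ e, he _ _ hg, rfl⟩
  · exact Or.inr ⟨rfl, rfl⟩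

theorem DFnM.wk {g i} (h : DFnM V g i) (k) : DFnM (Ext V k) (fun p => g p.1) i :=
  h.rename (V' := Ext V k) Prod.fst (fun f _ hf => Or.inl ⟨f, hf, rfl⟩)

theorem DFnM.tm {g i} (h : Tm V g i) : DFnM V g i := .eq vsnd (vfst h)

/-- use a definable function through its graph -/
theorem DFnM.bind {g i} (h : DFnM V g i) {Q : Γ → K → Prop}
    (hQ : Def (Ext V i) (fun p => Q p.1 p.2)) : Def V (fun γ => Q γ (g γ)) :=
  (Def.ex i (Q := fun γ x => x = g γ ∧ Q γ x) (Def.and h hQ)).congr (fun γ => by simp)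

theorem DFnM.pair {f g i} (hf : DFnM V f i) (hg : DFnM V g i) :
    DFnM V (fun γ => spair (f γ) (g γ)) i :=
  DFnM.bind (hf.wk i) (Q := fun p x => p.2 = spair x (g p.1))
    (DFnM.bind ((hg.wk i).wk i) (Q := fun p y => p.1.2 = spair p.2 y)
      (.eq (vfst (vfst vsnd)) (.pair (vfst vsnd) vsnd)))

theorem Tm.subst (e : Γ' → Γ) (he : ∀ f i, V f i → DFnM V' (f ∘ e) i) {f i} (h : Tm V f i) :
    DFnM V' (f ∘ e) i := by
  induction h with
  | var h => exact he _ _ h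
  | cst c i => exact .tm (.cst c i)
  | pair _ _ h1 h2 => exact .pair h1 h2

theorem DFnM.eq {f g i} (hf : DFnM V f i) (hg : DFnM V g i) : Def V (fun γ => f γ = g γ) :=
  hf.bind (Q := fun γ x => x = g γ) hg
theorem DFnM.mem {f g i} (hf : DFnM V f i) (hg : DFnM V g (i+1)) :
    Def V (fun γ => smem (f γ) (g γ)) :=
  hf.bind (Q := fun γ x => smem x (g γ)) ((hg.wk i).bind (Q := fun p y => smem p.2 y)
    (.mem (vfst vsnd) vsnd))
theorem DFnM.lt {f g i} (hf : DFnM V f i) (hg : DFnM V g i) :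
    Def V (fun γ => HasLt.ltx (f γ) (g γ)) :=
  hf.bind (Q := fun γ x => HasLt.ltx x (g γ)) ((hg.wk i).bind (Q := fun p y => HasLt.ltx p.2 y)
    (.lt (vfst vsnd) vsnd))
theorem DFnM.set {f i} (hf : DFnM V f i) : Def V (fun γ => sset (f γ)) :=
  hf.bind (Q := fun _ x => sset x) (.set vsnd)

theorem Def.subst {P : Γ → Prop} (h : Def V P) : ∀ {Γ' : Type} {V' : VS Γ' K} (e : Γ' → Γ)
    (_ : ∀ f i, V f i → DFnM V' (f ∘ e) i), Def V' (P ∘ e) := by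
  induction h with
  | fal => intros; exact .fal
  | eq h1 h2 => intro _ _ e he; exact DFnM.eq (h1.subst e he) (h2.subst e he)
  | mem h1 h2 => intro _ _ e he; exact DFnM.mem (h1.subst e he) (h2.subst e he)
  | set h1 => intro _ _ e he; exact DFnM.set (h1.subst e he)
  | lt h1 h2 => intro _ _ e he; exact DFnM.lt (h1.subst e he) (h2.subst e he)
  | imp _ _ h1 h2 => intro _ _ e he; exact .imp (h1 e he) (h2 e he)
  | @all Γ V k Q _ ih =>
    intro Γ' V' e he
    refine Def.all (V := V') k (Q := fun γ x => Q (e γ) x) ?_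
    refine ih (V' := Ext V' k) (fun p => (e p.1, p.2)) ?_
    rintro f i (⟨g, hg, rfl⟩ | ⟨rfl, rfl⟩)
    · exact (he _ _ hg).wk k
    · exact .tm vsnd

end Defn

/-- abstract models -/
class Mdl (K : Type) [LNFU.Structure K] [HasLt K] : Prop where
  ne : Nonempty K
  comp : ∀ (k : ℕ) (P : K → Prop), Def (Ext V0 k) (fun p => P p.2) →
    ∃ y, sset y ∧ ∀ x, smem x y ↔ P x
  ext : ∀ x y : K, sset x → sset y → (∀ z, smem z x ↔ smem z y) → x = y
  pinj : ∀ x y w z : K, spair x y = spair w z → x = w ∧ y = z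

end NFUweak

open FirstOrder Language
namespace NFUweak
set_option linter.unusedSectionVars false

/-! ## Translation between `Def` and formulas -/
section Trans
variable {K : Type} [LNFU.Structure K] [HasLt K] {Γ : Type} {V : VS Γ K}

def lvl {m : ℕ} (lv : Fin m → ℕ) : (Empty ⊕ Fin m) → ℕ := Sum.elim (fun e => e.elim) lv

theorem Tm.toTerm {f i} (h : Tm V f i) : ∃ L : List (K × ℕ), ∀ (m : ℕ) (r : Γ → Fin m → K)
    (lv : Fin m → ℕ), (∀ f i, V f i → ∃ j, (∀ γ, r γ j = f γ) ∧ lv j = i) →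
    (∀ c ∈ L, ∃ j, (∀ γ, r γ j = c.1) ∧ lv j = c.2) →
    ∃ t : LNFU.Term (Empty ⊕ Fin m), termLevel (lvl lv) t i ∧
      ∀ γ, t.realize (Sum.elim (default : Empty → K) (r γ)) = f γ := by
  induction h with
  | var h =>
    refine ⟨[], fun m r lv hV _ => ?_⟩
    obtain ⟨j, h1, h2⟩ := hV _ _ h
    exact ⟨Term.var (Sum.inr j), h2, fun γ => by simp [h1]⟩
  | cst c i =>
    refine ⟨[(c, i)], fun m r lv _ hL => ?_⟩
    obtain ⟨j, h1, h2⟩ := hL _ (List.mem_singleton.2 rfl)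
    exact ⟨Term.var (Sum.inr j), h2, fun γ => by simp [h1]⟩
  | pair _ _ ih1 ih2 =>
    obtain ⟨L1, h1⟩ := ih1
    obtain ⟨L2, h2⟩ := ih2
    refine ⟨L1 ++ L2, fun m r lv hV hL => ?_⟩
    obtain ⟨t1, a1, b1⟩ := h1 m r lv hV (fun c hc => hL c (by simp [hc]))
    obtain ⟨t2, a2, b2⟩ := h2 m r lv hV (fun c hc => hL c (by simp [hc]))
    refine ⟨pairF.apply₂ t1 t2, ?_, fun γ => ?_⟩
    · intro i
      fin_cases i
      · exact a1
      · exact a2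
    · rw [Term.realize_functions_apply₂, b1, b2]; rfl

theorem Def.toFormula (hlt : ∀ x y : K, ¬ HasLt.ltx x y) {P : Γ → Prop} (h : Def V P) :
    ∃ L : List (K × ℕ), ∀ (m : ℕ) (r : Γ → Fin m → K)
    (lv : Fin m → ℕ), (∀ f i, V f i → ∃ j, (∀ γ, r γ j = f γ) ∧ lv j = i) →
    (∀ c ∈ L, ∃ j, (∀ γ, r γ j = c.1) ∧ lv j = c.2) →
    ∃ t : LNFU.BoundedFormula Empty m, stratifiedFrom (lvl lv) t ∧
      ∀ γ, t.Realize (default : Empty → K) (r γ) ↔ P γ := by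
  induction h with
  | fal => exact ⟨[], fun m r lv _ _ => ⟨.falsum, trivial, fun γ => Iff.rfl⟩⟩
  | eq h1 h2 =>
    obtain ⟨L1, h1⟩ := h1.toTerm
    obtain ⟨L2, h2⟩ := h2.toTerm
    refine ⟨L1 ++ L2, fun m r lv hV hL => ?_⟩
    obtain ⟨t1, a1, b1⟩ := h1 m r lv hV (fun c hc => hL c (by simp [hc]))
    obtain ⟨t2, a2, b2⟩ := h2 m r lv hV (fun c hc => hL c (by simp [hc]))
    exact ⟨.equal t1 t2, ⟨_, a1, a2⟩, fun γ => by simp [BoundedFormula.Realize, b1, b2]⟩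
  | mem h1 h2 =>
    obtain ⟨L1, h1⟩ := h1.toTerm
    obtain ⟨L2, h2⟩ := h2.toTerm
    refine ⟨L1 ++ L2, fun m r lv hV hL => ?_⟩
    obtain ⟨t1, a1, b1⟩ := h1 m r lv hV (fun c hc => hL c (by simp [hc]))
    obtain ⟨t2, a2, b2⟩ := h2 m r lv hV (fun c hc => hL c (by simp [hc]))
    exact ⟨memR.boundedFormula₂ t1 t2, ⟨_, a1, a2⟩, fun γ => by
      rw [BoundedFormula.realize_rel₂, b1, b2]; rfl⟩
  | set h1 =>
    obtain ⟨L1, h1⟩ := h1.toTerm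
    refine ⟨L1, fun m r lv hV hL => ?_⟩
    obtain ⟨t1, a1, b1⟩ := h1 m r lv hV hL
    exact ⟨setR.boundedFormula₁ t1, ⟨_, a1⟩, fun γ => by
      rw [BoundedFormula.realize_rel₁, b1]; rfl⟩
  | lt h1 h2 =>
    exact ⟨[], fun m r lv _ _ => ⟨.falsum, trivial, fun γ => by
      simp only [BoundedFormula.Realize, hlt]⟩⟩
  | imp _ _ h1 h2 =>
    obtain ⟨L1, h1⟩ := h1
    obtain ⟨L2, h2⟩ := h2
    refine ⟨L1 ++ L2, fun m r lv hV hL => ?_⟩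
    obtain ⟨t1, a1, b1⟩ := h1 m r lv hV (fun c hc => hL c (by simp [hc]))
    obtain ⟨t2, a2, b2⟩ := h2 m r lv hV (fun c hc => hL c (by simp [hc]))
    exact ⟨.imp t1 t2, ⟨a1, a2⟩, fun γ => by simp [BoundedFormula.realize_imp, b1, b2]⟩
  | @all Γ V k Q _ ih =>
    obtain ⟨L, h⟩ := ih
    refine ⟨L, fun m r lv hV hL => ?_⟩
    obtain ⟨t, a, b⟩ := h (m + 1) (fun p => Fin.snoc (r p.1) p.2) (Fin.snoc lv k) (by
      rintro f i (⟨g, hg, rfl⟩ | ⟨rfl, rfl⟩)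
      · obtain ⟨j, h1, h2⟩ := hV _ _ hg
        exact ⟨j.castSucc, fun γ => by simp [h1], by simp [h2]⟩
      · exact ⟨Fin.last m, fun γ => by simp, by simp⟩) (by
      intro c hc
      obtain ⟨j, h1, h2⟩ := hL c hc
      exact ⟨j.castSucc, fun γ => by simp [h1], by simp [h2]⟩)
    refine ⟨.all t, ⟨k, ?_⟩, fun γ => ?_⟩
    · convert a using 1
      ext x; rcases x with x | x
      · exact x.elim
      · rfl
    · rw [BoundedFormula.realize_all]
      exact forall_congr' fun x => b (γ, x)

theorem mdl_of_model (hlt : ∀ x y : K, ¬ HasLt.ltx x y) (hne : Nonempty K)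
    (hM : Theory.Model K NFUmAC) : Mdl K where
  ne := hne
  ext := by
    have h := hM.realize_of_mem weakExtAx (Or.inl (Or.inl rfl))
    intro x y hx hy hz
    simp only [weakExtAx, Sentence.Realize, Formula.Realize, BoundedFormula.realize_all,
      BoundedFormula.realize_imp, BoundedFormula.realize_inf, BoundedFormula.realize_rel₁,
      BoundedFormula.realize_iff, BoundedFormula.realize_rel₂, BoundedFormula.realize_bdEqual] at h
    exact (h x y ⟨hx, hy⟩).2 hz
  pinj := by
    have h := hM.realize_of_mem pairingAx (Or.inl (Or.inr rfl))
    intro x y w z hz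
    simp only [pairingAx, Sentence.Realize, Formula.Realize, BoundedFormula.realize_all,
      BoundedFormula.realize_imp, BoundedFormula.realize_inf, Term.realize_functions_apply₂,
      BoundedFormula.realize_bdEqual] at h
    exact h x y w z hz
  comp := by
    intro k P hP
    obtain ⟨L, h⟩ := hP.toFormula hlt
    obtain ⟨φ, h1, h2⟩ := h (L.length + 1) (fun p => Fin.snoc (fun j => (L.get j).1) p.2)
      (Fin.snoc (fun j => (L.get j).2) k) (by
        rintro f i (⟨g, hg, rfl⟩ | ⟨rfl, rfl⟩)
        · exact hg.elim
        · exact ⟨Fin.last _, fun γ => by simp, by simp⟩) (by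
        intro c hc
        obtain ⟨j, rfl⟩ := List.mem_iff_get.1 hc
        exact ⟨j.castSucc, fun γ => by simp, by simp⟩)
    have h := hM.realize_of_mem (comprehensionAx L.length φ) (Or.inr ⟨_, _, ⟨_, h1⟩, rfl⟩)
    rw [comprehensionAx, Sentence.Realize, BoundedFormula.realize_alls] at h
    have h := h (fun j => (L.get j).1)
    simp only [BoundedFormula.realize_all, BoundedFormula.realize_ex,
      BoundedFormula.realize_inf, BoundedFormula.realize_rel₁,
      BoundedFormula.realize_iff, BoundedFormula.realize_rel₂] at h
    obtain ⟨y, hy, hx⟩ := h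
    refine ⟨y, ?_, fun x => ?_⟩
    · convert hy using 2
      simp [Fin.snoc, sset]
    · rw [← h2 ((), x)]
      convert hx x using 1
      · simp [smem, Fin.snoc]
      · rw [BoundedFormula.realize_liftAt_one (by omega)]
        convert Iff.rfl using 2
        ext i
        refine Fin.lastCases ?_ (fun i => ?_) i
        · simp [Fin.snoc]
        · simp only [Function.comp, Fin.val_castSucc, i.2, if_true, Fin.snoc_castSucc]

theorem Term.toDef {n : ℕ} (σ : Fin n → ℕ) (t : LNFU.Term (Empty ⊕ Fin n)) (k : ℕ)
    (h : termLevel (lvl σ) t k) :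
    Tm (K := K) (Γ := Fin n → K) (fun f i => ∃ j, f = (fun v => v j) ∧ i = σ j)
      (fun v => t.realize (Sum.elim (default : Empty → K) v)) k := by
  induction t with
  | var x =>
    rcases x with x | x
    · exact x.elim
    · exact .var ⟨x, rfl, h.symm⟩
  | func F ts ih =>
    rcases F with _ | _
    have e : (fun v => Term.realize (Sum.elim (default : Empty → K) v) (Term.func NFUFunc.pair ts))
      = fun v => spair ((ts 0).realize (Sum.elim (default : Empty → K) v))
          ((ts 1).realize (Sum.elim (default : Empty → K) v)) := by
      ext v
      simp only [Term.realize, spair]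
      congr 1
      ext i
      fin_cases i <;> rfl
    rw [e]
    exact .pair (ih 0 (h 0)) (ih 1 (h 1))

theorem Formula.toDef {n : ℕ} (φ : LNFU.BoundedFormula Empty n) : ∀ (σ : Fin n → ℕ)
    (_ : stratifiedFrom (lvl σ) φ),
    Def (K := K) (Γ := Fin n → K) (fun f i => ∃ j, f = (fun v => v j) ∧ i = σ j)
      (fun v => φ.Realize (default : Empty → K) v) := by
  induction φ with
  | falsum => intros; exact .fal
  | equal t s =>
    rintro σ ⟨k, h1, h2⟩
    exact .eq (Term.toDef σ t k h1) (Term.toDef σ s k h2)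
  | rel R ts =>
    intro σ h
    rcases R with _ | _
    · obtain ⟨k, h1, h2⟩ := h
      refine Def.congr (.mem (Term.toDef σ (ts 0) k h1) (Term.toDef σ (ts 1) (k+1) h2)) fun v => ?_
      apply iff_of_eq
      show Structure.RelMap memR _ = Structure.RelMap memR _
      congr 1
      ext i
      fin_cases i <;> rfl
    · obtain ⟨k, h1⟩ := h
      refine Def.congr (.set (Term.toDef σ (ts 0) k h1)) fun v => ?_
      apply iff_of_eq
      show Structure.RelMap setR _ = Structure.RelMap setR _
      congr 1
      ext i
      fin_cases i; rfl
  | imp _ _ h1 h2 => rintro σ ⟨a, b⟩; exact .imp (h1 σ a) (h2 σ b)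
  | @all n f ih =>
    rintro σ ⟨k, h⟩
    have := ih (Fin.snoc σ k) (by convert h using 1; ext x; rcases x with x | x; exact x.elim; rfl)
    refine Def.congr (Def.all k (Q := fun v x => f.Realize default (Fin.snoc v x)) ?_)
      (fun v => Iff.rfl)
    refine this.rename (fun p : (Fin n → K) × K => Fin.snoc p.1 p.2) ?_
    rintro g i ⟨j, rfl, rfl⟩
    refine Fin.lastCases ?_ (fun j => ?_) j
    · exact Or.inr ⟨by ext p; simp, by simp⟩
    · exact Or.inl ⟨fun v => v j, ⟨j, rfl, by simp⟩, by ext p; simp⟩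

theorem model_of_mdl [Mdl K] : Theory.Model K NFUmAC where
  realize_of_mem := by
    rintro s ((rfl | rfl) | ⟨m, φ, ⟨σ, hσ⟩, rfl⟩)
    · simp only [weakExtAx, Sentence.Realize, Formula.Realize, BoundedFormula.realize_all,
        BoundedFormula.realize_imp, BoundedFormula.realize_inf, BoundedFormula.realize_rel₁,
        BoundedFormula.realize_iff, BoundedFormula.realize_rel₂, BoundedFormula.realize_bdEqual]
      intro x y ⟨hx, hy⟩
      exact ⟨fun e z => by
        have e : x = y := e
        subst e; exact Iff.rfl, fun h => Mdl.ext x y hx hy h⟩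
    · simp only [pairingAx, Sentence.Realize, Formula.Realize, BoundedFormula.realize_all,
        BoundedFormula.realize_imp, BoundedFormula.realize_inf, Term.realize_functions_apply₂,
        BoundedFormula.realize_bdEqual]
      intro x y w z h
      exact Mdl.pinj x y w z h
    · rw [comprehensionAx, Sentence.Realize, BoundedFormula.realize_alls]
      intro xs
      simp only [BoundedFormula.realize_all, BoundedFormula.realize_ex,
        BoundedFormula.realize_inf, BoundedFormula.realize_rel₁,
        BoundedFormula.realize_iff, BoundedFormula.realize_rel₂]
      have hd := Formula.toDef (K := K) φ (fun i => σ (Sum.inr i)) (by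
        convert hσ using 1; ext x; rcases x with x | x; exact x.elim; rfl)
      obtain ⟨y, h1, h2⟩ := Mdl.comp (K := K) (σ (Sum.inr (Fin.last m)))
        (fun x => φ.Realize default (Fin.snoc xs x : Fin (m+1) → K)) (by
          refine hd.subst (fun p : Unit × K => (Fin.snoc xs p.2 : Fin (m+1) → K)) ?_
          rintro g i ⟨j, rfl, rfl⟩
          apply DFnM.tm
          refine Fin.lastCases ?_ (fun j => ?_) j
          · exact .var (Or.inr ⟨by ext p; simp, rfl⟩)
          · convert Tm.cst (xs j) _ using 1
            ext p; simp)
      refine ⟨y, ?_, fun x => ?_⟩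
      · convert h1 using 2
        simp [Fin.snoc, sset]
      · convert h2 x using 1
        · simp [smem, Fin.snoc]
        · rw [BoundedFormula.realize_liftAt_one (by omega)]
          convert Iff.rfl using 2
          ext i
          refine Fin.lastCases ?_ (fun i => ?_) i
          · simp [Fin.snoc]
          · simp only [Function.comp, Fin.val_castSucc, i.2, if_true, Fin.snoc_castSucc]
end Trans
end NFUweak

open FirstOrder Language
namespace NFUweak
set_option linter.unusedSectionVars false

/-! ## Internal sets as types -/

class ISet (K : Type) [LNFU.Structure K] (X : Type) where
  val : X → K
  inj : Function.Injective val
  code : ∃ A, sset A ∧ ∀ z, smem z A ↔ ∃ x, val x = z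

def vl {K X : Type} [LNFU.Structure K] [ISet K X] (x : X) : K := ISet.val x

section
variable {K : Type} [LNFU.Structure K] [HasLt K] [Mdl K]

theorem vl_inj {X : Type} [ISet K X] {x y : X} (h : (vl x : K) = vl y) : x = y := ISet.inj h

def ExtX {Γ : Type} (V : VS Γ K) (X : Type) [ISet K X] (k : ℕ) : VS (Γ × X) K := fun f i =>
  (∃ g, V g i ∧ f = fun p => g p.1) ∨ (f = (fun p => vl p.2) ∧ i = k)

variable {Γ Γ' : Type} {V : VS Γ K} {V' : VS Γ' K} {X Y Z W : Type}
  [ISet K X] [ISet K Y] [ISet K Z] [ISet K W]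

def DFn (V : VS Γ K) (f : Γ → X) (i : ℕ) : Prop := DFnM V (fun γ => vl (f γ)) i

theorem Def.allX (k : ℕ) {Q : Γ → X → Prop} (h : Def (ExtX V X k) (fun p => Q p.1 p.2)) :
    Def V (fun γ => ∀ x, Q γ x) := by
  classical
  by_cases hX : Nonempty X
  swap
  · have : IsEmpty X := not_nonempty_iff.1 hX
    exact Def.tru.congr (fun γ => by simp)
  obtain ⟨x0⟩ := hX
  obtain ⟨A, _, hA⟩ := ISet.code (K := K) (X := X)
  let dec : K → X := fun z => if h : ∃ x : X, (vl x : K) = z then h.choose else x0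
  have hdec : ∀ x : X, dec (vl x) = x := fun x => by
    have h : ∃ x' : X, (vl x' : K) = vl x := ⟨x, rfl⟩
    simp only [dec, dif_pos h]
    exact vl_inj h.choose_spec
  have key : Def (Ext V k) (fun p => smem p.2 A → Q p.1 (dec p.2)) := by
    refine .imp (.mem vsnd (.cst A _)) ?_
    refine h.subst (fun p : Γ × K => (p.1, dec p.2)) ?_
    rintro f i (⟨g, hg, rfl⟩ | ⟨rfl, rfl⟩)
    · exact .tm (.var (Or.inl ⟨g, hg, rfl⟩))
    · have : Def (Ext (Ext V i) i) (fun q => (smem q.1.2 A ∧ q.2 = q.1.2) ∨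
          (¬ smem q.1.2 A ∧ q.2 = vl x0)) :=
        .or (.and (.mem (vfst vsnd) (.cst A _)) (.eq vsnd (vfst vsnd)))
          (.and (.nott (.mem (vfst vsnd) (.cst A _))) (.eq vsnd (.cst _ _)))
      refine this.congr ?_
      rintro ⟨⟨γ, z⟩, y⟩
      simp only [Function.comp]
      by_cases hz : ∃ x : X, (vl x : K) = z
      · obtain ⟨x, rfl⟩ := hz
        have : smem (vl x : K) A := (hA _).2 ⟨x, rfl⟩
        simp [this, hdec]
      · have h' : ¬ smem z A := fun h => hz ((hA z).1 h)
        have : dec z = x0 := by simp only [dec, dif_neg hz]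
        simp [h', this]
  refine (Def.all k (Q := fun γ z => smem z A → Q γ (dec z)) key).congr
    fun γ => ⟨fun h x => ?_, fun h z _ => h _⟩
  have := h (vl x) ((hA _).2 ⟨x, rfl⟩)
  rwa [hdec] at this

theorem Def.exX (k : ℕ) {Q : Γ → X → Prop} (h : Def (ExtX V X k) (fun p => Q p.1 p.2)) :
    Def V (fun γ => ∃ x, Q γ x) :=
  (Def.nott (Def.allX k (Q := fun γ x => ¬ Q γ x) h.nott)).congr (fun γ => by push Not; rfl)

theorem Def.compX {P : Γ × X → Prop} {k} (h : Def (ExtX V X k) P) {e : Γ' → Γ} {f : Γ' → X}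
    (he : ∀ g i, V g i → DFnM V' (g ∘ e) i) (hf : DFn V' f k) : Def V' (fun γ => P (e γ, f γ)) := by
  refine h.subst (fun γ => (e γ, f γ)) ?_
  rintro g i (⟨g, hg, rfl⟩ | ⟨rfl, rfl⟩)
  · exact he g i hg
  · exact hf

theorem ext_he {V1 : VS Γ K} {k} {e : Γ' → Γ} {f : Γ' → X}
    (he : ∀ g i, V1 g i → DFnM V' (g ∘ e) i) (hf : DFn V' f k) :
    ∀ g i, ExtX V1 X k g i → DFnM V' (g ∘ fun γ => (e γ, f γ)) i := by
  rintro g i (⟨g, hg, rfl⟩ | ⟨rfl, rfl⟩)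
  · exact he g i hg
  · exact hf

theorem v0_he : ∀ g i, (V0 : VS Unit K) g i → DFnM V' (g ∘ fun _ => ()) i := fun _ _ h => h.elim

abbrev C1 (K : Type) [LNFU.Structure K] (X : Type) [ISet K X] (k : ℕ) : VS (Unit × X) K :=
  ExtX V0 X k
abbrev C2 (K : Type) [LNFU.Structure K] (X : Type) [ISet K X] (k : ℕ) (Y : Type) [ISet K Y]
    (l : ℕ) : VS ((Unit × X) × Y) K := ExtX (C1 K X k) Y l
abbrev C3 (K : Type) [LNFU.Structure K] (X : Type) [ISet K X] (k : ℕ) (Y : Type) [ISet K Y]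
    (l : ℕ) (Z : Type) [ISet K Z] (m : ℕ) : VS (((Unit × X) × Y) × Z) K := ExtX (C2 K X k Y l) Z m

theorem Def.c1 {P : X → Prop} {k} (h : Def (C1 K X k) (fun p => P p.2)) {f : Γ → X}
    (hf : DFn V f k) : Def V (fun γ => P (f γ)) :=
  h.subst (fun γ => ((), f γ)) (ext_he v0_he hf)
theorem Def.c2 {P : X → Y → Prop} {k l} (h : Def (C2 K X k Y l) (fun p => P p.1.2 p.2)) {f : Γ → X}
    {g : Γ → Y} (hf : DFn V f k) (hg : DFn V g l) : Def V (fun γ => P (f γ) (g γ)) :=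
  h.subst (fun γ => (((), f γ), g γ)) (ext_he (ext_he v0_he hf) hg)
theorem Def.c3 {P : X → Y → Z → Prop} {k l m}
    (h : Def (C3 K X k Y l Z m) (fun p => P p.1.1.2 p.1.2 p.2)) {f : Γ → X}
    {g : Γ → Y} {q : Γ → Z} (hf : DFn V f k) (hg : DFn V g l) (hq : DFn V q m) :
    Def V (fun γ => P (f γ) (g γ) (q γ)) :=
  h.subst (fun γ => ((((), f γ), g γ), q γ)) (ext_he (ext_he (ext_he v0_he hf) hg) hq)

theorem DFn.var0 {k} : DFn (ExtX V X k) (fun p => p.2) k := .tm (.var (Or.inr ⟨rfl, rfl⟩))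
theorem DFn.wk {f : Γ → X} {i k} (h : DFn V f i) : DFn (ExtX V Y k) (fun p => f p.1) i :=
  h.rename (V' := ExtX V Y k) Prod.fst (fun f _ hf => Or.inl ⟨f, hf, rfl⟩)
theorem Def.wkX {P : Γ → Prop} {k} (h : Def V P) : Def (ExtX V Y k) (fun p => P p.1) :=
  h.rename (V' := ExtX V Y k) Prod.fst (fun f _ hf => Or.inl ⟨f, hf, rfl⟩)
theorem DFn.cst (c : X) {i} : DFn V (fun _ => c) i := .tm (.cst _ _)
theorem DFn.eq {f g : Γ → X} {i} (hf : DFn V f i) (hg : DFn V g i) : Def V (fun γ => f γ = g γ) :=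
  (DFnM.eq hf hg).congr fun _ => ⟨vl_inj, fun h => by rw [h]⟩

/-- definable functions from definable graphs -/
theorem DFn.of_graph {f : Γ → X} {i} (R : Γ → X → Prop) (hR : ∀ γ x, R γ x ↔ x = f γ)
    (h : Def (ExtX V X i) (fun p => R p.1 p.2)) : DFn V f i := by
  have : Def (Ext V i) (fun p => ∃ x : X, R p.1 x ∧ p.2 = vl x) := by
    refine Def.exX i (Q := fun (p : Γ × K) x => R p.1 x ∧ p.2 = vl x) (.and ?_ ?_)
    · refine h.rename (fun q : (Γ × K) × X => (q.1.1, q.2)) ?_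
      rintro f i (⟨g, hg, rfl⟩ | ⟨rfl, rfl⟩)
      · exact Or.inl ⟨_, Or.inl ⟨g, hg, rfl⟩, rfl⟩
      · exact Or.inr ⟨rfl, rfl⟩
    · exact .eq (.var (Or.inl ⟨Prod.snd, Or.inr ⟨rfl, rfl⟩, rfl⟩)) (.var (Or.inr ⟨rfl, rfl⟩))
  exact this.congr fun p => by simp [hR]

theorem DFn.graph {f : Γ → X} {i} (h : DFn V f i) : Def (ExtX V X i) (fun p => p.2 = f p.1) :=
  DFn.eq .var0 (.wk h)

theorem DFn.c1 {F : X → W} {k i} (h : DFn (C1 K X k) (fun p => F p.2) i) {f : Γ → X}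
    (hf : DFn V f k) : DFn V (fun γ => F (f γ)) i := by
  refine DFn.of_graph (fun γ x => x = F (f γ)) (fun _ _ => Iff.rfl) ?_
  exact h.graph.subst (fun q : Γ × W => (((), f q.1), q.2)) (ext_he (ext_he v0_he (.wk hf)) .var0)
theorem DFn.c2 {F : X → Y → W} {k l i} (h : DFn (C2 K X k Y l) (fun p => F p.1.2 p.2) i)
    {f : Γ → X} {g : Γ → Y} (hf : DFn V f k) (hg : DFn V g l) :
    DFn V (fun γ => F (f γ) (g γ)) i := by
  refine DFn.of_graph (fun γ x => x = F (f γ) (g γ)) (fun _ _ => Iff.rfl) ?_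
  exact h.graph.subst (fun q : Γ × W => ((((), f q.1), g q.1), q.2))
    (ext_he (ext_he (ext_he v0_he (.wk hf)) (.wk hg)) .var0)

/-! instances -/
instance : ISet K K where
  val := id
  inj := Function.injective_id
  code := by
    obtain ⟨y, h, h2⟩ := Mdl.comp (K := K) 0 (fun _ => True) .tru
    exact ⟨y, h, fun z => by simp [h2]⟩

@[simp] theorem vl_self (x : K) : (vl x : K) = x := rfl

theorem DFn.spair {f g : Γ → K} {i} (hf : DFn V f i) (hg : DFn V g i) :
    DFn V (fun γ => spair (f γ) (g γ)) i := DFnM.pair hf hg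
theorem DFn.vl {f : Γ → X} {i} (hf : DFn V f i) : DFn V (fun γ => (vl (f γ) : K)) i := hf
theorem DFn.smem {f : Γ → K} {g : Γ → K} {i} (hf : DFn V f i) (hg : DFn V g (i+1)) :
    Def V (fun γ => smem (f γ) (g γ)) := DFnM.mem hf hg
theorem DFn.sset {f : Γ → K} {i} (hf : DFn V f i) : Def V (fun γ => sset (f γ)) := DFnM.set hf
theorem DFn.ltx {f g : Γ → K} {i} (hf : DFn V f i) (hg : DFn V g i) :
    Def V (fun γ => HasLt.ltx (f γ) (g γ)) := DFnM.lt hf hg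

theorem compX {k} (P : K → Prop) (h : Def (C1 K K k) (fun p => P p.2)) :
    ∃ y, sset y ∧ ∀ x, smem x y ↔ P x := by
  refine Mdl.comp k P (h.rename id ?_)
  rintro f i (⟨g, hg, rfl⟩ | ⟨rfl, rfl⟩)
  · exact hg.elim
  · exact Or.inr ⟨rfl, rfl⟩

/-- internal predicates -/
def IPred (K : Type) [LNFU.Structure K] {X : Type} [ISet K X] (P : X → Prop) : Prop :=
  ∃ A : K, sset A ∧ ∀ z, smem z A ↔ ∃ x, P x ∧ vl x = z

theorem IPred.mk {P : X → Prop} {k} (h : Def (C1 K X k) (fun p => P p.2)) : IPred K P := by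
  refine compX (k := k) _ ?_
  exact Def.exX k (.and (Def.c1 h .var0) (DFn.eq (K := K) (DFn.vl .var0) (.wk .var0)))

theorem IPred.iff {P : X → Prop} {A : K} (h : ∀ z, smem z A ↔ ∃ x, P x ∧ vl x = z) (x : X) :
    P x ↔ smem (vl x) A :=
  by rw [h]; exact ⟨fun h => ⟨x, h, rfl⟩, fun ⟨_, h, e⟩ => vl_inj e ▸ h⟩

theorem IPred.df {P : X → Prop} (h : IPred K P) {f : Γ → X} {i} (hf : DFn V f i) :
    Def V (fun γ => P (f γ)) := by
  obtain ⟨A, _, hA⟩ := h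
  exact (DFn.smem (DFn.vl hf) (.cst A)).congr fun γ => (IPred.iff hA _).symm

theorem Def.ipred {P : X → Prop} {f : Γ → X} {i} (hf : DFn V f i) (h : IPred K P) :
    Def V (fun γ => P (f γ)) := h.df hf

instance instISub {P : X → Prop} [h : Fact (IPred K P)] : ISet K {x // P x} where
  val x := vl x.1
  inj _ _ h := Subtype.ext (vl_inj h)
  code := by
    obtain ⟨A, hs, h⟩ := h.out
    exact ⟨A, hs, fun z => by rw [h]; simp⟩

theorem DFn.sval {P : X → Prop} [Fact (IPred K P)] {f : Γ → {x // P x}} {i} (hf : DFn V f i) :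
    DFn V (fun γ => (f γ).1) i := hf
theorem DFn.smk {P : X → Prop} [Fact (IPred K P)] {f : Γ → X} {hP : ∀ γ, P (f γ)} {i}
    (hf : DFn V f i) : DFn V (fun γ => (⟨f γ, hP γ⟩ : {x // P x})) i := hf

instance instIProd : ISet K (X × Y) where
  val x := spair (vl x.1) (vl x.2)
  inj := by
    rintro ⟨a, b⟩ ⟨c, d⟩ h
    obtain ⟨h1, h2⟩ := Mdl.pinj _ _ _ _ h
    exact Prod.ext (vl_inj h1) (vl_inj h2)
  code := by
    obtain ⟨A, h⟩ := compX (K := K) (k := 0) (fun z => ∃ (x : X) (y : Y), spair (vl x) (vl y) = z)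
      (Def.exX 0 (Def.exX 0 (DFn.eq (K := K) (X := K) (.spair (.vl (.wk .var0)) (.vl .var0))
        (.wk (.wk .var0)))))
    exact ⟨A, h.1, fun z => by rw [h.2]; simp⟩

theorem vl_pair (x : X) (y : Y) : (vl (x, y) : K) = spair (vl x) (vl y) := rfl
theorem DFn.pair {f : Γ → X} {g : Γ → Y} {i} (hf : DFn V f i) (hg : DFn V g i) :
    DFn V (fun γ => (f γ, g γ)) i := DFnM.pair hf hg
theorem DFn.fst {f : Γ → X × Y} {i} (hf : DFn V f i) : DFn V (fun γ => (f γ).1) i :=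
  .of_graph (fun γ x => ∃ y, f γ = (x, y))
    (fun γ x => ⟨fun ⟨y, h⟩ => by rw [h], fun h => ⟨(f γ).2, by rw [h]⟩⟩)
    (.exX i (DFn.eq (.wk (.wk hf)) (.pair (.wk .var0) .var0)))
theorem DFn.snd {f : Γ → X × Y} {i} (hf : DFn V f i) : DFn V (fun γ => (f γ).2) i :=
  .of_graph (fun γ x => ∃ y, f γ = (y, x))
    (fun γ x => ⟨fun ⟨y, h⟩ => by rw [h], fun h => ⟨(f γ).1, by rw [h]⟩⟩)
    (.exX i (DFn.eq (.wk (.wk hf)) (.pair .var0 (.wk .var0))))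

/-- internal relations and functions -/
def IRel (K : Type) [LNFU.Structure K] [HasLt K] [Mdl K] {X Y : Type} [ISet K X] [ISet K Y]
    (Q : X → Y → Prop) : Prop := IPred K (fun p : X × Y => Q p.1 p.2)
theorem IRel.mk {Q : X → Y → Prop} {k} (h : Def (C2 K X k Y k) (fun p => Q p.1.2 p.2)) :
    IRel K Q := IPred.mk (k := k) (Def.c2 h (.fst .var0) (.snd .var0))
theorem IRel.df {Q : X → Y → Prop} (h : IRel K Q) {f : Γ → X} {g : Γ → Y} {i} (hf : DFn V f i)
    (hg : DFn V g i) : Def V (fun γ => Q (f γ) (g γ)) := IPred.df h (.pair hf hg)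
def IFun (K : Type) [LNFU.Structure K] [HasLt K] [Mdl K] {X Y : Type} [ISet K X] [ISet K Y]
    (f : X → Y) : Prop := IRel K (fun x y => y = f x)
theorem IFun.mk {f : X → Y} {k} (h : DFn (C1 K X k) (fun p => f p.2) k) : IFun K f :=
  IRel.mk h.graph
theorem IFun.mk' {f : X → Y} {k} (R : X → Y → Prop) (hR : ∀ x y, R x y ↔ y = f x)
    (h : Def (C2 K X k Y k) (fun p => R p.1.2 p.2)) : IFun K f :=
  IRel.mk (h.congr fun _ => hR _ _)
theorem IFun.df {F : X → Y} (h : IFun K F) {f : Γ → X} {i} (hf : DFn V f i) :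
    DFn V (fun γ => F (f γ)) i :=
  .of_graph (fun γ y => y = F (f γ)) (fun _ _ => Iff.rfl) (IRel.df h (.wk hf) .var0)
theorem IFun.comp {F : Y → Z} {G : X → Y} (h : IFun K F) (h' : IFun K G) :
    IFun K (fun x => F (G x)) := .mk (k := 0) (h.df (h'.df .var0))

theorem DFn.var1 {V : VS Γ K} {k l} : DFn (ExtX (ExtX V X k) Y l) (fun p => p.1.2) k := .wk .var0
theorem DFn.var2 {V : VS Γ K} {k l m} :
    DFn (ExtX (ExtX (ExtX V X k) Y l) Z m) (fun p => p.1.1.2) k := .wk .var1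
theorem DFn.var3 {V : VS Γ K} {k l m n} :
    DFn (ExtX (ExtX (ExtX (ExtX V X k) Y l) Z m) W n) (fun p => p.1.1.1.2) k := .wk .var2
theorem DFn.var4 {U : Type} [ISet K U] {V : VS Γ K} {k l m n o} :
    DFn (ExtX (ExtX (ExtX (ExtX (ExtX V X k) Y l) Z m) W n) U o) (fun p => p.1.1.1.1.2) k :=
  .wk .var3
theorem DFn.var5 {U U' : Type} [ISet K U] [ISet K U'] {V : VS Γ K} {k l m n o q} :
    DFn (ExtX (ExtX (ExtX (ExtX (ExtX (ExtX V X k) Y l) Z m) W n) U o) U' q)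
      (fun p => p.1.1.1.1.1.2) k := .wk .var4
theorem DFn.var6 {U U' U'' : Type} [ISet K U] [ISet K U'] [ISet K U''] {V : VS Γ K}
    {k l m n o q r} :
    DFn (ExtX (ExtX (ExtX (ExtX (ExtX (ExtX (ExtX V X k) Y l) Z m) W n) U o) U' q) U'' r)
      (fun p => p.1.1.1.1.1.1.2) k := .wk .var5
theorem Def.allP {P : Prop} {Q : P → Γ → Prop} (h : ∀ p, Def V (Q p)) :
    Def V (fun γ => ∀ p, Q p γ) := by
  by_cases hp : P
  · exact (h hp).congr fun γ => ⟨fun h _ => h, fun h => h hp⟩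
  · exact Def.tru.congr fun γ => by simp [hp]
end
end NFUweak

open FirstOrder Language
namespace NFUweak
set_option linter.unusedSectionVars false

theorem isDef {K : Type} [LNFU.Structure K] [HasLt K] {Γ : Type} {V : VS Γ K} {P : Γ → Prop}
    (h : Def V P) : Def V P := h
theorem isDFn {K : Type} [LNFU.Structure K] [HasLt K] [Mdl K] {Γ X : Type} [ISet K X] {V : VS Γ K}
    {f : Γ → X} {i} (h : DFn V f i) : DFn V f i := h

theorem dd0 {P : Prop} (h : P := by
  (repeat' first
    | with_reducible apply DFn.var0
    | with_reducible apply DFn.var1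
    | with_reducible apply DFn.var2
    | with_reducible apply DFn.var3
    | with_reducible apply DFn.var4
    | with_reducible apply DFn.var5
    | with_reducible apply DFn.var6
    | with_reducible apply DFn.cst
    | with_reducible apply Def.prop
    | (with_reducible apply isDef; apply_assumption -exfalso -symm)
    | (with_reducible apply isDFn; apply_assumption -exfalso -symm)
    | with_reducible apply Def.and
    | with_reducible apply Def.or
    | with_reducible apply Def.iff
    | with_reducible apply Def.imp
    | with_reducible apply Def.nott
    | with_reducible apply Def.allX
    | with_reducible apply Def.exX
    | with_reducible apply DFn.smem
    | with_reducible apply DFn.sset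
    | with_reducible apply DFn.eq
    | with_reducible apply DFn.spair
    | with_reducible apply DFn.pair
    | with_reducible apply DFn.fst
    | with_reducible apply DFn.snd
    | with_reducible apply DFn.vl)
  all_goals exact 0) : P := h

/-! ## Internal well-orders -/
class IWO (K : Type) [LNFU.Structure K] [HasLt K] [Mdl K] (X : Type) [ISet K X] [LinearOrder X] :
    Prop where
  irel : IRel K (fun x y : X => x ≤ y)
  wf : ∀ P : X → Prop, IPred K P → (∃ x, P x) → ∃ x, P x ∧ ∀ y, P y → x ≤ y

section
variable {K : Type} [LNFU.Structure K] [HasLt K] [Mdl K]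
variable {X Y Z : Type} [ISet K X] [LinearOrder X] [IWO K X] [ISet K Y] [LinearOrder Y] [IWO K Y]
  [ISet K Z] [LinearOrder Z] [IWO K Z] {Γ : Type} {V : VS Γ K}

theorem DFn.le {f g : Γ → X} {i} (hf : DFn V f i) (hg : DFn V g i) :
    Def V (fun γ => f γ ≤ g γ) := IWO.irel.df hf hg
theorem DFn.lt {f g : Γ → X} {i} (hf : DFn V f i) (hg : DFn V g i) :
    Def V (fun γ => f γ < g γ) := ((DFn.le hg hf).nott).congr fun γ => not_le

theorem dd1 {P : Prop} (h : P := by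
  (repeat' first
    | with_reducible apply DFn.var0
    | with_reducible apply DFn.var1
    | with_reducible apply DFn.var2
    | with_reducible apply DFn.var3
    | with_reducible apply DFn.var4
    | with_reducible apply DFn.var5
    | with_reducible apply DFn.var6
    | with_reducible apply DFn.cst
    | with_reducible apply Def.prop
    | (with_reducible apply isDef; apply_assumption -exfalso -symm)
    | (with_reducible apply isDFn; apply_assumption -exfalso -symm)
    | with_reducible apply DFn.lt
    | with_reducible apply DFn.le
    | with_reducible apply DFn.sval
    | with_reducible apply DFn.smk
    | with_reducible apply Def.and
    | with_reducible apply Def.or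
    | with_reducible apply Def.iff
    | with_reducible apply Def.imp
    | with_reducible apply Def.nott
    | with_reducible apply Def.allX
    | with_reducible apply Def.exX
    | with_reducible apply DFn.smem
    | with_reducible apply DFn.sset
    | with_reducible apply DFn.eq
    | with_reducible apply DFn.spair
    | with_reducible apply DFn.pair
    | with_reducible apply DFn.fst
    | with_reducible apply DFn.snd
    | with_reducible apply DFn.vl)
  all_goals exact 0) : P := h

theorem IWO.least (P : X → Prop) {k} (h : Def (C1 K X k) (fun p => P p.2)) (h' : ∃ x, P x) :
    ∃ x, P x ∧ ∀ y < x, ¬ P y := by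
  obtain ⟨x, h1, h2⟩ := IWO.wf P (IPred.mk h) h'
  exact ⟨x, h1, fun y hy hp => absurd (h2 y hp) (not_le.2 hy)⟩

theorem IWO.ind (P : X → Prop) {k} (h : Def (C1 K X k) (fun p => P p.2))
    (h' : ∀ x, (∀ y < x, P y) → P x) (x : X) : P x := by
  by_contra hx
  obtain ⟨x, h1, h2⟩ := IWO.least (K := K) (fun x => ¬ P x) (.nott h) ⟨x, hx⟩
  exact h1 (h' x fun y hy => not_not.1 (h2 y hy))

/-- coded relation -/
def cr (G : K) (x : X) (y : Y) : Prop := smem (spair (vl x) (vl y)) G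
theorem DFn.cr {f : Γ → X} {g : Γ → Y} {G : Γ → K} {i} (hG : DFn V G (i+1)) (hf : DFn V f i)
    (hg : DFn V g i) : Def V (fun γ => cr (G γ) (f γ) (g γ)) := (hf.vl.spair hg.vl).smem hG
theorem IRel.code {Q : X → Y → Prop} (h : IRel K Q) : ∃ G : K, sset G ∧ ∀ x y, cr G x y ↔ Q x y := by
  obtain ⟨A, hs, h⟩ := h
  exact ⟨A, hs, fun x y => (IPred.iff h (x, y)).symm⟩
theorem IPred.code {Q : X → Prop} (h : IPred K Q) : ∃ G : K, sset G ∧ ∀ x, smem (vl x) G ↔ Q x := by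
  obtain ⟨A, hs, h⟩ := h
  exact ⟨A, hs, fun x => (IPred.iff h x).symm⟩

theorem dd2 {P : Prop} (h : P := by
  (repeat' first
    | with_reducible apply DFn.var0
    | with_reducible apply DFn.var1
    | with_reducible apply DFn.var2
    | with_reducible apply DFn.var3
    | with_reducible apply DFn.var4
    | with_reducible apply DFn.var5
    | with_reducible apply DFn.var6
    | with_reducible apply DFn.cst
    | with_reducible apply Def.prop
    | (with_reducible apply isDef; apply_assumption -exfalso -symm)
    | (with_reducible apply isDFn; apply_assumption -exfalso -symm)
    | with_reducible apply DFn.cr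
    | with_reducible apply DFn.lt
    | with_reducible apply DFn.le
    | with_reducible apply DFn.sval
    | with_reducible apply DFn.smk
    | with_reducible apply Def.and
    | with_reducible apply Def.or
    | with_reducible apply Def.iff
    | with_reducible apply Def.imp
    | with_reducible apply Def.nott
    | with_reducible apply Def.allX
    | with_reducible apply Def.exX
    | with_reducible apply DFn.smem
    | with_reducible apply DFn.sset
    | with_reducible apply DFn.eq
    | with_reducible apply DFn.spair
    | with_reducible apply DFn.pair
    | with_reducible apply DFn.fst
    | with_reducible apply DFn.snd
    | with_reducible apply DFn.vl)
  all_goals exact 0) : P := h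

/-- the initial segments below `x` and `y` are isomorphic -/
def Seg (K : Type) [LNFU.Structure K] [HasLt K] [Mdl K]
    {X Y : Type} [ISet K X] [LinearOrder X] [ISet K Y] [LinearOrder Y] (x : X) (y : Y) : Prop :=
  ∃ G : K, (∀ a < x, ∃ b < y, cr G a b) ∧ (∀ b < y, ∃ a < x, cr G a b) ∧
    ∀ a < x, ∀ a' < x, ∀ b < y, ∀ b' < y, cr G a b → cr G a' b' → (a ≤ a' ↔ b ≤ b')

theorem DFn.seg {f : Γ → X} {g : Γ → Y} {i} (hf : DFn V f i) (hg : DFn V g i) :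
    Def V (fun γ => Seg K (f γ) (g γ)) := by
  refine Def.c2 (P := fun x y => Seg K x y) ?_ hf hg
  unfold Seg
  exact dd2
end
end NFUweak

open FirstOrder Language
namespace NFUweak
set_option linter.unusedSectionVars false
set_option linter.unusedVariables false

section
variable {K : Type} [LNFU.Structure K] [HasLt K] [Mdl K]
variable {X Y Z : Type} [ISet K X] [LinearOrder X] [IWO K X] [ISet K Y] [LinearOrder Y] [IWO K Y]
  [ISet K Z] [LinearOrder Z] [IWO K Z] {Γ : Type} {V : VS Γ K}

theorem Seg.symm {x : X} {y : Y} (h : Seg K x y) : Seg K y x := by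
  obtain ⟨G, h1, h2, h3⟩ := h
  obtain ⟨G', _, hG⟩ := IRel.code (K := K) (X := Y) (Y := X) (Q := fun y x => cr G x y)
    (IRel.mk (k := 0) dd2)
  refine ⟨G', ?_, ?_, ?_⟩
  · simpa only [hG] using h2
  · simpa only [hG] using h1
  · intro a ha a' ha' b hb b' hb' e e'
    rw [hG] at e e'
    exact (h3 b hb b' hb' a ha a' ha' e e').symm

/-- two strictly monotone families with lower ranges -/
theorem Seg.of_fam {f : Z → X} {g : Z → Y} {k l} (hf : DFn (C1 K Z k) (fun p => f p.2) l)
    (hg : DFn (C1 K Z k) (fun p => g p.2) l) (mf : StrictMono f) (mg : StrictMono g)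
    (lf : ∀ z, ∀ a < f z, ∃ z', f z' = a) (lg : ∀ z, ∀ a < g z, ∃ z', g z' = a) (z : Z) :
    Seg K (f z) (g z) := by
  have hf' : Def (C2 K Z k X l) (fun p => f p.1.2 = p.2) := DFn.eq (.wk hf) .var0
  have hg' : Def (C2 K Z k Y l) (fun p => g p.1.2 = p.2) := DFn.eq (.wk hg) .var0
  obtain ⟨G, _, hG⟩ := IRel.code (K := K) (X := X) (Y := Y) (Q := fun a b => ∃ z, f z = a ∧ g z = b)
    (IRel.mk (k := l) (.exX k (.and (Def.c2 (P := fun z a => f z = a) hf' .var0 .var2)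
      (Def.c2 (P := fun z a => g z = a) hg' .var0 .var1))))
  refine ⟨G, ?_, ?_, ?_⟩
  · intro a ha
    obtain ⟨z', rfl⟩ := lf z a ha
    exact ⟨g z', mg (mf.lt_iff_lt.1 ha), (hG _ _).2 ⟨z', rfl, rfl⟩⟩
  · intro a ha
    obtain ⟨z', rfl⟩ := lg z a ha
    exact ⟨f z', mf (mg.lt_iff_lt.1 ha), (hG _ _).2 ⟨z', rfl, rfl⟩⟩
  · intro a _ a' _ b _ b' _ e e'
    rw [hG] at e e'
    obtain ⟨z, rfl, rfl⟩ := e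
    obtain ⟨z', rfl, rfl⟩ := e'
    rw [mf.le_iff_le, mg.le_iff_le]

theorem Seg.refl (x : X) : Seg K x x :=
  Seg.of_fam (f := id) (g := id) (k := 0) (l := 0) .var0 .var0 strictMono_id strictMono_id
    (fun _ a _ => ⟨a, rfl⟩) (fun _ a _ => ⟨a, rfl⟩) x

theorem Seg.trans {x : X} {y : Y} {z : Z} (h : Seg K x y) (h' : Seg K y z) : Seg K x z := by
  obtain ⟨G, h1, h2, h3⟩ := h
  obtain ⟨G', h1', h2', h3'⟩ := h'
  obtain ⟨H, _, hH⟩ := IRel.code (K := K) (X := X) (Y := Z)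
    (Q := fun a b => ∃ c, c < y ∧ cr G a c ∧ cr G' c b) (IRel.mk (k := 0) dd2)
  refine ⟨H, ?_, ?_, ?_⟩
  · intro a ha
    obtain ⟨b, hb, e⟩ := h1 a ha
    obtain ⟨c, hc, e'⟩ := h1' b hb
    exact ⟨c, hc, (hH _ _).2 ⟨b, hb, e, e'⟩⟩
  · intro a ha
    obtain ⟨b, hb, e⟩ := h2' a ha
    obtain ⟨c, hc, e'⟩ := h2 b hb
    exact ⟨c, hc, (hH _ _).2 ⟨b, hb, e', e⟩⟩
  · intro a ha a' ha' b hb b' hb' e e'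
    rw [hH] at e e'
    obtain ⟨c, hc, e1, e2⟩ := e
    obtain ⟨c', hc', e1', e2'⟩ := e'
    rw [h3 a ha a' ha' c hc c' hc' e1 e1', h3' c hc c' hc' b hb b' hb' e2 e2']

theorem Seg.restr {x : X} {y : Y} (h : Seg K x y) {a : X} (ha : a < x) : ∃ b < y, Seg K a b := by
  obtain ⟨G, h1, h2, h3⟩ := h
  obtain ⟨b, hb, e⟩ := h1 a ha
  refine ⟨b, hb, G, ?_, ?_, ?_⟩
  · intro a' ha'
    obtain ⟨b', hb', e'⟩ := h1 a' (ha'.trans ha)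
    refine ⟨b', ?_, e'⟩
    have := h3 a ha a' (ha'.trans ha) b hb b' hb' e e'
    exact lt_of_not_ge fun hh => absurd (this.2 hh) (not_le.2 ha')
  · intro b' hb'
    obtain ⟨a', ha', e'⟩ := h2 b' (hb'.trans hb)
    refine ⟨a', ?_, e'⟩
    have := h3 a ha a' ha' b hb b' (hb'.trans hb) e e'
    exact lt_of_not_ge fun hh => absurd (this.1 hh) (not_le.2 hb')
  · intro a ha a' ha' b hb b' hb' e e'
    exact h3 _ (by order) _ (by order) _ (by order) _ (by order) e e'

/-- within a single well-order, segments are rigid -/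
theorem Seg.eq {x y : X} (h : Seg K x y) : x = y := by
  have key : ∀ x : X, ∀ y, Seg K x y → y ≤ x := by
    refine IWO.ind (K := K) _ (k := 0) (.allX 0 (.imp (DFn.seg .var1 .var0) (DFn.le .var0 .var1))) ?_
    intro x ih y hs
    by_contra hlt
    push Not at hlt
    obtain ⟨b, hb, e⟩ := hs.symm.restr hlt
    -- x ~ b < x
    have := ih b hb x e.symm
    order
  exact le_antisymm (key _ _ h.symm) (key _ _ h)

theorem Seg.uniq {x : X} {y y' : Y} (h : Seg K x y) (h' : Seg K x y') : y = y' :=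
  (h.symm.trans h').eq

theorem Seg.lt {x a : X} {y b : Y} (h : Seg K x y) (h' : Seg K a b) (ha : a < x) : b < y := by
  obtain ⟨c, hc, e⟩ := h.restr ha
  rw [h'.uniq e]; exact hc

theorem Seg.ext {x : X} {y : Y} (h : ∀ a < x, ∃ b < y, Seg K a b) (h' : ∀ b < y, ∃ a < x, Seg K a b) :
    Seg K x y := by
  obtain ⟨G, _, hG⟩ := IRel.code (K := K) (X := X) (Y := Y) (Q := fun a b => Seg K a b)
    (IRel.mk (k := 0) (DFn.seg .var1 .var0))
  refine ⟨G, by simpa only [hG] using h, by simpa only [hG] using h', ?_⟩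
  intro a _ a' _ b _ b' _ e e'
  rw [hG] at e e'
  rw [← not_lt, ← not_lt]
  exact not_congr ⟨fun h => e.lt e' h, fun h => e.symm.lt e'.symm h⟩

/-- order-type comparison -/
def OLe (K : Type) [LNFU.Structure K] [HasLt K] [Mdl K]
    (X Y : Type) [ISet K X] [LinearOrder X] [ISet K Y] [LinearOrder Y] : Prop :=
  ∀ x : X, ∃ y : Y, Seg K x y

theorem OLe.refl : OLe K X X := fun x => ⟨x, .refl x⟩
theorem OLe.trans (h : OLe K X Y) (h' : OLe K Y Z) : OLe K X Z := fun x => by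
  obtain ⟨y, hy⟩ := h x
  obtain ⟨z, hz⟩ := h' y
  exact ⟨z, hy.trans hz⟩
theorem OLe.cmp (h : ¬ OLe K X Y) : ∃ x : X, (∀ a < x, ∃ y : Y, Seg K a y) ∧
    ∀ y : Y, ∃ a < x, Seg K a y := by
  unfold OLe at h
  push Not at h
  obtain ⟨x, h1, h2⟩ := IWO.least (K := K) (X := X) (fun x => ∀ y : Y, ¬ Seg K x y) (k := 0)
    (.allX 0 (.nott (DFn.seg .var1 .var0))) h
  push Not at h2
  refine ⟨x, h2, ?_⟩
  refine IWO.ind (K := K) _ (k := 0)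
    (.exX 0 (.and (DFn.lt .var0 (.cst x)) (DFn.seg .var0 .var1))) ?_
  intro y ih
  by_contra hy
  push Not at hy
  refine h1 y (Seg.ext (fun a ha => ?_) ih)
  obtain ⟨b, hb⟩ := h2 a ha
  refine ⟨b, ?_, hb⟩
  by_contra hlt
  push Not at hlt
  rcases hlt.eq_or_lt with rfl | hlt
  · exact hy a ha hb
  · obtain ⟨c, hc, e⟩ := hb.symm.restr hlt
    exact hy c (by order) e.symm
theorem OLe.total : OLe K X Y ∨ OLe K Y X := by
  by_contra h
  push Not at h
  obtain ⟨x, _, h1⟩ := OLe.cmp h.1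
  exact h.2 fun y => by
    obtain ⟨a, _, e⟩ := h1 y
    exact ⟨a, e.symm⟩
end
end NFUweak

open FirstOrder Language
namespace NFUweak
set_option linter.unusedSectionVars false
set_option linter.unusedVariables false

section
variable {K : Type} [LNFU.Structure K] [HasLt K] [Mdl K]

def rr (R x y : K) : Prop := smem (spair x y) R
theorem DFn.mrr {Γ : Type} {V : VS Γ K} {R f g : Γ → K} {i} (hR : DFn V R (i+1)) (hf : DFn V f i)
    (hg : DFn V g i) : Def V (fun γ => rr (R γ) (f γ) (g γ)) := (hf.spair hg).smem hR

theorem DFn.var7 {A B C D E F G H Γ : Type} [ISet K A] [ISet K B] [ISet K C] [ISet K D] [ISet K E]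
    [ISet K F] [ISet K G] [ISet K H] {V : VS Γ K} {a b c d e f g h} :
    DFn (ExtX (ExtX (ExtX (ExtX (ExtX (ExtX (ExtX (ExtX V A a) B b) C c) D d) E e) F f) G g) H h)
      (fun p => p.1.1.1.1.1.1.1.2) a := .wk .var6
theorem DFn.var8 {A B C D E F G H I Γ : Type} [ISet K A] [ISet K B] [ISet K C] [ISet K D] [ISet K E]
    [ISet K F] [ISet K G] [ISet K H] [ISet K I] {V : VS Γ K} {a b c d e f g h i} :
    DFn (ExtX (ExtX (ExtX (ExtX (ExtX (ExtX (ExtX (ExtX (ExtX V A a) B b) C c) D d) E e) F f) G g)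
      H h) I i) (fun p => p.1.1.1.1.1.1.1.1.2) a := .wk .var7

theorem dd3 {P : Prop} (h : P := by
  (repeat' first
    | with_reducible apply DFn.var0
    | with_reducible apply DFn.var1
    | with_reducible apply DFn.var2
    | with_reducible apply DFn.var3
    | with_reducible apply DFn.var4
    | with_reducible apply DFn.var5
    | with_reducible apply DFn.var6
    | with_reducible apply DFn.cst
    | with_reducible apply Def.prop
    | (with_reducible apply isDef; apply_assumption -exfalso -symm)
    | (with_reducible apply isDFn; apply_assumption -exfalso -symm)
    | with_reducible apply DFn.var7
    | with_reducible apply DFn.var8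
    | with_reducible apply DFn.mrr
    | with_reducible apply DFn.cr
    | with_reducible apply DFn.lt
    | with_reducible apply DFn.le
    | with_reducible apply DFn.sval
    | with_reducible apply DFn.smk
    | with_reducible apply Def.and
    | with_reducible apply Def.or
    | with_reducible apply Def.iff
    | with_reducible apply Def.imp
    | with_reducible apply Def.nott
    | with_reducible apply Def.allX
    | with_reducible apply Def.exX
    | with_reducible apply DFn.smem
    | with_reducible apply DFn.sset
    | with_reducible apply DFn.eq
    | with_reducible apply DFn.spair
    | with_reducible apply DFn.pair
    | with_reducible apply DFn.fst
    | with_reducible apply DFn.snd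
    | with_reducible apply DFn.vl)
  all_goals exact 0) : P := h

/-- well-orders, given by the reflexive order relation -/
def WO (R : K) : Prop :=
  (∀ x y, rr R x y → rr R x x ∧ rr R y y) ∧ (∀ x y, rr R x y → rr R y x → x = y) ∧
  (∀ x y z, rr R x y → rr R y z → rr R x z) ∧ (∀ x y, rr R x x → rr R y y → rr R x y ∨ rr R y x) ∧
  ∀ A, (∃ x, smem x A ∧ rr R x x) → ∃ x, smem x A ∧ rr R x x ∧ ∀ y, smem y A → rr R y y → rr R x y

theorem DFn.wo {Γ : Type} {V : VS Γ K} {R : Γ → K} {i} (hR : DFn V R (i+1)) :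
    Def V (fun γ => WO (R γ)) := by
  refine Def.c1 (P := fun R => WO R) ?_ hR
  unfold WO
  exact dd3

structure WOrd (K : Type) [LNFU.Structure K] [HasLt K] [Mdl K] : Type where
  c : K
  wo : WO c
instance : ISet K (WOrd K) where
  val R := R.c
  inj := by rintro ⟨_, _⟩ ⟨_, _⟩ h; cases h; rfl
  code := by
    obtain ⟨A, h, h'⟩ := IPred.mk (K := K) (P := fun R : K => WO R) (k := 1) (DFn.wo .var0)
    exact ⟨A, h, fun z => by rw [h']; exact ⟨fun ⟨x, h, e⟩ => ⟨⟨x, h⟩, e⟩, fun ⟨x, e⟩ => ⟨x.c, x.wo, e⟩⟩⟩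
theorem DFn.wval {Γ : Type} {V : VS Γ K} {f : Γ → WOrd K} {i} (hf : DFn V f i) :
    DFn V (fun γ => (f γ).c) i := hf

structure Fld (R : WOrd K) : Type where
  c : K
  h : rr R.c c c
theorem Fld.ext {R : WOrd K} {x y : Fld R} (h : x.c = y.c) : x = y := by
  cases x; cases y; cases h; rfl
instance (R : WOrd K) : ISet K (Fld R) where
  val x := x.c
  inj _ _ h := Fld.ext h
  code := by
    obtain ⟨A, h, h'⟩ := IPred.mk (K := K) (P := fun x : K => rr R.c x x) (k := 0)
      (DFn.mrr (.cst _) .var0 .var0)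
    exact ⟨A, h, fun z => by rw [h']; exact ⟨fun ⟨x, h, e⟩ => ⟨⟨x, h⟩, e⟩, fun ⟨x, e⟩ => ⟨x.c, x.h, e⟩⟩⟩
theorem Fld.vl {R : WOrd K} (x : Fld R) : (vl x : K) = x.c := rfl
noncomputable instance (R : WOrd K) : LinearOrder (Fld R) where
  le x y := rr R.c x.c y.c
  le_refl x := x.h
  le_trans x y z h h' := R.wo.2.2.1 _ _ _ h h'
  le_antisymm x y h h' := Fld.ext (R.wo.2.1 _ _ h h')
  le_total x y := R.wo.2.2.2.1 _ _ x.h y.h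
  toDecidableLE := Classical.decRel _
theorem Fld.le_iff {R : WOrd K} (x y : Fld R) : x ≤ y ↔ rr R.c x.c y.c := Iff.rfl
instance (R : WOrd K) : IWO K (Fld R) where
  irel := IRel.mk (k := 0) (DFn.mrr (.cst _) (DFn.vl (X := Fld R) .var1) (DFn.vl (X := Fld R) .var0))
  wf P hP h := by
    obtain ⟨A, _, hA⟩ := hP
    replace hA := fun x => (IPred.iff hA x).symm
    obtain ⟨x, hx⟩ := h
    obtain ⟨x, h1, h2, h3⟩ := R.wo.2.2.2.2 A ⟨x.c, (hA x).2 hx, x.h⟩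
    exact ⟨⟨x, h2⟩, (hA ⟨x, h2⟩).1 h1, fun y hy => h3 y.c ((hA y).2 hy) y.h⟩

theorem Fld.forall {R : WOrd K} {P : Fld R → Prop} :
    (∀ a, P a) ↔ ∀ x (h : rr R.c x x), P ⟨x, h⟩ := ⟨fun h x hx => h _, fun h a => h a.c a.h⟩
theorem Fld.exists {R : WOrd K} {P : Fld R → Prop} :
    (∃ a, P a) ↔ ∃ x, ∃ (h : rr R.c x x), P ⟨x, h⟩ :=
  ⟨fun ⟨a, h⟩ => ⟨a.c, a.h, h⟩, fun ⟨x, h, h'⟩ => ⟨⟨x, h⟩, h'⟩⟩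

theorem olefld_iff (R S : WOrd K) : OLe K (Fld R) (Fld S) ↔
    ∀ x, rr R.c x x → ∃ y, rr S.c y y ∧ ∃ G,
      (∀ a, rr R.c a a → rr R.c a x ∧ ¬ a = x → ∃ b, rr S.c b b ∧ (rr S.c b y ∧ ¬ b = y) ∧ rr G a b) ∧
      (∀ b, rr S.c b b → rr S.c b y ∧ ¬ b = y → ∃ a, rr R.c a a ∧ (rr R.c a x ∧ ¬ a = x) ∧ rr G a b) ∧
      ∀ a, rr R.c a a → rr R.c a x ∧ ¬ a = x → ∀ a', rr R.c a' a' → rr R.c a' x ∧ ¬ a' = x →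
        ∀ b, rr S.c b b → rr S.c b y ∧ ¬ b = y → ∀ b', rr S.c b' b' → rr S.c b' y ∧ ¬ b' = y →
        rr G a b → rr G a' b' → (rr R.c a a' ↔ rr S.c b b') := by
  have hl : ∀ (R : WOrd K) (x y : Fld R), x < y ↔ rr R.c x.c y.c ∧ ¬ x.c = y.c := fun R x y =>
    lt_iff_le_and_ne.trans (and_congr_right fun _ => not_congr ⟨fun h => h ▸ rfl, Fld.ext⟩)
  have hc : ∀ (G : K) (x : Fld R) (y : Fld S), cr G x y ↔ rr G x.c y.c := fun _ _ _ => Iff.rfl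
  unfold OLe Seg
  simp only [Fld.forall, Fld.exists, hl, Fld.le_iff, hc, exists_prop]

instance : Preorder (WOrd K) where
  le R S := OLe K (Fld R) (Fld S)
  le_refl R := OLe.refl
  le_trans R S T h h' := h.trans h'
theorem WOrd.le_iff (R S : WOrd K) : R ≤ S ↔ OLe K (Fld R) (Fld S) := Iff.rfl
instance : Std.Total (α := WOrd K) (· ≤ ·) := ⟨fun _ _ => OLe.total⟩

theorem DFn.wle {Γ : Type} {V : VS Γ K} {R S : Γ → WOrd K} {i} (hR : DFn V R (i+1))
    (hS : DFn V S (i+1)) : Def V (fun γ => R γ ≤ S γ) := by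
  refine Def.congr ?_ (fun γ => (olefld_iff (R γ) (S γ)).symm)
  refine Def.c2 (K := K) (k := i+1) (l := i+1) (f := fun γ => (R γ).c) (g := fun γ => (S γ).c)
    (P := fun R S => ∀ x, rr R x x → ∃ y, rr S y y ∧ ∃ G,
      (∀ a, rr R a a → rr R a x ∧ ¬ a = x → ∃ b, rr S b b ∧ (rr S b y ∧ ¬ b = y) ∧ rr G a b) ∧
      (∀ b, rr S b b → rr S b y ∧ ¬ b = y → ∃ a, rr R a a ∧ (rr R a x ∧ ¬ a = x) ∧ rr G a b) ∧
      ∀ a, rr R a a → rr R a x ∧ ¬ a = x → ∀ a', rr R a' a' → rr R a' x ∧ ¬ a' = x →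
        ∀ b, rr S b b → rr S b y ∧ ¬ b = y → ∀ b', rr S b' b' → rr S b' y ∧ ¬ b' = y →
        rr G a b → rr G a' b' → (rr R a a' ↔ rr S b b')) ?_ hR hS
  exact dd3

open Classical in
/-- the ordinals -/
def DD (K : Type) [LNFU.Structure K] [HasLt K] [Mdl K] : Type :=
  Antisymmetrization (WOrd K) (· ≤ ·)
open Classical in
noncomputable instance : LinearOrder (DD K) :=
  inferInstanceAs (LinearOrder (Antisymmetrization (WOrd K) (· ≤ ·)))
def dmk (R : WOrd K) : DD K := toAntisymmetrization _ R
theorem dmk_surj (d : DD K) : ∃ R, dmk R = d := Quotient.exists_rep d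
theorem dmk_le {R S : WOrd K} : dmk R ≤ dmk S ↔ OLe K (Fld R) (Fld S) := Iff.rfl
theorem dmk_eq {R S : WOrd K} : dmk R = dmk S ↔ R ≤ S ∧ S ≤ R := Quotient.eq
end
end NFUweak

open FirstOrder Language
namespace NFUweak
set_option linter.unusedSectionVars false
set_option linter.unusedVariables false

section
variable {K : Type} [LNFU.Structure K] [HasLt K] [Mdl K]

theorem dd4 {P : Prop} (h : P := by
  (repeat' first
    | with_reducible apply DFn.var0
    | with_reducible apply DFn.var1
    | with_reducible apply DFn.var2
    | with_reducible apply DFn.var3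
    | with_reducible apply DFn.var4
    | with_reducible apply DFn.var5
    | with_reducible apply DFn.var6
    | with_reducible apply DFn.cst
    | with_reducible apply Def.prop
    | (with_reducible apply isDef; apply_assumption -exfalso -symm)
    | (with_reducible apply isDFn; apply_assumption -exfalso -symm)
    | with_reducible apply DFn.var7
    | with_reducible apply DFn.var8
    | with_reducible apply DFn.wle
    | with_reducible apply DFn.mrr
    | with_reducible apply DFn.cr
    | with_reducible apply DFn.lt
    | with_reducible apply DFn.le
    | with_reducible apply DFn.seg
    | with_reducible apply DFn.wval
    | with_reducible apply DFn.sval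
    | with_reducible apply DFn.smk
    | with_reducible apply Def.and
    | with_reducible apply Def.or
    | with_reducible apply Def.iff
    | with_reducible apply Def.imp
    | with_reducible apply Def.nott
    | with_reducible apply Def.allX
    | with_reducible apply Def.exX
    | with_reducible apply DFn.smem
    | with_reducible apply DFn.sset
    | with_reducible apply DFn.eq
    | with_reducible apply DFn.spair
    | with_reducible apply DFn.pair
    | with_reducible apply DFn.fst
    | with_reducible apply DFn.snd
    | with_reducible apply DFn.vl)
  all_goals exact 0) : P := h

theorem cls_ex (R : WOrd K) : ∃ c : K, sset c ∧ ∀ S, smem S c ↔ ∃ S' : WOrd K, vl S' = S ∧ S' ≤ R ∧ R ≤ S' :=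
  compX (k := 1) _ dd4
noncomputable def cls (R : WOrd K) : K := (cls_ex R).choose
theorem cls_set (R : WOrd K) : sset (cls R) := (cls_ex R).choose_spec.1
theorem mem_cls (R S : WOrd K) : smem (vl S) (cls R) ↔ S ≤ R ∧ R ≤ S := by
  rw [cls, (cls_ex R).choose_spec.2]
  exact ⟨fun ⟨S', h, h'⟩ => vl_inj h ▸ h', fun h => ⟨S, rfl, h⟩⟩
theorem cls_eq {R S : WOrd K} : cls R = cls S ↔ R ≤ S ∧ S ≤ R := by
  refine ⟨fun h => ?_, fun h => ?_⟩
  · have := (mem_cls S R).1 (h ▸ (mem_cls R R).2 ⟨le_refl _, le_refl _⟩)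
    exact this
  · refine Mdl.ext _ _ (cls_set _) (cls_set _) fun z => ?_
    rw [cls, cls, (cls_ex R).choose_spec.2, (cls_ex S).choose_spec.2]
    refine exists_congr fun T => and_congr_right fun _ => ?_
    exact ⟨fun h' => ⟨h'.1.trans h.1, h.2.trans h'.2⟩, fun h' => ⟨h'.1.trans h.2, h.1.trans h'.2⟩⟩
/-- `c` is the class of `R` -/
theorem eq_cls (c : K) (R : WOrd K) : c = cls R ↔ sset c ∧ ∀ S, smem S c ↔ ∃ S' : WOrd K, vl S' = S ∧ S' ≤ R ∧ R ≤ S' := by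
  refine ⟨fun h => h ▸ (cls_ex R).choose_spec, fun h => Mdl.ext _ _ h.1 (cls_set _) fun z => ?_⟩
  rw [h.2, cls, (cls_ex R).choose_spec.2]
theorem DFn.eqcls {Γ : Type} {V : VS Γ K} {c : Γ → K} {R : Γ → WOrd K} {i} (hc : DFn V c (i+2))
    (hR : DFn V R (i+1)) : Def V (fun γ => c γ = cls (R γ)) := by
  refine Def.c2 (P := fun c R => c = cls R) ?_ hc hR
  simp only [eq_cls]
  exact dd4

noncomputable instance : ISet K (DD K) where
  val := Quotient.lift cls fun R S h => cls_eq.2 h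
  inj := by
    intro c d
    obtain ⟨R, rfl⟩ := dmk_surj c
    obtain ⟨S, rfl⟩ := dmk_surj d
    exact fun h => dmk_eq.2 (cls_eq.1 h)
  code := by
    obtain ⟨A, h1, h2⟩ := compX (K := K) (k := 2) (fun c => ∃ R, c = cls R)
      (.exX 1 (DFn.eqcls (i := 0) .var1 .var0))
    refine ⟨A, h1, fun z => ?_⟩
    rw [h2]
    constructor
    · rintro ⟨R, rfl⟩
      exact ⟨dmk R, rfl⟩
    · rintro ⟨c, rfl⟩
      obtain ⟨R, rfl⟩ := dmk_surj c
      exact ⟨R, rfl⟩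
theorem vl_dmk (R : WOrd K) : (vl (dmk R) : K) = cls R := rfl

theorem DFn.dmk {Γ : Type} {V : VS Γ K} {R : Γ → WOrd K} {i} (hR : DFn V R (i+1)) :
    DFn V (fun γ => dmk (R γ)) (i+2) := by
  refine DFn.of_graph (fun γ d => NFUweak.vl d = cls (R γ)) (fun γ d => ?_)
    (DFn.eqcls (DFn.vl .var0) (.wk hR))
  exact ⟨fun h => vl_inj (h.trans (vl_dmk _).symm), fun h => h ▸ rfl⟩

theorem IPred.code' {X : Type} [ISet K X] {Q : X → Prop} (h : IPred K Q) :
    ∃ G : K, sset G ∧ ∀ x, smem (vl x) G ↔ Q x := by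
  obtain ⟨A, hs, h⟩ := h
  exact ⟨A, hs, fun x => (IPred.iff h x).symm⟩

section
variable {X Y Z : Type} [ISet K X] [LinearOrder X] [IWO K X] [ISet K Y] [LinearOrder Y] [IWO K Y]
  [ISet K Z] [LinearOrder Z] [IWO K Z] {Γ : Type} {V : VS Γ K}

/-- restriction of a well-order to an internal lower set, as a code -/
theorem sub_ex (P : X → Prop) (hP : IPred K P) : ∃ R : WOrd K, ∀ u v, rr R.c u v ↔
    ∃ a b : X, P a ∧ P b ∧ a ≤ b ∧ vl a = u ∧ vl b = v := by
  obtain ⟨R, _, hR⟩ := compX (K := K) (k := 0)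
    (fun z => ∃ a b : X, P a ∧ P b ∧ a ≤ b ∧ z = spair (vl a) (vl b)) (by
      have hp : ∀ {Γ : Type} {V : VS Γ K} {f : Γ → X} {i}, DFn V f i → Def V (fun γ => P (f γ)) :=
        fun hf => hP.df hf
      exact dd4)
  have hr : ∀ u v, rr R u v ↔ ∃ a b : X, P a ∧ P b ∧ a ≤ b ∧ vl a = u ∧ vl b = v := by
    intro u v
    unfold rr
    rw [hR]
    refine exists_congr fun a => exists_congr fun b => and_congr_right fun _ => and_congr_right fun _ =>
      and_congr_right fun _ => ⟨fun h => ?_, fun ⟨h, h'⟩ => by rw [h, h']⟩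
    obtain ⟨h, h'⟩ := Mdl.pinj _ _ _ _ h
    exact ⟨h.symm, h'.symm⟩
  have hd : ∀ u, rr R u u ↔ ∃ a : X, P a ∧ vl a = u := by
    intro u
    rw [hr]
    exact ⟨fun ⟨a, _, h, _, _, h', _⟩ => ⟨a, h, h'⟩, fun ⟨a, h, h'⟩ => ⟨a, a, h, h, le_rfl, h', h'⟩⟩
  have h2 : ∀ a b : X, rr R (vl a) (vl b) ↔ P a ∧ P b ∧ a ≤ b := fun a b => by
    rw [hr]
    exact ⟨fun ⟨a', b', h1, h2, h3, h4, h5⟩ => by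
      rw [← vl_inj h4, ← vl_inj h5]; exact ⟨h1, h2, h3⟩, fun ⟨h1, h2, h3⟩ => ⟨a, b, h1, h2, h3, rfl, rfl⟩⟩
  refine ⟨⟨R, ?_, ?_, ?_, ?_, ?_⟩, hr⟩
  · intro x y h
    obtain ⟨a, b, ha, hb, _, rfl, rfl⟩ := (hr _ _).1 h
    exact ⟨(hd _).2 ⟨a, ha, rfl⟩, (hd _).2 ⟨b, hb, rfl⟩⟩
  · intro x y h h'
    obtain ⟨a, b, ha, hb, e, rfl, rfl⟩ := (hr _ _).1 h
    rw [le_antisymm e ((h2 _ _).1 h').2.2]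
  · intro x y z h h'
    obtain ⟨a, b, ha, hb, e, rfl, rfl⟩ := (hr _ _).1 h
    obtain ⟨b', c, hb', hc, e', e2, rfl⟩ := (hr _ _).1 h'
    obtain rfl := vl_inj e2
    exact (h2 _ _).2 ⟨ha, hc, e.trans e'⟩
  · intro x y h h'
    obtain ⟨a, ha, rfl⟩ := (hd _).1 h
    obtain ⟨b, hb, rfl⟩ := (hd _).1 h'
    rw [h2, h2]
    exact (le_total a b).imp (fun h => ⟨ha, hb, h⟩) (fun h => ⟨hb, ha, h⟩)
  · rintro A ⟨x, hA, hx⟩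
    obtain ⟨a, ha, rfl⟩ := (hd _).1 hx
    obtain ⟨b, ⟨h1, h3⟩, h4⟩ := IWO.wf (K := K) (fun b : X => P b ∧ smem (vl b) A) (IPred.mk (k := 0)
      (.and (hP.df .var0) (DFn.smem (DFn.vl .var0) (.cst A)))) ⟨a, ha, hA⟩
    refine ⟨vl b, h3, (h2 _ _).2 ⟨h1, h1, le_rfl⟩, fun y hy hyy => ?_⟩
    obtain ⟨c, hc, rfl⟩ := (hd _).1 hyy
    exact (h2 _ _).2 ⟨h1, hc, h4 c ⟨hc, hy⟩⟩

/-- elements of the restriction match the originals -/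
theorem sub_seg {P : X → Prop} {R : WOrd K} (hR : ∀ u v, rr R.c u v ↔
    ∃ a b : X, P a ∧ P b ∧ a ≤ b ∧ vl a = u ∧ vl b = v) (hl : ∀ x, P x → ∀ y < x, P y) :
    (∀ u : Fld R, ∃ x, P x ∧ Seg K u x) ∧ ∀ x, P x → ∃ u : Fld R, Seg K u x := by
  have hd : ∀ u, rr R.c u u ↔ ∃ a : X, P a ∧ vl a = u := by
    intro u
    rw [hR]
    exact ⟨fun ⟨a, _, h, _, _, h', _⟩ => ⟨a, h, h'⟩, fun ⟨a, h, h'⟩ => ⟨a, a, h, h, le_rfl, h', h'⟩⟩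
  choose f hf hf' using fun u : Fld R => (hd u.c).1 u.h
  have hle : ∀ u v, u ≤ v ↔ f u ≤ f v := by
    intro u v
    rw [Fld.le_iff, hR]
    constructor
    · rintro ⟨a, b, ha, hb, e, e1, e2⟩
      rw [← hf'] at e1 e2
      rwa [← vl_inj e1, ← vl_inj e2]
    · exact fun h => ⟨f u, f v, hf u, hf v, h, hf' u, hf' v⟩
  have key : ∀ u, Seg K u (f u) := Seg.of_fam (f := fun u => u) (g := f) (k := 0) (l := 0) .var0
    (.of_graph (fun u x => vl x = (vl u.2 : K)) (fun u x => by
      rw [Fld.vl, ← hf']; exact ⟨vl_inj, fun h => h ▸ rfl⟩) (DFn.eq (X := K) .var0 .var1))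
    (fun _ _ h => h) (fun u v h => by rw [← not_le] at h ⊢; rwa [← hle]) (fun _ a _ => ⟨a, rfl⟩)
    (fun u a ha => by
      have := hl _ (hf u) a ha
      refine ⟨⟨vl a, (hd _).2 ⟨a, this, rfl⟩⟩, vl_inj (hf' _)⟩)
  refine ⟨fun u => ⟨f u, hf u, key u⟩, fun x hx => ⟨⟨vl x, (hd _).2 ⟨x, hx, rfl⟩⟩, ?_⟩⟩
  have := key ⟨vl x, (hd _).2 ⟨x, hx, rfl⟩⟩
  rwa [show f ⟨vl x, _⟩ = x from vl_inj (hf' _)] at this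

noncomputable def subW (x : X) : WOrd K :=
  (sub_ex (K := K) (fun y : X => y < x) (IPred.mk (k := 0) (DFn.lt .var0 (.cst x)))).choose
theorem subW_spec (x : X) : ∀ u v, rr (subW x : WOrd K).c u v ↔
    ∃ a b : X, a < x ∧ b < x ∧ a ≤ b ∧ vl a = u ∧ vl b = v :=
  (sub_ex (K := K) (fun y : X => y < x) (IPred.mk (k := 0) (DFn.lt .var0 (.cst x)))).choose_spec
noncomputable def allW (K : Type) [LNFU.Structure K] [HasLt K] [Mdl K] (X : Type) [ISet K X]
    [LinearOrder X] [IWO K X] : WOrd K :=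
  (sub_ex (K := K) (fun y : X => True) (IPred.mk (k := 0) (.prop _))).choose
theorem allW_spec : ∀ u v, rr (allW K X).c u v ↔
    ∃ a b : X, True ∧ True ∧ a ≤ b ∧ vl a = u ∧ vl b = v :=
  (sub_ex (K := K) (fun y : X => True) (IPred.mk (k := 0) (.prop _))).choose_spec

noncomputable def rk (K : Type) [LNFU.Structure K] [HasLt K] [Mdl K] {X : Type} [ISet K X]
    [LinearOrder X] [IWO K X] (x : X) : DD K := dmk (subW x)
noncomputable def otp (K : Type) [LNFU.Structure K] [HasLt K] [Mdl K] (X : Type) [ISet K X]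
    [LinearOrder X] [IWO K X] : DD K := dmk (allW K X)

theorem subW_seg (x : X) : (∀ u : Fld (subW x : WOrd K), ∃ y, y < x ∧ Seg K u y) ∧
    ∀ y, y < x → ∃ u : Fld (subW x : WOrd K), Seg K u y :=
  sub_seg (subW_spec x) (fun x hx y hy => hy.trans hx)
theorem allW_seg : (∀ u : Fld (allW K X), ∃ y : X, True ∧ Seg K u y) ∧
    ∀ y : X, True → ∃ u : Fld (allW K X), Seg K u y :=
  sub_seg allW_spec (fun _ _ _ _ => trivial)

theorem rk_le_rk {x : X} {y : Y} : rk K x ≤ rk K y ↔ ∀ a < x, ∃ b < y, Seg K a b := by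
  unfold rk
  rw [dmk_le (K := K)]
  constructor
  · intro h a ha
    obtain ⟨u, hu⟩ := (subW_seg (K := K) x).2 a ha
    obtain ⟨v, hv⟩ := h u
    obtain ⟨b, hb, e⟩ := (subW_seg (K := K) y).1 v
    exact ⟨b, hb, hu.symm.trans (hv.trans e)⟩
  · intro h u
    obtain ⟨a, ha, e⟩ := (subW_seg (K := K) x).1 u
    obtain ⟨b, hb, e'⟩ := h a ha
    obtain ⟨v, hv⟩ := (subW_seg (K := K) y).2 b hb
    exact ⟨v, e.trans (e'.trans hv.symm)⟩
theorem rk_eq {x : X} {y : Y} : rk K x = rk K y ↔ Seg K x y := by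
  rw [le_antisymm_iff, rk_le_rk, rk_le_rk]
  constructor
  · rintro ⟨h, h'⟩
    exact Seg.ext h fun b hb => by
      obtain ⟨a, ha, e⟩ := h' b hb
      exact ⟨a, ha, e.symm⟩
  · exact fun h => ⟨fun a ha => h.restr ha, fun a ha => h.symm.restr ha⟩

theorem lt_dmk {d : DD K} {R : WOrd K} : d < dmk R ↔ ∃ x : Fld R, d = rk K x := by
  obtain ⟨S, rfl⟩ := dmk_surj d
  constructor
  · intro h
    obtain ⟨x, h1, h2⟩ := OLe.cmp (K := K) (fun h' => absurd (dmk_le.2 h') (not_le.2 h))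
    refine ⟨x, le_antisymm (dmk_le.2 fun s => ?_) (dmk_le.2 fun u => ?_)⟩
    · obtain ⟨a, ha, e⟩ := h2 s
      obtain ⟨u, hu⟩ := (subW_seg (K := K) x).2 a ha
      exact ⟨u, e.symm.trans hu.symm⟩
    · obtain ⟨a, ha, e⟩ := (subW_seg (K := K) x).1 u
      obtain ⟨y, hy⟩ := h1 a ha
      exact ⟨y, e.trans hy⟩
  · rintro ⟨x, h⟩
    rw [h, ← not_le]
    intro h'
    obtain ⟨u, hu⟩ := dmk_le.1 h' x
    obtain ⟨a, ha, e⟩ := (subW_seg (K := K) x).1 u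
    have := (hu.trans e).eq
    order

theorem lt_rk {d : DD K} {x : X} : d < rk K x ↔ ∃ y < x, d = rk K y := by
  unfold rk
  rw [lt_dmk]
  constructor
  · rintro ⟨u, rfl⟩
    obtain ⟨a, ha, e⟩ := (subW_seg (K := K) x).1 u
    exact ⟨a, ha, rk_eq.2 e⟩
  · rintro ⟨a, ha, rfl⟩
    obtain ⟨u, hu⟩ := (subW_seg (K := K) x).2 a ha
    exact ⟨u, (rk_eq.2 hu).symm⟩
theorem lt_otp {d : DD K} : d < otp K X ↔ ∃ y : X, d = rk K y := by
  unfold otp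
  rw [lt_dmk]
  constructor
  · rintro ⟨u, rfl⟩
    obtain ⟨a, ha, e⟩ := allW_seg.1 u
    exact ⟨a, rk_eq.2 e⟩
  · rintro ⟨a, rfl⟩
    obtain ⟨u, hu⟩ := (allW_seg (K := K) (X := X)).2 a trivial
    exact ⟨u, (rk_eq.2 hu).symm⟩
theorem rk_mono : StrictMono (rk K : X → DD K) := fun x y h => lt_rk.2 ⟨x, h, rfl⟩

theorem DFn.rk {f : Γ → X} {i} (hf : DFn V f i) : DFn V (fun γ => rk K (f γ)) (i+2) := by
  refine DFn.c1 (F := fun x => NFUweak.rk K x) (k := i) ?_ hf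
  refine DFn.of_graph (fun γ d => ∃ R : WOrd K, d = NFUweak.dmk R ∧ ∀ u v, rr R.c u v ↔
    ∃ a b : X, a < γ.2 ∧ b < γ.2 ∧ a ≤ b ∧ NFUweak.vl a = u ∧ NFUweak.vl b = v) (fun γ d => ?_) ?_
  · constructor
    · rintro ⟨R, rfl, h⟩
      have : R ≤ subW γ.2 ∧ subW γ.2 ≤ R := by
        have h1 := sub_seg h (fun x hx y hy => hy.trans hx)
        have h2 := subW_seg (K := K) γ.2
        constructor
        · intro u
          obtain ⟨y, hy, e⟩ := h1.1 u
          obtain ⟨v, hv⟩ := h2.2 y hy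
          exact ⟨v, e.trans hv.symm⟩
        · intro u
          obtain ⟨y, hy, e⟩ := h2.1 u
          obtain ⟨v, hv⟩ := h1.2 y hy
          exact ⟨v, e.trans hv.symm⟩
      exact dmk_eq.2 this
    · rintro rfl
      exact ⟨subW γ.2, rfl, subW_spec _⟩
  · refine .exX (i+1) (.and (DFn.eq .var1 (DFn.dmk .var0)) ?_)
    exact dd4
end

theorem dle_iff (c d : DD K) : c ≤ d ↔ ∃ R S : WOrd K, c = dmk R ∧ d = dmk S ∧ R ≤ S := by
  constructor
  · intro h
    obtain ⟨R, rfl⟩ := dmk_surj c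
    obtain ⟨S, rfl⟩ := dmk_surj d
    exact ⟨R, S, rfl, rfl, h⟩
  · rintro ⟨R, S, rfl, rfl, h⟩
    exact h

instance : IWO K (DD K) where
  irel := by
    refine IRel.mk (k := 2) (Def.congr ?_ fun _ => (dle_iff _ _).symm)
    exact .exX 1 (.exX 1 (.and (DFn.eq .var3 (DFn.dmk .var1)) (.and (DFn.eq .var2 (DFn.dmk .var0))
      (DFn.wle (i := 0) .var1 .var0))))
  wf P hP h := by
    obtain ⟨d, hd⟩ := h
    by_cases h : ∃ e < d, P e
    swap
    · push Not at h
      exact ⟨d, hd, fun e he => not_lt.1 fun hlt => h e hlt he⟩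
    obtain ⟨R, rfl⟩ := dmk_surj d
    obtain ⟨e, he, hP'⟩ := h
    obtain ⟨x, rfl⟩ := lt_dmk.1 he
    obtain ⟨x, h1, h2⟩ := IWO.wf (K := K) (fun x : Fld R => P (rk K x))
      (IPred.mk (k := 0) (hP.df (DFn.rk .var0))) ⟨x, hP'⟩
    refine ⟨_, h1, fun y hy => not_lt.1 fun hlt => ?_⟩
    obtain ⟨z, hz, rfl⟩ := lt_rk.1 hlt
    exact absurd (h2 z hy) (not_le.2 hz)
end
end NFUweak

open FirstOrder Language
namespace NFUweak
set_option linter.unusedSectionVars false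
set_option linter.unusedVariables false

section
variable {K : Type} [LNFU.Structure K] [HasLt K] [Mdl K]

theorem two_pts (K : Type) [LNFU.Structure K] [HasLt K] [Mdl K] : ∃ c d : K, c ≠ d := by
  obtain ⟨c, _, h⟩ := compX (K := K) (k := 0) (fun _ => False) (.prop _)
  obtain ⟨d, _, h'⟩ := compX (K := K) (k := 0) (fun _ => True) (.prop _)
  refine ⟨c, d, fun e => ?_⟩
  subst e
  exact (h c).1 ((h' c).2 trivial)
noncomputable def k0 (K : Type) [LNFU.Structure K] [HasLt K] [Mdl K] : K := (two_pts K).choose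
noncomputable def k1 (K : Type) [LNFU.Structure K] [HasLt K] [Mdl K] : K := (two_pts K).choose_spec.choose
theorem k01 : k0 K ≠ k1 K := (two_pts K).choose_spec.choose_spec

section
variable {X Y Z : Type} [ISet K X] [ISet K Y] {Γ : Type} {V : VS Γ K}

theorem dd5 {P : Prop} (h : P := by
  (repeat' first
    | with_reducible apply DFn.var0
    | with_reducible apply DFn.var1
    | with_reducible apply DFn.var2
    | with_reducible apply DFn.var3
    | with_reducible apply DFn.var4
    | with_reducible apply DFn.var5
    | with_reducible apply DFn.var6
    | with_reducible apply DFn.cst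
    | with_reducible apply Def.prop
    | (with_reducible apply isDef; apply_assumption -exfalso -symm)
    | (with_reducible apply isDFn; apply_assumption -exfalso -symm)
    | with_reducible apply DFn.var7
    | with_reducible apply DFn.var8
    | with_reducible apply DFn.rk
    | with_reducible apply DFn.wle
    | with_reducible apply DFn.mrr
    | with_reducible apply DFn.cr
    | with_reducible apply DFn.lt
    | with_reducible apply DFn.le
    | with_reducible apply DFn.seg
    | with_reducible apply DFn.wval
    | with_reducible apply DFn.sval
    | with_reducible apply DFn.smk
    | with_reducible apply Def.and
    | with_reducible apply Def.or
    | with_reducible apply Def.iff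
    | with_reducible apply Def.imp
    | with_reducible apply Def.nott
    | with_reducible apply Def.allX
    | with_reducible apply Def.exX
    | with_reducible apply DFn.smem
    | with_reducible apply DFn.sset
    | with_reducible apply DFn.eq
    | with_reducible apply DFn.spair
    | with_reducible apply DFn.pair
    | with_reducible apply DFn.fst
    | with_reducible apply DFn.snd
    | with_reducible apply DFn.vl)
  all_goals exact 0) : P := h

noncomputable instance instWT : ISet K (WithTop X) where
  val := WithTop.recTopCoe (spair (k0 K) (k0 K)) fun x => spair (k1 K) (vl x)
  inj x y := by
    induction x using WithTop.recTopCoe <;> induction y using WithTop.recTopCoe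
    · simp
    · exact fun h => absurd (Mdl.pinj _ _ _ _ h).1 k01
    · exact fun h => absurd (Mdl.pinj _ _ _ _ h).1.symm k01
    · exact fun h => by rw [vl_inj (Mdl.pinj _ _ _ _ h).2]
  code := by
    obtain ⟨A, h1, h2⟩ := compX (K := K) (k := 0)
      (fun z => z = spair (k0 K) (k0 K) ∨ ∃ x : X, z = spair (k1 K) (vl x)) dd5
    refine ⟨A, h1, fun z => ?_⟩
    rw [h2]
    constructor
    · rintro (rfl | ⟨x, rfl⟩)
      exacts [⟨⊤, rfl⟩, ⟨x, rfl⟩]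
    · rintro ⟨x, rfl⟩
      induction x using WithTop.recTopCoe
      exacts [.inl rfl, .inr ⟨_, rfl⟩]
theorem DFn.coe {f : Γ → X} {i} (hf : DFn V f i) : DFn V (fun γ => (f γ : WithTop X)) i :=
  DFnM.pair (.tm (.cst (k1 K) _)) hf
theorem WTirel [LinearOrder X] [IWO K X] : IRel K (fun x y : WithTop X => x ≤ y) := by
    have h : Def (C2 K (WithTop X) 0 (WithTop X) 0) (fun p => p.2 = ⊤ ∨ ∃ x y : X, p.1.2 = (↑x : WithTop X) ∧ p.2 = (↑y : WithTop X) ∧ x ≤ y) :=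
      .or (DFn.eq (i := 0) .var0 (.cst _)) (.exX 0 (.exX 0 (.and (DFn.eq (i := 0) .var3 (.coe .var1)) (.and (DFn.eq (i := 0) .var2 (.coe .var0))
        (DFn.le (i := 0) .var1 .var0)))))
    refine IRel.mk (k := 0) (h.congr ?_)
    rintro ⟨⟨_, a⟩, b⟩
    induction a using WithTop.recTopCoe <;> induction b using WithTop.recTopCoe <;> simp
instance [LinearOrder X] [IWO K X] : IWO K (WithTop X) where
  irel := WTirel
  wf P hP h := by
    by_cases h' : ∃ x : X, P x
    · obtain ⟨x, h1, h2⟩ := IWO.wf (K := K) (fun x : X => P x) (IPred.mk (k := 0) (hP.df (.coe .var0))) h'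
      refine ⟨x, h1, fun y hy => ?_⟩
      induction y using WithTop.recTopCoe
      · exact le_top
      · exact WithTop.coe_le_coe.2 (h2 _ hy)
    · obtain ⟨x, hx⟩ := h
      refine ⟨x, hx, fun y hy => ?_⟩
      induction y using WithTop.recTopCoe
      · exact le_top
      · exact absurd ⟨_, hy⟩ h'
end

instance : NoMaxOrder (DD K) := ⟨fun d => by
  obtain ⟨R, rfl⟩ := dmk_surj d
  refine ⟨otp K (WithTop (Fld R)), not_le.1 fun h => ?_⟩
  obtain ⟨x, hx⟩ := lt_dmk.1 ((lt_otp.2 ⟨(⊤ : WithTop (Fld R)), rfl⟩).trans_le h)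
  have h1 : rk K x = rk K (x : WithTop (Fld R)) := rk_eq.2 (Seg.of_fam (f := fun x => x)
    (g := fun x : Fld R => (x : WithTop (Fld R))) (k := 0) (l := 0) .var0 (.coe .var0) (fun _ _ h => h)
    (fun _ _ h => WithTop.coe_lt_coe.2 h) (fun _ a _ => ⟨a, rfl⟩) (fun z a ha => by
      induction a using WithTop.recTopCoe
      · exact absurd ha (by simp)
      · exact ⟨_, rfl⟩) x)
  have := rk_mono (K := K) (WithTop.coe_lt_top x)
  order⟩
instance : Nonempty (DD K) := ⟨otp K (DD K)⟩

theorem le_of_sm {X : Type} [ISet K X] [LinearOrder X] [IWO K X] {f : X → X} {k}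
    (hf : DFn (C1 K X k) (fun p => f p.2) k) (hm : StrictMono f) (x : X) : x ≤ f x := by
  by_contra h
  obtain ⟨y, h1, h2⟩ := IWO.least (K := K) (fun x => f x < x) (DFn.lt hf .var0) ⟨x, not_le.1 h⟩
  exact h2 _ h1 (hm h1)

noncomputable def d0 (K : Type) [LNFU.Structure K] [HasLt K] [Mdl K] : DD K :=
  (IWO.wf (K := K) (fun _ : DD K => True) (IPred.mk (k := 0) (.prop _)) ⟨Classical.arbitrary _, trivial⟩).choose
theorem d0_le (x : DD K) : d0 K ≤ x :=
  (IWO.wf (K := K) (fun _ : DD K => True) (IPred.mk (k := 0) (.prop _)) ⟨Classical.arbitrary _, trivial⟩).choose_spec.2 x trivial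
theorem d1_ex (K : Type) [LNFU.Structure K] [HasLt K] [Mdl K] :
    ∃ x : DD K, d0 K < x ∧ ∀ y, d0 K < y → x ≤ y :=
  IWO.wf (K := K) (fun x : DD K => d0 K < x) (IPred.mk (k := 0) (DFn.lt (.cst _) .var0)) (exists_gt _)
noncomputable def d1 (K : Type) [LNFU.Structure K] [HasLt K] [Mdl K] : DD K := (d1_ex K).choose
theorem d0_lt_d1 : d0 K < d1 K := (d1_ex K).choose_spec.1
theorem d1_le {y : DD K} (h : d0 K < y) : d1 K ≤ y := (d1_ex K).choose_spec.2 y h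

/-- the T operation -/
noncomputable def tau (x : DD K) : DD K := rk K x
theorem tau_mono : StrictMono (tau : DD K → DD K) := rk_mono
theorem DFn.tau {Γ : Type} {V : VS Γ K} {f : Γ → DD K} {i} (hf : DFn V f i) :
    DFn V (fun γ => tau (f γ)) (i+2) := DFn.rk hf
theorem lt_tau {d x : DD K} : d < tau x ↔ ∃ y < x, d = tau y := lt_rk
noncomputable def Om (K : Type) [LNFU.Structure K] [HasLt K] [Mdl K] : DD K := otp K (DD K)
theorem lt_Om {d : DD K} : d < Om K ↔ ∃ y, d = tau y := lt_otp

/-- Goedel pairs -/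
structure Gdl (X : Type) where
  a : X
  b : X
section
variable {X Y : Type} [ISet K X] [LinearOrder X] [IWO K X] [ISet K Y] [LinearOrder Y] [IWO K Y]
   {Γ : Type} {V : VS Γ K}
theorem DFn.max {f g : Γ → X} {i} (hf : DFn V f i) (hg : DFn V g i) :
    DFn V (fun γ => Max.max (f γ) (g γ)) i :=
  .of_graph (fun γ m => m = f γ ∧ g γ ≤ f γ ∨ m = g γ ∧ f γ ≤ g γ) (fun γ m => by
    rcases le_total (f γ) (g γ) with h | h
    · rw [max_eq_right h]
      constructor
      · rintro (⟨rfl, h'⟩ | ⟨rfl, _⟩)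
        exacts [le_antisymm h h', rfl]
      · rintro rfl
        exact .inr ⟨rfl, h⟩
    · rw [max_eq_left h]
      constructor
      · rintro (⟨rfl, h'⟩ | ⟨rfl, h'⟩)
        exacts [rfl, le_antisymm h h']
      · rintro rfl
        exact .inl ⟨rfl, h⟩)
   (.or (.and (DFn.eq .var0 (.wk hf)) (DFn.le (.wk hg) (.wk hf)))
     (.and (DFn.eq .var0 (.wk hg)) (DFn.le (.wk hf) (.wk hg))))

@[ext] theorem Gdl.ext' {g h : Gdl X} (h1 : g.a = h.a) (h2 : g.b = h.b) : g = h := by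
  cases g; cases h; cases h1; cases h2; rfl
instance : ISet K (Gdl X) where
  val g := vl (g.a, g.b)
  inj g h e := by
    have := vl_inj e
    exact Gdl.ext' (congrArg Prod.fst this) (congrArg Prod.snd this)
  code := by
    obtain ⟨A, h1, h2⟩ := ISet.code (K := K) (X := X × X)
    exact ⟨A, h1, fun z => by rw [h2]; exact ⟨fun ⟨x, h⟩ => ⟨⟨x.1, x.2⟩, h⟩, fun ⟨x, h⟩ => ⟨_, h⟩⟩⟩
theorem DFn.gmk {f g : Γ → X} {i} (hf : DFn V f i) (hg : DFn V g i) :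
    DFn V (fun γ => (⟨f γ, g γ⟩ : Gdl X)) i := DFn.pair hf hg
theorem DFn.ga {f : Γ → Gdl X} {i} (hf : DFn V f i) : DFn V (fun γ => (f γ).a) i :=
  DFn.fst (f := fun γ => ((f γ).a, (f γ).b)) hf
theorem DFn.gb {f : Γ → Gdl X} {i} (hf : DFn V f i) : DFn V (fun γ => (f γ).b) i :=
  DFn.snd (f := fun γ => ((f γ).a, (f γ).b)) hf

noncomputable instance : LinearOrder (Gdl X) :=
  LinearOrder.lift' (fun g : Gdl X => toLex (max g.a g.b, toLex (g.a, g.b))) fun g h e => by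
    have e2 : (g.a, g.b) = (h.a, h.b) := toLex.injective (congrArg Prod.snd (toLex.injective e))
    exact Gdl.ext' (congrArg Prod.fst e2) (congrArg Prod.snd e2)
theorem Gdl.le_iff (g h : Gdl X) : g ≤ h ↔ max g.a g.b < max h.a h.b ∨
    (max g.a g.b = max h.a h.b ∧ (g.a < h.a ∨ (g.a = h.a ∧ g.b ≤ h.b))) := by
  change toLex (max g.a g.b, toLex (g.a, g.b)) ≤ toLex (max h.a h.b, toLex (h.a, h.b)) ↔ _
  rw [Prod.Lex.toLex_le_toLex, Prod.Lex.toLex_le_toLex]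
theorem Gdl.lt_iff (g h : Gdl X) : g < h ↔ max g.a g.b < max h.a h.b ∨
    (max g.a g.b = max h.a h.b ∧ (g.a < h.a ∨ (g.a = h.a ∧ g.b < h.b))) := by
  change toLex (max g.a g.b, toLex (g.a, g.b)) < toLex (max h.a h.b, toLex (h.a, h.b)) ↔ _
  rw [Prod.Lex.toLex_lt_toLex, Prod.Lex.toLex_lt_toLex]

theorem dd6 {P : Prop} (h : P := by
  (repeat' first
    | with_reducible apply DFn.var0
    | with_reducible apply DFn.var1
    | with_reducible apply DFn.var2
    | with_reducible apply DFn.var3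
    | with_reducible apply DFn.var4
    | with_reducible apply DFn.var5
    | with_reducible apply DFn.var6
    | with_reducible apply DFn.cst
    | with_reducible apply Def.prop
    | (with_reducible apply isDef; apply_assumption -exfalso -symm)
    | (with_reducible apply isDFn; apply_assumption -exfalso -symm)
    | with_reducible apply DFn.var7
    | with_reducible apply DFn.var8
    | with_reducible apply DFn.gmk
    | with_reducible apply DFn.ga
    | with_reducible apply DFn.gb
    | with_reducible apply DFn.max
    | with_reducible apply DFn.tau
    | with_reducible apply DFn.rk
    | with_reducible apply DFn.wle
    | with_reducible apply DFn.mrr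
    | with_reducible apply DFn.cr
    | with_reducible apply DFn.lt
    | with_reducible apply DFn.le
    | with_reducible apply DFn.seg
    | with_reducible apply DFn.wval
    | with_reducible apply DFn.sval
    | with_reducible apply DFn.smk
    | with_reducible apply Def.and
    | with_reducible apply Def.or
    | with_reducible apply Def.iff
    | with_reducible apply Def.imp
    | with_reducible apply Def.nott
    | with_reducible apply Def.allX
    | with_reducible apply Def.exX
    | with_reducible apply DFn.smem
    | with_reducible apply DFn.sset
    | with_reducible apply DFn.eq
    | with_reducible apply DFn.spair
    | with_reducible apply DFn.pair
    | with_reducible apply DFn.fst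
    | with_reducible apply DFn.snd
    | with_reducible apply DFn.vl)
  all_goals exact 0) : P := h

instance : IWO K (Gdl X) where
  irel := by
    refine IRel.mk (k := 0) (Def.congr ?_ fun _ => (Gdl.le_iff _ _).symm)
    exact dd6
  wf P hP h := by
    have hp : ∀ {Γ : Type} {V : VS Γ K} {f : Γ → Gdl X} {i}, DFn V f i → Def V (fun γ => P (f γ)) :=
        fun hf => hP.df hf
    obtain ⟨g, hg⟩ := h
    obtain ⟨m, ⟨g, h0, rfl⟩, h1⟩ := IWO.wf (K := K) (fun m : X => ∃ g, P g ∧ m = max g.a g.b)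
      (IPred.mk (k := 0) dd6) ⟨_, g, hg, rfl⟩
    obtain ⟨m, ⟨g', h0', rfl, hmm⟩, h2⟩ := IWO.wf (K := K)
      (fun a : X => ∃ g', P g' ∧ a = g'.a ∧ max g'.a g'.b = max g.a g.b)
      (IPred.mk (k := 0) dd6) ⟨_, g, h0, rfl, rfl⟩
    rw [← hmm] at h1 h2
    obtain ⟨m, ⟨g, h0, rfl, hmm, ha⟩, h3⟩ := IWO.wf (K := K)
      (fun a : X => ∃ g, P g ∧ a = g.b ∧ max g.a g.b = max g'.a g'.b ∧ g.a = g'.a)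
      (IPred.mk (k := 0) dd6) ⟨_, g', h0', rfl, rfl, rfl⟩
    rw [← hmm, ← ha] at h2 h3
    rw [← hmm] at h1
    refine ⟨g, h0, fun q hq => ?_⟩
    rw [Gdl.le_iff]
    rcases (h1 _ ⟨q, hq, rfl⟩).lt_or_eq with h | h
    · exact .inl h
    · refine .inr ⟨h, ?_⟩
      rcases (h2 _ ⟨q, hq, rfl, h.symm⟩).lt_or_eq with h' | h'
      · exact .inl h'
      · exact .inr ⟨h', h3 _ ⟨q, hq, rfl, h.symm, h'.symm⟩⟩

/-- strictly monotone maps with lower range induce such maps on Goedel pairs -/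
def Gdl.map (f : X → Y) (g : Gdl X) : Gdl Y := ⟨f g.a, f g.b⟩
theorem Gdl.map_mono {f : X → Y} (hf : StrictMono f) : StrictMono (Gdl.map f) := by
  intro g h
  rw [Gdl.lt_iff, Gdl.lt_iff]
  simp only [Gdl.map, ← hf.monotone.map_max, hf.lt_iff_lt, hf.injective.eq_iff]
  exact id
theorem Gdl.map_low {f : X → Y} (hf : StrictMono f) (hl : ∀ x, ∀ y < f x, ∃ x', f x' = y) (g : Gdl X)
    (h : Gdl Y) (hh : h < Gdl.map f g) : ∃ g', Gdl.map f g' = h := by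
  have hm : max h.a h.b ≤ f (max g.a g.b) := by
    rw [Gdl.lt_iff] at hh
    simp only [Gdl.map, ← hf.monotone.map_max] at hh
    rcases hh with h | h
    exacts [h.le, h.1.le]
  have key : ∀ y, y ≤ f (max g.a g.b) → ∃ x', f x' = y := fun y hy => by
    rcases hy.lt_or_eq with h | h
    exacts [hl _ _ h, ⟨_, h.symm⟩]
  obtain ⟨a, ha⟩ := key h.a ((le_max_left _ _).trans hm)
  obtain ⟨b, hb⟩ := key h.b ((le_max_right _ _).trans hm)
  exact ⟨⟨a, b⟩, Gdl.ext' ha hb⟩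
end

theorem q_lt (g : Gdl (DD K)) : ∃ d, rk K g = tau d := by
  obtain ⟨e, he⟩ := exists_gt (max g.a g.b)
  obtain ⟨R, rfl⟩ := dmk_surj e
  obtain ⟨x, hx⟩ := lt_dmk.1 ((le_max_left _ _).trans_lt he)
  obtain ⟨y, hy⟩ := lt_dmk.1 ((le_max_right _ _).trans_lt he)
  have hlow : ∀ x : Fld R, ∀ y < rk K x, ∃ x' : Fld R, rk K x' = y := fun x y h => by
    obtain ⟨z, _, rfl⟩ := lt_rk.1 h
    exact ⟨z, rfl⟩
  have := Seg.of_fam (K := K) (Z := Gdl (Fld R)) (f := fun z => rk K z) (g := fun z => Gdl.map (rk K) z) (k := 0) (l := 2)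
    (.rk .var0) (DFn.gmk (.rk (.ga .var0)) (.rk (.gb .var0))) rk_mono (Gdl.map_mono rk_mono)
    (fun z d h => by
      obtain ⟨z, _, rfl⟩ := lt_rk.1 h
      exact ⟨z, rfl⟩) (fun z d h => Gdl.map_low rk_mono hlow z d h) ⟨x, y⟩
  have e : Gdl.map (rk K) ⟨x, y⟩ = g := Gdl.ext' hx.symm hy.symm
  rw [e] at this
  exact ⟨_, (rk_eq.2 this).symm⟩

noncomputable def pG (g : Gdl (DD K)) : DD K := (q_lt g).choose
theorem tau_pG (g : Gdl (DD K)) : tau (pG g) = rk K g := (q_lt g).choose_spec.symm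
theorem pG_mono : StrictMono (pG : Gdl (DD K) → DD K) := fun g h hl => by
  rw [← tau_mono.lt_iff_lt, tau_pG, tau_pG]; exact rk_mono hl
theorem DFn.pG {Γ : Type} {V : VS Γ K} {f : Γ → Gdl (DD K)} {i} (hf : DFn V f i) :
    DFn V (fun γ => pG (f γ)) i :=
  .of_graph (fun γ d => NFUweak.tau d = NFUweak.rk K (f γ)) (fun γ d => by
    rw [← tau_pG]; exact tau_mono.injective.eq_iff) (DFn.eq (.tau .var0) (.rk (.wk hf)))
theorem pG_low (g : Gdl (DD K)) (d : DD K) (h : d < pG g) : ∃ g', pG g' = d := by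
  rw [← tau_mono.lt_iff_lt, tau_pG] at h
  obtain ⟨g', _, e⟩ := lt_rk.1 h
  rw [← tau_pG] at e
  exact ⟨g', tau_mono.injective e.symm⟩

/-- pairing on the ordinals -/
noncomputable def pp (x y : DD K) : DD K := pG ⟨x, y⟩
theorem DFn.pp {Γ : Type} {V : VS Γ K} {f g : Γ → DD K} {i} (hf : DFn V f i) (hg : DFn V g i) :
    DFn V (fun γ => pp (f γ) (g γ)) i := .pG (.gmk hf hg)
theorem pp_inj {x y x' y' : DD K} (h : pp x y = pp x' y') : x = x' ∧ y = y' := by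
  have := pG_mono.injective h
  exact ⟨congrArg Gdl.a this, congrArg Gdl.b this⟩
theorem pp_mono {x y x' y' : DD K} (h : x ≤ x') (h' : y ≤ y') : pp x y ≤ pp x' y' := by
  refine pG_mono.monotone ?_
  rw [Gdl.le_iff]
  rcases (max_le_max h h').lt_or_eq with h1 | h1
  · exact .inl h1
  · refine .inr ⟨h1, ?_⟩
    rcases h.lt_or_eq with h2 | h2
    exacts [.inl h2, .inr ⟨h2, h'⟩]
theorem le_pp0 (x : DD K) : x ≤ pp (d0 K) x :=
  le_of_sm (f := fun x => pp (d0 K) x) (k := 0) (.pp (.cst _) .var0) (fun x y h => pG_mono (by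
    rw [Gdl.lt_iff]
    refine .inl ?_
    simpa only [max_eq_right (d0_le _)] using h)) x
theorem max_le_pp (x y : DD K) : max x y ≤ pp x y := by
  refine (le_pp0 _).trans (pG_mono.monotone ?_)
  rw [Gdl.le_iff]
  simp only [max_eq_right (d0_le (max x y))]
  refine .inr ⟨trivial, ?_⟩
  rcases (d0_le x).lt_or_eq with h | h
  · exact .inl h
  · refine .inr ⟨h, ?_⟩
    rw [← h, max_eq_right (d0_le y)]
theorem max_lt_pp {x y : DD K} (hx : d0 K < x) : max x y < pp x y := by
  refine (le_pp0 _).trans_lt (pG_mono ?_)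
  rw [Gdl.lt_iff]
  simp only [max_eq_right (d0_le (max x y))]
  exact .inr ⟨trivial, .inl hx⟩
theorem pp_surj (d : DD K) : ∃ x y, pp x y = d := by
  obtain ⟨e, he⟩ := exists_gt d
  obtain ⟨g, hg⟩ := pG_low ⟨d0 K, e⟩ d (he.trans_le (le_pp0 e))
  exact ⟨g.a, g.b, hg⟩
noncomputable def p1 (d : DD K) : DD K := (pp_surj d).choose
noncomputable def p2 (d : DD K) : DD K := (pp_surj d).choose_spec.choose
@[simp] theorem pp_p (d : DD K) : pp (p1 d) (p2 d) = d := (pp_surj d).choose_spec.choose_spec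
@[simp] theorem p1_pp (x y : DD K) : p1 (pp x y) = x := (pp_inj (pp_p _)).1
@[simp] theorem p2_pp (x y : DD K) : p2 (pp x y) = y := (pp_inj (pp_p _)).2
theorem p1_le (d : DD K) : p1 d ≤ d := by
  conv_rhs => rw [← pp_p d]
  exact (le_max_left _ _).trans (max_le_pp _ _)
theorem p2_le (d : DD K) : p2 d ≤ d := by
  conv_rhs => rw [← pp_p d]
  exact (le_max_right _ _).trans (max_le_pp _ _)
theorem DFn.p1 {Γ : Type} {V : VS Γ K} {f : Γ → DD K} {i} (hf : DFn V f i) :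
    DFn V (fun γ => p1 (f γ)) i :=
  .of_graph (fun γ x => ∃ y, NFUweak.pp x y = f γ) (fun γ x => ⟨fun ⟨y, h⟩ => by rw [← h, p1_pp],
    fun h => ⟨NFUweak.p2 (f γ), by rw [h, pp_p]⟩⟩) (.exX i (DFn.eq (.pp .var1 .var0) (.wk (.wk hf))))
theorem DFn.p2 {Γ : Type} {V : VS Γ K} {f : Γ → DD K} {i} (hf : DFn V f i) :
    DFn V (fun γ => p2 (f γ)) i :=
  .of_graph (fun γ x => ∃ y, NFUweak.pp y x = f γ) (fun γ x => ⟨fun ⟨y, h⟩ => by rw [← h, p2_pp],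
    fun h => ⟨NFUweak.p1 (f γ), by rw [h, pp_p]⟩⟩) (.exX i (DFn.eq (.pp .var0 .var1) (.wk (.wk hf))))
end
end NFUweak

open FirstOrder Language
namespace NFUweak
set_option linter.unusedSectionVars false
set_option linter.unusedVariables false

section
variable {K : Type} [LNFU.Structure K] [HasLt K] [Mdl K]

/-! ## Recursion -/
section
variable (G : (DD K → DD K → Prop) → DD K → DD K → Prop)
def Att (R : K) (b : DD K) : Prop := ∀ a ≤ b, ∀ y : DD K, cr R y a ↔ G (cr R) a y
def RecE (y b : DD K) : Prop := ∃ R, Att G R b ∧ cr R y b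

theorem RecE_irel (hG : Def (C3 K K 1 (DD K) 0 (DD K) 0) (fun p => G (cr p.1.1.2) p.1.2 p.2)) : IRel K (RecE G) := by
  have hg : ∀ {Γ : Type} {V : VS Γ K} {R : Γ → K} {f g : Γ → DD K}, DFn V R 1 → DFn V f 0 → DFn V g 0 →
    Def V (fun γ => G (cr (R γ)) (f γ) (g γ)) := fun h1 h2 h3 => Def.c3 (P := fun R b y => G (cr R) b y) hG h1 h2 h3
  refine IRel.mk (k := 0) ?_
  refine Def.exX 1 (.and (.allX 0 (.imp ?_ (.allX 0 (.iff ?_ ?_)))) ?_)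
  · exact DFn.le .var0 .var2
  · exact DFn.cr .var2 .var0 .var1
  · exact hg .var2 .var1 .var0
  · exact DFn.cr .var0 .var2 .var1
theorem Att_uniq (hG : Def (C3 K K 1 (DD K) 0 (DD K) 0) (fun p => G (cr p.1.1.2) p.1.2 p.2))
    (hl : ∀ R R' b, (∀ a < b, ∀ y, R y a ↔ R' y a) → ∀ y, G R b y ↔ G R' b y) {R R' : K} {b : DD K} (h : Att G R b) (h' : Att G R' b) (a : DD K) :
    a ≤ b → ∀ y : DD K, cr R y a ↔ cr R' y a := by
  refine IWO.ind (K := K) (fun a => a ≤ b → ∀ y : DD K, cr R y a ↔ cr R' y a) (k := 0) dd6 ?_ a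
  intro a ih ha y
  rw [h a ha, h' a ha]
  exact hl _ _ _ (fun c hc => ih c hc (hc.le.trans ha)) y
theorem RecE_att (hG : Def (C3 K K 1 (DD K) 0 (DD K) 0) (fun p => G (cr p.1.1.2) p.1.2 p.2))
    (hl : ∀ R R' b, (∀ a < b, ∀ y, R y a ↔ R' y a) → ∀ y, G R b y ↔ G R' b y) {R : K} {a b : DD K} (h : Att G R b) (ha : a ≤ b) (y : DD K) :
    RecE G y a ↔ cr R y a := by
  have h1 : Att G R a := fun c hc => h c (hc.trans ha)
  exact ⟨fun ⟨R', h2, h3⟩ => (Att_uniq G hG hl h2 h1 a le_rfl y).1 h3, fun h3 => ⟨R, h1, h3⟩⟩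
theorem RecE_att' (hG : Def (C3 K K 1 (DD K) 0 (DD K) 0) (fun p => G (cr p.1.1.2) p.1.2 p.2))
    (hl : ∀ R R' b, (∀ a < b, ∀ y, R y a ↔ R' y a) → ∀ y, G R b y ↔ G R' b y) {R : K} {a : DD K} (h : Att G R a) (y : DD K) :
    RecE G y a ↔ G (RecE G) a y := by
  rw [RecE_att G hG hl h le_rfl, h a le_rfl]
  exact hl _ _ _ (fun c hc y => (RecE_att G hG hl h hc.le y).symm) y
theorem Att_ex (hG : Def (C3 K K 1 (DD K) 0 (DD K) 0) (fun p => G (cr p.1.1.2) p.1.2 p.2))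
    (hl : ∀ R R' b, (∀ a < b, ∀ y, R y a ↔ R' y a) → ∀ y, G R b y ↔ G R' b y) (b : DD K) : ∃ R, Att G R b := by
  have hg : ∀ {Γ : Type} {V : VS Γ K} {R : Γ → K} {f g : Γ → DD K}, DFn V R 1 → DFn V f 0 → DFn V g 0 →
    Def V (fun γ => G (cr (R γ)) (f γ) (g γ)) := fun h1 h2 h3 => Def.c3 (P := fun R b y => G (cr R) b y) hG h1 h2 h3
  obtain ⟨C, _, hC⟩ := (RecE_irel G hG).code
  have hC' : RecE G = cr C := funext fun x => funext fun y => propext (hC x y).symm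
  refine IWO.ind (K := K) (fun b => ∃ R, Att G R b) (k := 0) ?_ ?_ b
  · refine Def.exX 1 (.allX 0 (.imp (DFn.le .var0 .var2) (.allX 0 (.iff ?_ (hg .var2 .var1 .var0)))))
    exact DFn.cr .var2 .var0 .var1
  intro b ih
  obtain ⟨R, _, hR⟩ := (IRel.mk (K := K) (k := 0) (Q := fun y a : DD K => (a < b ∧ cr C y a) ∨ (a = b ∧ G (cr C) b y))
    (.or (.and (DFn.lt .var0 (.cst b)) (DFn.cr (.cst C) .var1 .var0))
      (.and (DFn.eq .var0 (.cst b)) (hg (.cst _) (.cst _) .var1)))).code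
  rw [← hC'] at hR
  have h1 : ∀ a < b, ∀ y, cr R y a ↔ RecE G y a := fun a ha y => by
    rw [hR]; simp [ha, ha.ne]
  refine ⟨R, fun a ha y => ?_⟩
  have h2 : G (cr R) a y ↔ G (RecE G) a y := hl _ _ _ (fun c hc y => h1 c (hc.trans_le ha) y) y
  rw [h2]
  rcases ha.lt_or_eq with ha | rfl
  · rw [h1 a ha]
    obtain ⟨R', h'⟩ := ih a ha
    exact RecE_att' G hG hl h' y
  · rw [hR]; simp
theorem rec_ex (hG : Def (C3 K K 1 (DD K) 0 (DD K) 0) (fun p => G (cr p.1.1.2) p.1.2 p.2))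
    (hl : ∀ R R' b, (∀ a < b, ∀ y, R y a ↔ R' y a) → ∀ y, G R b y ↔ G R' b y) : ∃ E : DD K → DD K → Prop, IRel K E ∧ ∀ b y, E y b ↔ G E b y :=
  ⟨RecE G, RecE_irel G hG, fun b y => by
    obtain ⟨R, h⟩ := Att_ex G hG hl b
    exact RecE_att' G hG hl h y⟩
end
end
end NFUweak

open FirstOrder Language
namespace NFUweak
set_option linter.unusedSectionVars false
set_option linter.unusedVariables false
set_option linter.unusedSimpArgs false

section
variable {K : Type} [LNFU.Structure K] [HasLt K] [Mdl K]

theorem pp_lt {x y x' y' : DD K} : pp x y < pp x' y' ↔ max x y < max x' y' ∨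
    (max x y = max x' y' ∧ (x < x' ∨ (x = x' ∧ y < y'))) := by
  unfold pp
  rw [pG_mono.lt_iff_lt, Gdl.lt_iff]

theorem Def.exFin {Γ : Type} {V : VS Γ K} : ∀ {n : ℕ} {P : Fin n → Γ → Prop}, (∀ j, Def V (P j)) →
    Def V (fun γ => ∃ j, P j γ) := by
  intro n
  induction n with
  | zero => intro P h; exact Def.fal.congr fun γ => by simp
  | succ n ih => intro P h; exact (Def.or (h 0) (ih fun j => h j.succ)).congr fun γ => by
                  rw [Fin.exists_fin_succ]

/-- opcodes -/
noncomputable def op (K : Type) [LNFU.Structure K] [HasLt K] [Mdl K] : ℕ → DD K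
  | 0 => d1 K
  | n+1 => pp (d1 K) (op K n)
theorem op_mono : StrictMono (op K) := strictMono_nat_of_lt_succ fun n =>
  (le_max_right _ _).trans_lt (max_lt_pp d0_lt_d1)
@[simp] theorem op_inj {i j : ℕ} : op K i = op K j ↔ i = j := op_mono.injective.eq_iff
theorem op_pos (i : ℕ) : d0 K < op K i := d0_lt_d1.trans_le (op_mono.monotone (Nat.zero_le i))

/-- stack operations -/
noncomputable def uu : Fin 7 → DD K → DD K → DD K
  | 0, x, _ => pp x x
  | 1, x, _ => pp (p1 x) (pp (p2 x) (p1 x))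
  | 2, x, _ => pp (p1 x) (pp (p1 (p2 x)) (p1 (p2 (p2 x))))
  | 3, x, _ => pp (p1 x) (pp (p1 (p2 x)) (p2 (p2 (p2 x))))
  | 4, x, _ => pp (p1 x) (pp (p1 (p1 (p2 x))) (pp (p2 (p1 (p2 x))) (p2 (p2 x))))
  | 5, x, _ => p2 (p2 x)
  | 6, x, b => pp (p1 x) (pp (p2 x) b)
theorem DFn.uu (j : Fin 7) {Γ : Type} {V : VS Γ K} {f g : Γ → DD K} {i} (hf : DFn V f i) (hg : DFn V g i) :
    DFn V (fun γ => uu j (f γ) (g γ)) i := by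
  fin_cases j
  · exact .pp hf hf
  · exact .pp (.p1 hf) (.pp (.p2 hf) (.p1 hf))
  · exact .pp (.p1 hf) (.pp (.p1 (.p2 hf)) (.p1 (.p2 (.p2 hf))))
  · exact .pp (.p1 hf) (.pp (.p1 (.p2 hf)) (.p2 (.p2 (.p2 hf))))
  · exact .pp (.p1 hf) (.pp (.p1 (.p1 (.p2 hf))) (.pp (.p2 (.p1 (.p2 hf))) (.p2 (.p2 hf))))
  · exact .p2 (.p2 hf)
  · exact .pp (.p1 hf) (.pp (.p2 hf) hg)

theorem dd7 {P : Prop} (h : P := by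
  (repeat' first
    | with_reducible apply DFn.var0
    | with_reducible apply DFn.var1
    | with_reducible apply DFn.var2
    | with_reducible apply DFn.var3
    | with_reducible apply DFn.var4
    | with_reducible apply DFn.var5
    | with_reducible apply DFn.var6
    | with_reducible apply DFn.cst
    | with_reducible apply Def.prop
    | (with_reducible apply isDef; apply_assumption -exfalso -symm)
    | (with_reducible apply isDFn; apply_assumption -exfalso -symm)
    | with_reducible apply DFn.var7
    | with_reducible apply DFn.var8
    | with_reducible apply DFn.uu
    | with_reducible apply DFn.pp
    | with_reducible apply DFn.p1
    | with_reducible apply DFn.p2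
    | with_reducible apply DFn.max
    | with_reducible apply DFn.tau
    | with_reducible apply DFn.rk
    | with_reducible apply DFn.cr
    | with_reducible apply DFn.lt
    | with_reducible apply DFn.le
    | with_reducible apply DFn.seg
    | with_reducible apply DFn.sval
    | with_reducible apply DFn.smk
    | with_reducible apply Def.and
    | with_reducible apply Def.or
    | with_reducible apply Def.iff
    | with_reducible apply Def.imp
    | with_reducible apply Def.nott
    | with_reducible apply Def.allX
    | with_reducible apply Def.exX
    | with_reducible apply DFn.smem
    | with_reducible apply DFn.sset
    | with_reducible apply DFn.eq
    | with_reducible apply DFn.spair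
    | with_reducible apply DFn.pair
    | with_reducible apply DFn.fst
    | with_reducible apply DFn.snd
    | with_reducible apply DFn.vl)
  all_goals exact 0) : P := h

/-! index components -/
noncomputable def ia (γ : DD K) := p1 (p1 (p2 γ))
noncomputable def ib (γ : DD K) := p2 (p1 (p2 γ))
noncomputable def ic (γ : DD K) := p2 (p2 γ)
noncomputable def ix (i : ℕ) (a b c : DD K) : DD K := pp (op K i) (pp (pp a b) c)
@[simp] theorem p1_ix (i) (a b c : DD K) : p1 (ix i a b c) = op K i := by simp [ix]
@[simp] theorem ia_ix (i) (a b c : DD K) : ia (ix i a b c) = a := by simp [ix, ia]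
@[simp] theorem ib_ix (i) (a b c : DD K) : ib (ix i a b c) = b := by simp [ix, ib]
@[simp] theorem ic_ix (i) (a b c : DD K) : ic (ix i a b c) = c := by simp [ix, ic]
theorem ic_le (γ : DD K) : ic γ ≤ γ := (p2_le _).trans (p2_le _)
theorem p2_lt {γ : DD K} (h : d0 K < p1 γ) : p2 γ < γ := by
  have := (le_max_right _ _).trans_lt (max_lt_pp (y := p2 γ) h)
  rwa [pp_p] at this
theorem ia_lt {γ : DD K} {i} (h : p1 γ = op K i) : ia γ < γ :=
  ((p1_le _).trans (p1_le _)).trans_lt (p2_lt (h ▸ op_pos i))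
theorem ib_lt {γ : DD K} {i} (h : p1 γ = op K i) : ib γ < γ :=
  ((p2_le _).trans (p1_le _)).trans_lt (p2_lt (h ▸ op_pos i))

def GG (R : DD K → DD K → Prop) (γ x : DD K) : Prop := x < ic γ ∧
  ((p1 γ = op K 0 ∧ ¬ (R x (ia γ) ∧ R x (ib γ))) ∨ (p1 γ = op K 1 ∧ ∃ s < ib γ, R (pp x s) (ia γ)) ∨
  (p1 γ = op K 2 ∧ p1 x < p2 x) ∨ (p1 γ = op K 3 ∧ p2 x < γ ∧ R (p1 x) (p2 x)) ∨
  ∃ j : Fin 7, p1 γ = op K (4 + j) ∧ R (uu j x (ib γ)) (ia γ))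

theorem GG_ex (K : Type) [LNFU.Structure K] [HasLt K] [Mdl K] :
    ∃ E : DD K → DD K → Prop, IRel K E ∧ ∀ b y, E y b ↔ GG E b y := by
  refine rec_ex GG ?_ ?_
  · unfold GG ia ib ic
    refine .and dd7 (.or dd7 (.or dd7 (.or dd7 (.or dd7 (.exFin fun j => ?_)))))
    refine .and dd7 (DFn.cr .var2 (.uu j .var0 dd7) dd7)
  · intro R R' γ h x
    unfold GG
    have e : ∀ {i}, p1 γ = op K i → ∀ y, (R y (ia γ) ↔ R' y (ia γ)) ∧ (R y (ib γ) ↔ R' y (ib γ)) :=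
      fun hi y => ⟨h _ (ia_lt hi) y, h _ (ib_lt hi) y⟩
    refine and_congr_right fun _ => ?_
    refine or_congr (and_congr_right fun hi => ?_) (or_congr (and_congr_right fun hi => ?_)
      (or_congr Iff.rfl (or_congr (and_congr_right fun hi => and_congr_right fun hl => h _ hl _)
       (exists_congr fun j => and_congr_right fun hi => (e hi _).1))))
    · rw [(e hi _).1, (e hi _).2]
    · exact exists_congr fun s => and_congr_right fun _ => (e hi _).1
/-- the membership relation of the constructible hierarchy, as sets of ordinals -/
def EE (x γ : DD K) : Prop := (GG_ex K).choose x γ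
theorem EE_irel : IRel K (EE (K := K)) := (GG_ex K).choose_spec.1
theorem EE_iff (x γ : DD K) : EE x γ ↔ GG EE γ x := (GG_ex K).choose_spec.2 γ x
theorem DFn.ee {Γ : Type} {V : VS Γ K} {f g : Γ → DD K} {i} (hf : DFn V f i) (hg : DFn V g i) :
    Def V (fun γ => EE (f γ) (g γ)) := EE_irel.df hf hg
theorem EE_lt {x γ : DD K} (h : EE x γ) : x < γ := ((EE_iff _ _).1 h).1.trans_le (ic_le _)

theorem dd8 {P : Prop} (h : P := by
  (repeat' first
    | with_reducible apply DFn.var0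
    | with_reducible apply DFn.var1
    | with_reducible apply DFn.var2
    | with_reducible apply DFn.var3
    | with_reducible apply DFn.var4
    | with_reducible apply DFn.var5
    | with_reducible apply DFn.var6
    | with_reducible apply DFn.cst
    | with_reducible apply Def.prop
    | (with_reducible apply isDef; apply_assumption -exfalso -symm)
    | (with_reducible apply isDFn; apply_assumption -exfalso -symm)
    | with_reducible apply DFn.var7
    | with_reducible apply DFn.var8
    | with_reducible apply DFn.ee
    | with_reducible apply DFn.uu
    | with_reducible apply DFn.pp
    | with_reducible apply DFn.p1
    | with_reducible apply DFn.p2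
    | with_reducible apply DFn.max
    | with_reducible apply DFn.tau
    | with_reducible apply DFn.rk
    | with_reducible apply DFn.cr
    | with_reducible apply DFn.lt
    | with_reducible apply DFn.le
    | with_reducible apply DFn.seg
    | with_reducible apply DFn.sval
    | with_reducible apply DFn.smk
    | with_reducible apply Def.and
    | with_reducible apply Def.or
    | with_reducible apply Def.iff
    | with_reducible apply Def.imp
    | with_reducible apply Def.nott
    | with_reducible apply Def.allX
    | with_reducible apply Def.exX
    | with_reducible apply DFn.smem
    | with_reducible apply DFn.sset
    | with_reducible apply DFn.eq
    | with_reducible apply DFn.spair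
    | with_reducible apply DFn.pair
    | with_reducible apply DFn.fst
    | with_reducible apply DFn.snd
    | with_reducible apply DFn.vl)
  all_goals exact 0) : P := h

theorem opn {i : ℕ} (h : i < 4) (j : Fin 7) : (i = 4 + (j:ℕ)) ↔ False := iff_false_intro (by omega)
theorem EE_nand {x a b c : DD K} : EE x (ix 0 a b c) ↔ x < c ∧ ¬ (EE x a ∧ EE x b) := by
  rw [EE_iff, GG]; simp [opn (i := 0)]
theorem EE_ex {x a b c : DD K} : EE x (ix 1 a b c) ↔ x < c ∧ ∃ s < b, EE (pp x s) a := by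
  rw [EE_iff, GG]; simp [opn (i := 1)]
theorem EE_less {x a b c : DD K} : EE x (ix 2 a b c) ↔ x < c ∧ p1 x < p2 x := by
  rw [EE_iff, GG]; simp [opn (i := 2)]
theorem EE_ee {x a b c : DD K} : EE x (ix 3 a b c) ↔ x < c ∧ EE (p1 x) (p2 x) := by
  rw [EE_iff, GG]
  refine ⟨fun h => ⟨by simpa using h.1, ?_⟩, fun h => ⟨by simpa using h.1, ?_⟩⟩
  · have := h.2; simp [opn (i := 3)] at this; exact this.2
  · have := (p2_le x).trans_lt (h.1.trans_le (ic_ix 3 a b c ▸ ic_le (ix 3 a b c)))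
    simp [h.2, this]
theorem EE_uu {x a b c : DD K} (j : Fin 7) : EE x (ix (4 + j) a b c) ↔ x < c ∧ EE (uu j x b) a := by
  rw [EE_iff, GG]
  simp only [p1_ix, ia_ix, ib_ix, ic_ix, op_inj]
  have : ∀ j' : Fin 7, 4 + (j:ℕ) = 4 + j' ↔ j' = j := fun j' => by rw [Fin.ext_iff]; omega
  simp only [this]
  refine and_congr_right fun _ => ?_
  constructor
  · rintro (h | h | h | h | ⟨j, rfl, h⟩)
    · omega
    · omega
    · omega
    · omega
    · exact h
  · exact fun h => .inr (.inr (.inr (.inr ⟨j, rfl, h⟩)))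

/-! ## isomorphisms -/
structure IsoH (H : DD K → Prop) (π : DD K → DD K) : Prop where
  ip : IPred K H
  df : ∃ k l, DFn (C1 K (DD K) k) (fun p => π p.2) l
  h0 : H (d0 K)
  h1 : H (d1 K)
  hp : ∀ {x y}, H x → H y → H (pp x y)
  hp1 : ∀ {x}, H x → H (p1 x)
  hp2 : ∀ {x}, H x → H (p2 x)
  mono : ∀ {x y}, H x → H y → x < y → π x < π y
  low : ∀ {x d}, H x → d < π x → ∃ y, H y ∧ d = π y
  sk : ∀ {t a d}, H t → H a → H d → (∃ s < d, EE (pp t s) a) → ∃ s, H s ∧ s < d ∧ EE (pp t s) a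

namespace IsoH
variable {H : DD K → Prop} {π : DD K → DD K}
theorem lt_iff (h : IsoH H π) {x y} (hx : H x) (hy : H y) : π x < π y ↔ x < y := by
  refine ⟨fun hl => ?_, h.mono hx hy⟩
  by_contra hn
  rcases (not_lt.1 hn).lt_or_eq with h' | h'
  · exact absurd (h.mono hy hx h') hl.not_gt
  · subst h'; exact lt_irrefl _ hl
theorem inj (h : IsoH H π) {x y} (hx : H x) (hy : H y) : π x = π y ↔ x = y := by
  refine ⟨fun he => ?_, fun h => h ▸ rfl⟩
  have h1 := h.lt_iff hx hy
  have h2 := h.lt_iff hy hx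
  rcases lt_trichotomy x y with h' | h' | h'
  · exact absurd (h1.2 h') (by rw [he]; exact lt_irrefl _)
  · exact h'
  · exact absurd (h2.2 h') (by rw [he]; exact lt_irrefl _)
theorem pi0 (h : IsoH H π) : π (d0 K) = d0 K := by
  by_contra hn
  obtain ⟨y, hy, e⟩ := h.low h.h0 (lt_of_le_of_ne (d0_le _) (Ne.symm hn))
  have : π y < π (d0 K) := e ▸ lt_of_le_of_ne (d0_le _) (Ne.symm hn)
  exact absurd ((h.lt_iff hy h.h0).1 this) (not_lt.2 (d0_le _))
theorem pi1 (h : IsoH H π) : π (d1 K) = d1 K := by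
  have h1 : d1 K ≤ π (d1 K) := d1_le (by
    have := h.mono h.h0 h.h1 d0_lt_d1
    rwa [h.pi0] at this)
  refine (h1.lt_or_eq.resolve_left fun h2 => ?_).symm
  obtain ⟨y, hy, e⟩ := h.low h.h1 h2
  have h3 : y < d1 K := (h.lt_iff hy h.h1).1 (e ▸ h2)
  have h4 : y = d0 K := le_antisymm (not_lt.1 fun h' => absurd (d1_le h') (not_le.2 h3)) (d0_le _)
  rw [h4, h.pi0] at e
  exact absurd d0_lt_d1 (by rw [e]; exact lt_irrefl _)
theorem max_eq (h : IsoH H π) {x y} (hx : H x) (hy : H y) : max (π x) (π y) = π (max x y) ∧ H (max x y) := by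
  rcases le_total x y with h' | h'
  · rw [max_eq_right h']
    refine ⟨max_eq_right ?_, hy⟩
    rwa [← not_lt, h.lt_iff hy hx, not_lt]
  · rw [max_eq_left h']
    refine ⟨max_eq_left ?_, hx⟩
    rwa [← not_lt, h.lt_iff hx hy, not_lt]
theorem low' (h : IsoH H π) {x d} (hx : H x) (hd : d ≤ π x) : ∃ y, H y ∧ d = π y := by
  rcases hd.lt_or_eq with h' | h'
  exacts [h.low hx h', ⟨x, hx, h'⟩]
theorem pp_lt_iff (h : IsoH H π) {x y x' y'} (hx : H x) (hy : H y) (hx' : H x') (hy' : H y') :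
    pp (π x) (π y) < pp (π x') (π y') ↔ pp x y < pp x' y' := by
  rw [pp_lt, pp_lt, (h.max_eq hx hy).1, (h.max_eq hx' hy').1, h.lt_iff (h.max_eq hx hy).2 (h.max_eq hx' hy').2,
    h.inj (h.max_eq hx hy).2 (h.max_eq hx' hy').2, h.lt_iff hx hx', h.lt_iff hy hy', h.inj hx hx']
theorem pi_p (h : IsoH H π) (d : DD K) : H d → π d = pp (π (p1 d)) (π (p2 d)) := by
  obtain ⟨k, l, hd⟩ := h.df
  have hπ : ∀ {Γ : Type} {V : VS Γ K} {f : Γ → DD K}, DFn V f k → DFn V (fun γ => π (f γ)) l :=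
    fun hf => DFn.c1 (F := π) hd hf
  refine IWO.ind (K := K) (fun d => H d → π d = pp (π (p1 d)) (π (p2 d))) (k := k)
    (.imp (h.ip.df .var0) (DFn.eq (hπ .var0) (.pp (hπ (.p1 .var0)) (hπ (.p2 .var0))))) ?_ d
  intro d ih hd
  have e1 := h.hp1 hd
  have e2 := h.hp2 hd
  rcases lt_trichotomy (π d) (pp (π (p1 d)) (π (p2 d))) with h' | h' | h'
  · exfalso
    have hm : max (p1 (π d)) (p2 (π d)) ≤ π (max (p1 d) (p2 d)) := by
      rw [← (h.max_eq e1 e2).1]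
      rw [← pp_p (π d), pp_lt] at h'
      rcases h' with h' | h'
      exacts [h'.le, h'.1.le]
    obtain ⟨x, hx, ex⟩ := h.low' (h.max_eq e1 e2).2 ((le_max_left _ _).trans hm)
    obtain ⟨y, hy, ey⟩ := h.low' (h.max_eq e1 e2).2 ((le_max_right _ _).trans hm)
    rw [← pp_p (π d), ex, ey, h.pp_lt_iff hx hy e1 e2, pp_p] at h'
    have := ih _ h' (h.hp hx hy)
    rw [p1_pp, p2_pp, ← ex, ← ey, pp_p, h.inj (h.hp hx hy) hd] at this
    exact absurd h' (by rw [this]; exact lt_irrefl _)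
  · exact h'
  · exfalso
    obtain ⟨y, hy, ey⟩ := h.low hd h'
    rw [ey] at h'
    rw [h.lt_iff hy hd] at h'
    have := ih y h' hy
    rw [← ey] at this
    obtain ⟨a, b⟩ := pp_inj this
    rw [h.inj e1 (h.hp1 hy)] at a
    rw [h.inj e2 (h.hp2 hy)] at b
    rw [← pp_p d, ← pp_p y, a, b] at h'
    exact lt_irrefl _ h'
theorem pi_pp (h : IsoH H π) {x y} (hx : H x) (hy : H y) : π (pp x y) = pp (π x) (π y) := by
  rw [h.pi_p _ (h.hp hx hy), p1_pp, p2_pp]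
theorem pi_p1 (h : IsoH H π) {x} (hx : H x) : π (p1 x) = p1 (π x) := by rw [h.pi_p x hx, p1_pp]
theorem pi_p2 (h : IsoH H π) {x} (hx : H x) : π (p2 x) = p2 (π x) := by rw [h.pi_p x hx, p2_pp]
theorem h_op (h : IsoH H π) (i) : H (op K i) := by
  induction i with
  | zero => exact h.h1
  | succ n ih => exact h.hp h.h1 ih
theorem pi_op (h : IsoH H π) (i) : π (op K i) = op K i := by
  induction i with
  | zero => exact h.pi1
  | succ n ih => rw [op, h.pi_pp h.h1 (h.h_op n), ih, h.pi1]
theorem h_uu (h : IsoH H π) (j) {x b} (hx : H x) (hb : H b) : H (uu j x b) := by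
  have := h.hp1 hx
  have := h.hp2 hx
  fin_cases j <;> simp only [uu] <;>
    (repeat' first | assumption | apply h.hp | apply h.hp1 | apply h.hp2)
theorem pi_uu (h : IsoH H π) (j) {x b} (hx : H x) (hb : H b) : π (uu j x b) = uu j (π x) (π b) := by
  have a1 := h.hp1 hx
  have a2 := h.hp2 hx
  have a3 := h.hp1 a2
  have a4 := h.hp2 a2
  have a5 := h.hp1 a3
  have a6 := h.hp2 a3
  have a7 := h.hp1 a4
  have a8 := h.hp2 a4
  have a9 := h.hp a6 a4
  have a10 := h.hp a5 a9
  fin_cases j <;> simp only [uu, a9, a10, a5, a6, a7, a8, h.pi_pp, h.pi_p1, h.pi_p2, hx, hb, a1, a2, a3, a4, h.hp, h.hp1, h.hp2]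
theorem ee (h : IsoH H π) (γ : DD K) : H γ → ∀ x, H x → (EE x γ ↔ EE (π x) (π γ)) := by
  obtain ⟨k, l, hd⟩ := h.df
  have hπ : ∀ {Γ : Type} {V : VS Γ K} {f : Γ → DD K}, DFn V f k → DFn V (fun γ => π (f γ)) l :=
    fun hf => DFn.c1 (F := π) hd hf
  refine IWO.ind (K := K) (fun γ => H γ → ∀ x, H x → (EE x γ ↔ EE (π x) (π γ))) (k := k)
    (.imp (h.ip.df .var0) (.allX k (.imp (h.ip.df .var0) (.iff (DFn.ee .var0 .var1)
      (DFn.ee (hπ .var0) (hπ .var1)))))) ?_ γ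
  intro γ ih hγ x hx
  rw [EE_iff, EE_iff, GG, GG]
  have ha : H (ia γ) := h.hp1 (h.hp1 (h.hp2 hγ))
  have hb : H (ib γ) := h.hp2 (h.hp1 (h.hp2 hγ))
  have hc : H (ic γ) := h.hp2 (h.hp2 hγ)
  have ea : ia (π γ) = π (ia γ) := by
    unfold ia; rw [h.pi_p1 (h.hp1 (h.hp2 hγ)), h.pi_p1 (h.hp2 hγ), h.pi_p2 hγ]
  have eb : ib (π γ) = π (ib γ) := by
    unfold ib; rw [h.pi_p2 (h.hp1 (h.hp2 hγ)), h.pi_p1 (h.hp2 hγ), h.pi_p2 hγ]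
  have ec : ic (π γ) = π (ic γ) := by
    unfold ic; rw [h.pi_p2 (h.hp2 hγ), h.pi_p2 hγ]
  have eo : ∀ i, p1 (π γ) = op K i ↔ p1 γ = op K i := fun i => by
    rw [← h.pi_p1 hγ, ← h.pi_op, h.inj (h.hp1 hγ) (h.h_op i)]
    rw [h.pi_op]
  rw [ea, eb, ec]
  simp only [eo]
  rw [h.lt_iff hx hc, ← h.pi_p1 hx, ← h.pi_p2 hx, h.lt_iff (h.hp1 hx) (h.hp2 hx), h.lt_iff (h.hp2 hx) hγ]
  refine and_congr_right fun _ => or_congr (and_congr_right fun hi => ?_) (or_congr (and_congr_right fun hi => ?_)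
      (or_congr Iff.rfl (or_congr (and_congr_right fun hi => and_congr_right fun hl => ih _ hl (h.hp2 hx) _ (h.hp1 hx))
       (exists_congr fun j => and_congr_right fun hi => ?_))))
  · rw [ih _ (ia_lt hi) ha _ hx, ih _ (ib_lt hi) hb _ hx]
  · constructor
    · intro h'
      obtain ⟨s, hs, hl, he⟩ := h.sk hx ha hb h'
      refine ⟨π s, h.mono hs hb hl, ?_⟩
      rwa [← h.pi_pp hx hs, ← ih _ (ia_lt hi) ha _ (h.hp hx hs)]
    · rintro ⟨s, hl, he⟩
      obtain ⟨s, hs, rfl⟩ := h.low hb hl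
      refine ⟨s, (h.lt_iff hs hb).1 hl, ?_⟩
      rwa [ih _ (ia_lt hi) ha _ (h.hp hx hs), h.pi_pp hx hs]
  · rw [ih _ (ia_lt hi) ha _ (h.h_uu j hx hb), h.pi_uu j hx hb]
end IsoH

theorem iso_tau : IsoH (fun _ : DD K => True) tau where
  ip := IPred.mk (k := 0) (.prop _)
  df := ⟨0, 2, .tau .var0⟩
  h0 := trivial
  h1 := trivial
  hp _ _ := trivial
  hp1 _ := trivial
  hp2 _ := trivial
  mono _ _ h := tau_mono h
  low _ h := by obtain ⟨y, _, e⟩ := lt_tau.1 h; exact ⟨y, trivial, e⟩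
  sk _ _ _ h := by obtain ⟨s, h1, h2⟩ := h; exact ⟨s, trivial, h1, h2⟩
theorem tau_pp (x y : DD K) : tau (pp x y) = pp (tau x) (tau y) := iso_tau.pi_pp trivial trivial
theorem tau_p1 (x : DD K) : tau (p1 x) = p1 (tau x) := iso_tau.pi_p1 trivial
theorem tau_p2 (x : DD K) : tau (p2 x) = p2 (tau x) := iso_tau.pi_p2 trivial
theorem tau_op (i) : tau (op K i) = op K i := iso_tau.pi_op i
theorem tau_ee {x y : DD K} : EE (tau x) (tau y) ↔ EE x y := (iso_tau.ee y trivial x trivial).symm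
end
end NFUweak

open FirstOrder Language
namespace NFUweak
set_option linter.unusedSectionVars false
set_option linter.unusedVariables false

section
variable {K : Type} [LNFU.Structure K] [HasLt K] [Mdl K]

/-! ## bounded definability -/
def Bdd (f : DD K → DD K) : Prop := ∀ c, ∃ c', ∀ t < c, f t < c'
theorem Bdd.id : Bdd (fun x : DD K => x) := fun c => ⟨c, fun _ h => h⟩
theorem Bdd.cst (b : DD K) : Bdd (fun _ => b) := fun c => by
  obtain ⟨d, hd⟩ := exists_gt b
  exact ⟨d, fun _ _ => hd⟩
theorem Bdd.pp {f g : DD K → DD K} (hf : Bdd f) (hg : Bdd g) : Bdd (fun x => pp (f x) (g x)) := fun c => by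
  obtain ⟨a, ha⟩ := hf c
  obtain ⟨b, hb⟩ := hg c
  obtain ⟨d, hd⟩ := exists_gt (NFUweak.pp a b)
  exact ⟨d, fun t ht => (pp_mono (ha t ht).le (hb t ht).le).trans_lt hd⟩
theorem Bdd.p1 {f : DD K → DD K} (hf : Bdd f) : Bdd (fun x => p1 (f x)) := fun c => by
  obtain ⟨a, ha⟩ := hf c
  exact ⟨a, fun t ht => (p1_le _).trans_lt (ha t ht)⟩
theorem Bdd.p2 {f : DD K → DD K} (hf : Bdd f) : Bdd (fun x => p2 (f x)) := fun c => by
  obtain ⟨a, ha⟩ := hf c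
  exact ⟨a, fun t ht => (p2_le _).trans_lt (ha t ht)⟩
theorem Bdd.uu (j) (b : DD K) : Bdd (fun x => uu j x b) := by
  have hf := Bdd.id (K := K)
  have hg := Bdd.cst b
  fin_cases j
  · exact .pp hf hf
  · exact .pp (.p1 hf) (.pp (.p2 hf) (.p1 hf))
  · exact .pp (.p1 hf) (.pp (.p1 (.p2 hf)) (.p1 (.p2 (.p2 hf))))
  · exact .pp (.p1 hf) (.pp (.p1 (.p2 hf)) (.p2 (.p2 (.p2 hf))))
  · exact .pp (.p1 hf) (.pp (.p1 (.p1 (.p2 hf))) (.pp (.p2 (.p1 (.p2 hf))) (.p2 (.p2 hf))))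
  · exact .p2 (.p2 hf)
  · exact .pp (.p1 hf) (.pp (.p2 hf) hg)

inductive Wd : (DD K → DD K) → Prop
  | id : Wd (fun x => x)
  | cst (b) : Wd (fun _ => b)
  | p1 {f} : Wd f → Wd (fun x => p1 (f x))
  | p2 {f} : Wd f → Wd (fun x => p2 (f x))
  | pp {f g} : Wd f → Wd g → Wd (fun x => pp (f x) (g x))
theorem Wd.bdd {f : DD K → DD K} (h : Wd f) : Bdd f := by
  induction h with
  | id => exact .id
  | cst b => exact .cst b
  | p1 _ h => exact h.p1
  | p2 _ h => exact h.p2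
  | pp _ _ h h' => exact h.pp h'
theorem Wd.comp {f g : DD K → DD K} (h : Wd f) (hg : Wd g) : Wd (fun x => f (g x)) := by
  induction h with
  | id => exact hg
  | cst b => exact .cst b
  | p1 _ h => exact h.p1
  | p2 _ h => exact h.p2
  | pp _ _ h h' => exact h.pp h'

/-- coded on every bounded domain -/
def Cod (P : DD K → Prop) : Prop := ∀ c, ∃ β, ∀ t < c, EE t β ↔ P t
theorem Cod.congr {P Q : DD K → Prop} (h : Cod P) (e : ∀ t, P t ↔ Q t) : Cod Q := by
  have : P = Q := funext fun t => propext (e t)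
  exact this ▸ h

def Sub (F : DD K → DD K) : Prop := ∀ P, Cod P → Cod (fun t => P (F t))
theorem Sub.comp {F G : DD K → DD K} (hF : Sub F) (hG : Sub G) : Sub (fun x => F (G x)) :=
  fun P hP => hG _ (hF P hP)
theorem Sub.uu (j) (b : DD K) : Sub (fun x => uu j x b) := fun P hP c => by
  obtain ⟨c', h⟩ := Bdd.uu j b c
  obtain ⟨β, hβ⟩ := hP c'
  refine ⟨ix (4 + j) β b c, fun t ht => ?_⟩
  rw [EE_uu, hβ _ (h t ht)]
  simp [ht]
theorem Wd.run {f : DD K → DD K} (h : Wd f) : Sub (fun x => NFUweak.pp (NFUweak.p1 x) (NFUweak.pp (NFUweak.p2 x) (f (NFUweak.p1 x)))) := by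
  induction h with
  | id => exact Sub.uu 1 (d0 K)
  | cst b => exact Sub.uu 6 b
  | p1 _ h => have := (Sub.uu 2 (d0 K)).comp h; simpa [NFUweak.uu] using this
  | p2 _ h => have := (Sub.uu 3 (d0 K)).comp h; simpa [NFUweak.uu] using this
  | pp _ _ h h' => have := (Sub.uu 4 (d0 K)).comp (h'.comp h); simpa [NFUweak.uu] using this
theorem Wd.sub {f : DD K → DD K} (h : Wd f) : Sub f := by
  have := (Sub.uu 5 (d0 K)).comp (h.run.comp (Sub.uu 0 (d0 K)))
  simpa [NFUweak.uu] using this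

section
variable {P Q : DD K → Prop}
theorem Cod.sub (hP : Cod P) {f} (hf : Wd f) : Cod (fun t => P (f t)) := hf.sub P hP
theorem Cod.nott (hP : Cod P) : Cod (fun t => ¬ P t) := fun c => by
  obtain ⟨β, h⟩ := hP c
  refine ⟨ix 0 β β c, fun t ht => ?_⟩
  rw [EE_nand, h t ht]; simp [ht]
theorem Cod.and (hP : Cod P) (hQ : Cod Q) : Cod (fun t => P t ∧ Q t) := by
  have : Cod (fun t => ¬ (P t ∧ Q t)) := fun c => by
    obtain ⟨β, h⟩ := hP c
    obtain ⟨β', h'⟩ := hQ c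
    refine ⟨ix 0 β β' c, fun t ht => ?_⟩
    rw [EE_nand, h t ht, h' t ht]; simp [ht]
  exact this.nott.congr fun t => not_not
theorem Cod.or (hP : Cod P) (hQ : Cod Q) : Cod (fun t => P t ∨ Q t) := (hP.nott.and hQ.nott).nott.congr fun t => by tauto
theorem Cod.imp (hP : Cod P) (hQ : Cod Q) : Cod (fun t => P t → Q t) := (hP.and hQ.nott).nott.congr fun t => by tauto
theorem Cod.iff (hP : Cod P) (hQ : Cod Q) : Cod (fun t => P t ↔ Q t) := ((hP.imp hQ).and (hQ.imp hP)).congr fun t => by tauto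
end
theorem Cod.bex0 {P : DD K → Prop} (hP : Cod P) (d : DD K) : Cod (fun t => ∃ s < d, P (pp t s)) := fun c => by
  obtain ⟨c', hc⟩ := exists_gt (pp c d)
  obtain ⟨β, h⟩ := hP c'
  refine ⟨ix 1 β d c, fun t ht => ?_⟩
  rw [EE_ex]
  constructor
  · rintro ⟨_, s, hs, h'⟩
    exact ⟨s, hs, (h _ ((pp_mono ht.le hs.le).trans_lt hc)).1 h'⟩
  · rintro ⟨s, hs, h'⟩
    exact ⟨ht, s, hs, (h _ ((pp_mono ht.le hs.le).trans_lt hc)).2 h'⟩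
theorem Cod.less {f g : DD K → DD K} (hf : Wd f) (hg : Wd g) : Cod (fun t => f t < g t) := by
  have : Cod (fun x : DD K => p1 x < p2 x) := fun c => ⟨ix 2 c c c, fun t ht => by rw [EE_less]; simp [ht]⟩
  exact (this.sub (hf.pp hg)).congr fun t => by simp
theorem Cod.ee {f g : DD K → DD K} (hf : Wd f) (hg : Wd g) : Cod (fun t => EE (f t) (g t)) := by
  have : Cod (fun x : DD K => EE (p1 x) (p2 x)) := fun c => ⟨ix 3 c c c, fun t ht => by rw [EE_ee]; simp [ht]⟩
  exact (this.sub (hf.pp hg)).congr fun t => by simp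
theorem Cod.eq {f g : DD K → DD K} (hf : Wd f) (hg : Wd g) : Cod (fun t => f t = g t) :=
  ((Cod.less hf hg).or (Cod.less hg hf)).nott.congr fun t => by
    rw [not_or, not_lt, not_lt]; exact ⟨fun h => le_antisymm h.2 h.1, fun h => ⟨h.ge, h.le⟩⟩
theorem Cod.prop (P : Prop) : Cod (fun _ : DD K => P) := by
  by_cases hp : P
  · exact (Cod.eq .id .id).congr fun t => by simp [hp]
  · exact (Cod.eq .id .id).nott.congr fun t => by simp [hp]
/-- bounded quantifiers; the variables are coded by pairs -/
theorem Cod.bex {Q : DD K → DD K → Prop} (hQ : Cod (fun x => Q (p1 x) (p2 x))) {f} (hf : Wd f) :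
    Cod (fun t => ∃ s < f t, Q t s) := fun c => by
  obtain ⟨d, hd⟩ := hf.bdd c
  obtain ⟨β, h⟩ := ((Cod.less (.p2 .id) (hf.comp (.p1 .id))).and hQ).bex0 d c
  refine ⟨β, fun t ht => ?_⟩
  rw [h t ht]
  simp only [p1_pp, p2_pp]
  exact exists_congr fun s => ⟨fun h => h.2, fun h => ⟨h.1.trans (hd t ht), h⟩⟩
theorem Cod.ball {Q : DD K → DD K → Prop} (hQ : Cod (fun x => Q (p1 x) (p2 x))) {f} (hf : Wd f) :
    Cod (fun t => ∀ s < f t, Q t s) :=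
  (Cod.bex (Q := fun t s => ¬ Q t s) hQ.nott hf).nott.congr fun t => by push Not; rfl

/-! ## condensation -/
theorem lt_tOm {d : DD K} : d < tau (Om K) ↔ ∃ z, d = tau (tau z) := by
  rw [lt_tau]
  constructor
  · rintro ⟨y, hy, rfl⟩
    obtain ⟨z, rfl⟩ := lt_Om.1 hy
    exact ⟨z, rfl⟩
  · rintro ⟨z, rfl⟩
    exact ⟨_, lt_Om.2 ⟨z, rfl⟩, rfl⟩
theorem tOm_lt : tau (Om K) < Om K := lt_Om.2 ⟨_, rfl⟩

def Skl (u y : DD K) : Prop := y < p2 (p2 u) ∧ EE (pp (p1 u) y) (p1 (p2 u)) ∧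
  ∀ s < y, ¬ EE (pp (p1 u) s) (p1 (p2 u))
theorem Skl.uniq {u y y' : DD K} (h : Skl u y) (h' : Skl u y') : y = y' := by
  rcases lt_trichotomy y y' with e | e | e
  · exact absurd h.2.1 (h'.2.2 _ e)
  · exact e
  · exact absurd h'.2.1 (h.2.2 _ e)
def NG (β : DD K) (R : DD K → DD K → Prop) (b y : DD K) : Prop :=
  (p1 b = op K 0 ∧ y = p2 b) ∨ (p1 b = op K 1 ∧ y = β) ∨
  (p1 b = op K 2 ∧ ∃ u v, R u (p1 (p2 b)) ∧ R v (p2 (p2 b)) ∧ y = pp u v) ∨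
  (p1 b = op K 3 ∧ ∃ u, R u (p2 b) ∧ y = p1 u) ∨ (p1 b = op K 4 ∧ ∃ u, R u (p2 b) ∧ y = p2 u) ∨
  (p1 b = op K 5 ∧ ∃ u, R u (p2 b) ∧ Skl u y)
theorem NG_ex (β : DD K) : ∃ E : DD K → DD K → Prop, IRel K E ∧ ∀ b y, E y b ↔ NG β E b y := by
  refine rec_ex (NG β) ?_ ?_
  · unfold NG Skl
    refine .or dd8 (.or dd8 (.or dd8 (.or dd8 (.or dd8 dd8))))
  · intro R R' b h y
    unfold NG
    have e : ∀ {i}, p1 b = op K i → ∀ y, (R y (p2 b) ↔ R' y (p2 b)) ∧ (R y (p1 (p2 b)) ↔ R' y (p1 (p2 b))) ∧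
      (R y (p2 (p2 b)) ↔ R' y (p2 (p2 b))) :=
      fun hi y => have := p2_lt (hi ▸ op_pos _)
        ⟨h _ this y, h _ ((p1_le _).trans_lt this) y, h _ ((p2_le _).trans_lt this) y⟩
    refine or_congr Iff.rfl (or_congr Iff.rfl (or_congr (and_congr_right fun hi => ?_) (or_congr (and_congr_right fun hi => ?_)
     (or_congr (and_congr_right fun hi => ?_) (and_congr_right fun hi => ?_)))))
    · simp only [(e hi _).2.1, (e hi _).2.2]
    all_goals simp only [(e hi _).1]
def NN (β y b : DD K) : Prop := (NG_ex β).choose y b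
theorem NN_irel (β : DD K) : IRel K (NN β) := (NG_ex β).choose_spec.1
theorem NN_iff (β y b : DD K) : NN β y b ↔ NG β (NN β) b y := (NG_ex β).choose_spec.2 b y
theorem NN_uniq (β b : DD K) : ∀ y y', NN β y b → NN β y' b → y = y' := by
  have hN : ∀ {Γ : Type} {V : VS Γ K} {f g : Γ → DD K} {i}, DFn V f i → DFn V g i → Def V (fun γ => NN β (f γ) (g γ)) :=
    fun h h' => (NN_irel β).df h h'
  refine IWO.ind (K := K) (fun b => ∀ y y', NN β y b → NN β y' b → y = y') (k := 0) ?_ ?_ b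
  · exact dd8
  intro b ih y y' h h'
  rw [NN_iff] at h h'
  have hl : ∀ {i}, p1 b = op K i → p2 b < b := fun hi => p2_lt (hi ▸ op_pos _)
  rcases h with ⟨e, h⟩ | ⟨e, h⟩ | ⟨e, u, v, h1, h2, h⟩ | ⟨e, u, h1, h⟩ | ⟨e, u, h1, h⟩ | ⟨e, u, h1, h⟩ <;>
  rcases h' with ⟨e', h'⟩ | ⟨e', h'⟩ | ⟨e', u', v', h1', h2', h'⟩ | ⟨e', u', h1', h'⟩ | ⟨e', u', h1', h'⟩ | ⟨e', u', h1', h'⟩ <;>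
  first
  | exact absurd (op_inj.1 (e.symm.trans e')) (by decide)
  | exact h.trans h'.symm
  | rw [h, h', ih _ ((p1_le _).trans_lt (hl e)) _ _ h1 h1', ih _ ((p2_le _).trans_lt (hl e)) _ _ h2 h2']
  | rw [h, h', ih _ (hl e) _ _ h1 h1']
  | (rw [ih _ (hl e) _ _ h1 h1'] at h; exact h.uniq h')

section
variable (β : DD K)
def HH (y : DD K) : Prop := ∃ b < tau (Om K), NN β y b
theorem tOm_pp {x y : DD K} (hx : x < tau (Om K)) (hy : y < tau (Om K)) : pp x y < tau (Om K) := by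
  obtain ⟨a, rfl⟩ := lt_tOm.1 hx
  obtain ⟨b, rfl⟩ := lt_tOm.1 hy
  exact lt_tOm.2 ⟨pp a b, by rw [tau_pp, tau_pp]⟩
theorem tOm_op (i) : op K i < tau (Om K) := lt_tOm.2 ⟨op K i, by rw [tau_op, tau_op]⟩
theorem HH.lt {y : DD K} (h : y < tau (Om K)) : HH β y :=
  ⟨pp (op K 0) y, tOm_pp (tOm_op 0) h, (NN_iff _ _ _).2 (.inl (by simp))⟩
theorem HH.self : HH β β :=
  ⟨pp (op K 1) (op K 0), tOm_pp (tOm_op 1) (tOm_op 0), (NN_iff _ _ _).2 (.inr (.inl (by simp)))⟩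
variable {β}
theorem HH.pp {x y : DD K} (hx : HH β x) (hy : HH β y) : HH β (pp x y) := by
  obtain ⟨a, ha, h⟩ := hx
  obtain ⟨b, hb, h'⟩ := hy
  exact ⟨NFUweak.pp (op K 2) (NFUweak.pp a b), tOm_pp (tOm_op 2) (tOm_pp ha hb), (NN_iff _ _ _).2
    (.inr (.inr (.inl ⟨by simp, x, y, by simpa using h, by simpa using h', rfl⟩)))⟩
theorem HH.p1 {x : DD K} (hx : HH β x) : HH β (p1 x) := by
  obtain ⟨a, ha, h⟩ := hx
  exact ⟨NFUweak.pp (op K 3) a, tOm_pp (tOm_op _) ha, (NN_iff _ _ _).2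
    (.inr (.inr (.inr (.inl ⟨by simp, x, by simpa using h, rfl⟩))))⟩
theorem HH.p2 {x : DD K} (hx : HH β x) : HH β (p2 x) := by
  obtain ⟨a, ha, h⟩ := hx
  exact ⟨NFUweak.pp (op K 4) a, tOm_pp (tOm_op _) ha, (NN_iff _ _ _).2
    (.inr (.inr (.inr (.inr (.inl ⟨by simp, x, by simpa using h, rfl⟩)))))⟩
theorem HH.sk {t a d : DD K} (ht : HH β t) (ha : HH β a) (hd : HH β d) (h : ∃ s < d, EE (NFUweak.pp t s) a) :
    ∃ s, HH β s ∧ s < d ∧ EE (NFUweak.pp t s) a := by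
  obtain ⟨s, ⟨h1, h2⟩, h3⟩ := IWO.least (K := K) (fun s => s < d ∧ EE (NFUweak.pp t s) a) (k := 0) dd8 h
  obtain ⟨b, hb, h⟩ := ht.pp (ha.pp hd)
  refine ⟨s, ⟨NFUweak.pp (op K 5) b, tOm_pp (tOm_op _) hb, (NN_iff _ _ _).2
    (.inr (.inr (.inr (.inr (.inr ⟨by simp, _, by simpa using h, ?_⟩)))))⟩, h1, h2⟩
  simp only [Skl, p1_pp, p2_pp]
  exact ⟨h1, h2, fun s' hs h' => h3 s' hs ⟨hs.trans h1, h'⟩⟩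
theorem HH.iff {y : DD K} : HH β y ↔ ∃ a, NN β y (tau (tau a)) := by
  constructor
  · rintro ⟨b, hb, h⟩
    obtain ⟨a, rfl⟩ := lt_tOm.1 hb
    exact ⟨a, h⟩
  · rintro ⟨a, h⟩
    exact ⟨_, lt_tOm.2 ⟨a, rfl⟩, h⟩
theorem NN_df {Γ : Type} {V : VS Γ K} {f g : Γ → DD K} {i} (h : DFn V f i) (h' : DFn V g i) : Def V (fun γ => NN β (f γ) (g γ)) :=
  (NN_irel β).df h h'
theorem HH.ip : IPred K (HH β) := by
  refine IPred.mk (k := 0) (.exX 0 (.and ?_ (NN_df .var1 .var0)))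
  exact DFn.lt .var0 (.cst _)

variable (β) in
def isNm (a : DD K) : Prop := (∃ y, NN β y (tau (tau a))) ∧ ∀ a' < a, ∀ y, NN β y (tau (tau a)) → ¬ NN β y (tau (tau a'))
theorem isNm_ip : IPred K (isNm β) := by
  refine IPred.mk (k := 0) ?_
  refine .and (.exX 4 (NN_df .var0 (.tau (.tau .var1)))) (.allX 0 (.imp (DFn.lt .var0 .var1) (.allX 4 (.imp
    (NN_df .var0 (.tau (.tau .var2))) (.nott (NN_df .var0 (.tau (.tau .var1))))))))
variable (β) in
structure NX where
  a : DD K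
  h : isNm β a
noncomputable instance : ISet K (NX β) where
  val x := vl x.a
  inj := by
    rintro ⟨x, _⟩ ⟨y, _⟩ h
    obtain rfl : x = y := vl_inj (K := K) h
    rfl
  code := by
    obtain ⟨A, hs, h⟩ := isNm_ip (β := β)
    refine ⟨A, hs, fun z => ?_⟩
    rw [h]
    exact ⟨fun ⟨x, h1, h2⟩ => ⟨⟨x, h1⟩, h2⟩, fun ⟨x, h2⟩ => ⟨x.a, x.h, h2⟩⟩
theorem DFn.nxa {Γ : Type} {V : VS Γ K} {f : Γ → NX β} {i} (hf : DFn V f i) : DFn V (fun γ => (f γ).a) i := hf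
noncomputable def NX.v (x : NX β) : DD K := x.h.1.choose
theorem NX.v_iff (x : NX β) (y : DD K) : NN β y (tau (tau x.a)) ↔ y = x.v :=
  ⟨fun h => NN_uniq _ _ _ _ h x.h.1.choose_spec, fun h => h ▸ x.h.1.choose_spec⟩
theorem NX.v_inj : Function.Injective (NX.v (β := β)) := fun x y h => by
  have h1 := (x.v_iff _).2 rfl
  have h2 := (y.v_iff _).2 rfl
  obtain ⟨x, hx⟩ := x
  obtain ⟨y, hy⟩ := y
  rcases lt_trichotomy x y with e | e | e
  · exact absurd (h ▸ h1) (hy.2 x e _ h2)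
  · subst e; rfl
  · exact absurd (h ▸ h2) (hx.2 y e _ h1)
theorem DFn.nxv {Γ : Type} {V : VS Γ K} {f : Γ → NX β} {i} (hf : DFn V f i) : DFn V (fun γ => (f γ).v) (i+4) :=
  .of_graph (fun γ y => NN β y (NFUweak.tau (NFUweak.tau (f γ).a))) (fun γ y => (f γ).v_iff y) (NN_df .var0 (.tau (.tau (.nxa (.wk hf)))))
theorem NX.v_ex {y : DD K} : HH β y ↔ ∃ x : NX β, x.v = y := by
  rw [HH.iff]
  constructor
  · intro h
    obtain ⟨a, h1, h2⟩ := IWO.least (K := K) (fun a => NN β y (tau (tau a))) (k := 0) (NN_df (.cst _) (.tau (.tau .var0))) h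
    have : isNm β a := ⟨⟨y, h1⟩, fun a' ha y' h3 h4 => h2 a' ha (NN_uniq _ _ _ _ h1 h3 ▸ h4)⟩
    exact ⟨⟨a, this⟩, ((NX.v_iff ⟨a, this⟩ y).1 h1).symm⟩
  · rintro ⟨x, rfl⟩
    exact ⟨x.a, (x.v_iff _).2 rfl⟩
noncomputable instance : LinearOrder (NX β) := LinearOrder.lift' NX.v NX.v_inj
theorem NX.le_iff {x y : NX β} : x ≤ y ↔ x.v ≤ y.v := Iff.rfl
theorem NX.lt_iff {x y : NX β} : x < y ↔ x.v < y.v := Iff.rfl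
instance : IWO K (NX β) where
  irel := IRel.mk (Q := fun x y : NX β => x.v ≤ y.v) (k := 0) (DFn.le (.nxv .var1) (.nxv .var0))
  wf P hP h := by
    obtain ⟨x, hx⟩ := h
    obtain ⟨y, ⟨x, h1, rfl⟩, h2⟩ := IWO.wf (K := K) (fun y => ∃ x, P x ∧ NX.v x = y)
      (IPred.mk (k := 4) (.exX 0 (.and (hP.df .var0) (DFn.eq (.nxv .var0) .var1)))) ⟨_, x, hx, rfl⟩
    exact ⟨x, h1, fun y hy => h2 _ ⟨y, hy, rfl⟩⟩
open Classical in
variable (β) in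
noncomputable def ppi (y : DD K) : DD K := if h : ∃ x : NX β, x.v = y then tau (rk K h.choose) else d0 K
theorem ppi_v (x : NX β) : ppi β x.v = tau (rk K x) := by
  have h : ∃ x' : NX β, x'.v = x.v := ⟨x, rfl⟩
  rw [ppi, dif_pos h, NX.v_inj h.choose_spec]
theorem ppi_df : DFn (C1 K (DD K) 4) (fun p => ppi β p.2) 4 := by
  refine .of_graph (fun γ z => (∃ x : NX β, x.v = γ.2 ∧ z = tau (rk K x)) ∨ (¬(∃ x : NX β, x.v = γ.2) ∧ z = d0 K)) (fun γ z => ?_) ?_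
  · by_cases h : ∃ x : NX β, x.v = γ.2
    · obtain ⟨x, hx⟩ := h
      rw [← hx, ppi_v]
      constructor
      · rintro (⟨x', h1, h2⟩ | ⟨h1, _⟩)
        · rw [h2, NX.v_inj h1]
        · exact absurd ⟨x, rfl⟩ h1
      · rintro rfl
        exact .inl ⟨x, rfl, rfl⟩
    · rw [ppi, dif_neg h]
      constructor
      · rintro (⟨x', h1, h2⟩ | ⟨h1, h2⟩)
        · exact absurd ⟨x', h1⟩ h
        · exact h2
      · exact fun h2 => .inr ⟨h, h2⟩
  · exact .or (.exX 0 (.and (DFn.eq (.nxv .var0) .var2) (DFn.eq .var1 (.tau (.rk .var0)))))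
      (.and (.nott (.exX 0 (DFn.eq (.nxv .var0) .var2))) (DFn.eq .var0 (.cst _)))
theorem d0_lt_tOm : d0 K < tau (Om K) := (op_pos 0).trans (tOm_op 0)
theorem iso_ppi : IsoH (HH β) (ppi β) where
  ip := HH.ip
  df := ⟨4, 4, ppi_df⟩
  h0 := HH.lt _ d0_lt_tOm
  h1 := HH.lt _ (tOm_op 0)
  hp := HH.pp
  hp1 := HH.p1
  hp2 := HH.p2
  sk := HH.sk
  mono hx hy h := by
    obtain ⟨x, rfl⟩ := NX.v_ex.1 hx
    obtain ⟨y, rfl⟩ := NX.v_ex.1 hy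
    rw [ppi_v, ppi_v]
    exact tau_mono (rk_mono (NX.lt_iff.2 h))
  low hx h := by
    obtain ⟨x, rfl⟩ := NX.v_ex.1 hx
    rw [ppi_v] at h
    obtain ⟨y, hy, rfl⟩ := lt_tau.1 h
    obtain ⟨z, hz, rfl⟩ := lt_rk.1 hy
    exact ⟨z.v, NX.v_ex.2 ⟨z, rfl⟩, (ppi_v z).symm⟩
theorem ppi_id (y : DD K) : y < tau (Om K) → ppi β y = y := by
  have hπ : ∀ {Γ : Type} {V : VS Γ K} {f : Γ → DD K}, DFn V f 4 → DFn V (fun γ => ppi β (f γ)) 4 :=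
    fun hf => DFn.c1 (F := ppi β) ppi_df hf
  refine IWO.ind (K := K) (fun y => y < tau (Om K) → ppi β y = y) (k := 4)
    (.imp (DFn.lt .var0 (.cst _)) (DFn.eq (hπ .var0) .var0)) ?_ y
  intro y ih hy
  rcases lt_trichotomy (ppi β y) y with h | h | h
  · have := ih _ h (h.trans hy)
    exact (iso_ppi.inj (HH.lt _ (h.trans hy)) (HH.lt _ hy)).1 this
  · exact h
  · obtain ⟨z, hz, e⟩ := iso_ppi.low (HH.lt _ hy) h
    have h1 : z < y := (iso_ppi.lt_iff hz (HH.lt _ hy)).1 (e ▸ h)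
    rw [ih z h1 (h1.trans hy)] at e
    exact absurd h1 (by rw [e]; exact lt_irrefl _)
end
theorem cond (β : DD K) (h : ∀ x, EE x β → x < tau (Om K)) : ∃ β1, ∀ x, EE x (tau β1) ↔ EE x β := by
  obtain ⟨b, hb⟩ := NX.v_ex.1 (HH.self β)
  refine ⟨rk K b, fun x => ?_⟩
  rw [← ppi_v, hb]
  by_cases hx : x < tau (Om K)
  · conv_lhs => rw [← ppi_id (β := β) x hx]
    exact (iso_ppi.ee β (HH.self β) x (HH.lt _ hx)).symm
  · refine iff_of_false (fun h' => hx ?_) fun h' => hx (h x h')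
    obtain ⟨y, hy, rfl⟩ := iso_ppi.low (HH.self β) (EE_lt h')
    have := h _ ((iso_ppi.ee β (HH.self β) y hy).2 h')
    rwa [ppi_id y this]

/-- iterated T -/
noncomputable def tn : ℕ → DD K → DD K
  | 0, x => x
  | n+1, x => tau (tn n x)
theorem tn_add (m n) (x : DD K) : tn m (tn n x) = tn (m+n) x := by
  induction m with
  | zero => rw [tn, Nat.zero_add]
  | succ m ih => rw [tn, ih, Nat.succ_add]; rfl
theorem tn_mono (n) : StrictMono (tn n : DD K → DD K) := by
  induction n with
  | zero => exact strictMono_id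
  | succ n ih => exact tau_mono.comp ih
theorem tn_pp (n) (x y : DD K) : tn n (pp x y) = pp (tn n x) (tn n y) := by
  induction n with
  | zero => rfl
  | succ n ih => rw [tn, ih, tau_pp]; rfl
theorem tn_ee {n} {x y : DD K} : EE (tn n x) (tn n y) ↔ EE x y := by
  induction n with
  | zero => rfl
  | succ n ih => rw [tn, tn, tau_ee, ih]
theorem lt_tnOm {n} {d : DD K} : d < tn n (Om K) ↔ ∃ x, d = tn (n+1) x := by
  induction n generalizing d with
  | zero => exact lt_Om
  | succ n ih =>
    rw [tn, lt_tau]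
    constructor
    · rintro ⟨y, hy, rfl⟩
      obtain ⟨x, rfl⟩ := ih.1 hy
      exact ⟨x, rfl⟩
    · rintro ⟨x, rfl⟩
      exact ⟨_, ih.2 ⟨x, rfl⟩, rfl⟩
theorem tnOm_le (n) : tn (n+1) (Om K) ≤ tau (Om K) := by
  induction n with
  | zero => exact le_rfl
  | succ n ih => exact (tau_mono.monotone ih).trans (tau_mono.monotone tOm_lt.le)
theorem cond_n (m : ℕ) : ∀ β : DD K, (∀ x, EE x β → x < tn m (Om K)) →
    ∃ β0, (∀ x, EE x β0 → x < Om K) ∧ ∀ x, EE (tau x) β0 ↔ EE (tn (m+1) x) β := by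
  induction m with
  | zero => exact fun β h => ⟨β, h, fun x => Iff.rfl⟩
  | succ m ih =>
    intro β h
    obtain ⟨β1, h1⟩ := cond β fun x hx => (h x hx).trans_le (tnOm_le m)
    have h2 : ∀ x, EE x β1 ↔ EE (tau x) β := fun x => by rw [← h1, tau_ee]
    obtain ⟨β0, h3, h4⟩ := ih β1 fun x hx => by
      have := h _ ((h2 x).1 hx)
      rwa [tn, tau_mono.lt_iff_lt] at this
    exact ⟨β0, h3, fun x => by rw [h4, h2]; rfl⟩
end
end NFUweak

open FirstOrder Language
namespace NFUweak
set_option linter.unusedSectionVars false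
set_option linter.unusedVariables false

section
variable {K : Type} [LNFU.Structure K] [HasLt K] [Mdl K]

/-! ## the inner model -/
def SetM (c x : DD K) : Prop := (∀ y < x, EE y x → y < c) ∧ ∀ x' < x, ∃ y < x, ¬ (EE y x ↔ EE y x')
theorem lt_tn {n} {d x : DD K} : d < tn n x ↔ ∃ y < x, d = tn n y := by
  induction n generalizing d with
  | zero => exact ⟨fun h => ⟨d, h, rfl⟩, fun ⟨y, h, e⟩ => e ▸ h⟩
  | succ n ih =>
    rw [tn, lt_tau]
    constructor
    · rintro ⟨y, hy, rfl⟩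
      obtain ⟨x, h, rfl⟩ := ih.1 hy
      exact ⟨x, h, rfl⟩
    · rintro ⟨x, h, rfl⟩
      exact ⟨_, ih.2 ⟨x, h, rfl⟩, rfl⟩
theorem SetM_tn {n} {c x : DD K} : SetM (tn n c) (tn n x) ↔ SetM c x := by
  have hl : ∀ {P : DD K → Prop} {x}, (∀ y < tn n x, P y) ↔ ∀ y < x, P (tn n y) := fun {P x} =>
    ⟨fun h y hy => h _ (tn_mono n hy), fun h y hy => by obtain ⟨z, hz, rfl⟩ := lt_tn.1 hy; exact h z hz⟩
  have hx : ∀ {P : DD K → Prop} {x}, (∃ y < tn n x, P y) ↔ ∃ y < x, P (tn n y) := fun {P x} =>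
    ⟨fun ⟨y, hy, h⟩ => by obtain ⟨z, hz, rfl⟩ := lt_tn.1 hy; exact ⟨z, hz, h⟩, fun ⟨y, hy, h⟩ => ⟨_, tn_mono n hy, h⟩⟩
  unfold SetM
  simp only [hl, hx, tn_ee, (tn_mono n).lt_iff_lt]
theorem Cod.setM (c : DD K) {f} (hf : Wd f) : Cod (fun t => SetM c (f t)) := by
  refine Cod.sub (P := SetM c) ?_ hf
  refine (Cod.ball (Q := fun t s => EE s t → s < c) ((Cod.ee (.p2 .id) (.p1 .id)).imp (.less (.p2 .id) (.cst c))) .id).and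
    (Cod.ball (Q := fun t x' => ∃ y < t, ¬ (EE y t ↔ EE y x')) ?_ .id)
  refine Cod.bex (Q := fun u y => ¬ (EE y (NFUweak.p1 u) ↔ EE y (NFUweak.p2 u))) ?_ (.p1 .id)
  exact ((Cod.ee (.p2 .id) (.p1 (.p1 .id))).iff (.ee (.p2 .id) (.p2 (.p1 .id)))).nott

noncomputable instance : LNFU.Structure (DD K) where
  funMap {n} f := match n, f with
    | _, NFUFunc.pair => fun v => pp (v 0) (v 1)
  RelMap {n} r := match n, r with
    | _, NFURel.mem => fun v => SetM (Om K) (v 1) ∧ EE (tau (v 0)) (v 1)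
    | _, NFURel.isSet => fun v => SetM (Om K) (v 0)
noncomputable instance : HasLt (DD K) := ⟨fun x y => x < y⟩
theorem smem_iff {x y : DD K} : smem x y ↔ SetM (Om K) y ∧ EE (tau x) y := Iff.rfl
theorem sset_iff {x : DD K} : sset x ↔ SetM (Om K) x := Iff.rfl
theorem spair_eq {x y : DD K} : spair x y = pp x y := rfl
theorem ltx_iff {x y : DD K} : HasLt.ltx x y ↔ x < y := Iff.rfl

section
variable {Γ : Type} 
def Wds (V : VS Γ (DD K)) (n : ℕ) (e : Γ → DD K) : Prop := ∀ f i, V f i → ∃ w, Wd w ∧ ∀ γ, w (e γ) = tn (n - i) (f γ)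
theorem Tm.word {V : VS Γ (DD K)} {f i} (h : Tm V f i) (n) (e : Γ → DD K) (he : Wds V n e) :
    ∃ w, Wd w ∧ ∀ γ, w (e γ) = tn (n - i) (f γ) := by
  induction h with
  | var h => exact he _ _ h
  | cst c i => exact ⟨_, .cst (tn (n - i) c), fun _ => rfl⟩
  | pair _ _ h1 h2 =>
    obtain ⟨w, hw, h1⟩ := h1
    obtain ⟨w', hw', h2⟩ := h2
    exact ⟨_, hw.pp hw', fun γ => by rw [h1, h2, ← tn_pp]; rfl⟩
end
theorem Def.cod {Γ : Type} {V : VS Γ (DD K)} {P : Γ → Prop} (h : Def V P) : ∃ n0, ∀ n ≥ n0, ∀ e : Γ → DD K, Wds V n e →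
    ∃ Q : DD K → Prop, Cod Q ∧ ∀ γ, Q (e γ) ↔ P γ := by
  induction h with
  | fal => exact ⟨0, fun n _ e he => ⟨_, .prop False, fun _ => Iff.rfl⟩⟩
  | @eq Γ V f g i h1 h2 =>
    refine ⟨i, fun n hn e he => ?_⟩
    obtain ⟨w, hw, h1⟩ := h1.word n e he
    obtain ⟨w', hw', h2⟩ := h2.word n e he
    exact ⟨_, .eq hw hw', fun γ => by rw [h1, h2, (tn_mono _).injective.eq_iff]⟩
  | @mem Γ V f g i h1 h2 =>
    refine ⟨i+1, fun n hn e he => ?_⟩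
    obtain ⟨w, hw, h1⟩ := h1.word n e he
    obtain ⟨w', hw', h2⟩ := h2.word n e he
    refine ⟨_, (Cod.setM (tn (n - (i+1)) (Om K)) hw').and (.ee hw hw'), fun γ => ?_⟩
    have e : n - i = (n - (i+1)) + 1 := by omega
    have : tn (n - i) (f γ) = tn (n - (i+1)) (tau (f γ)) := by
      rw [e, ← tn_add]; rfl
    rw [h1, h2, SetM_tn, this, tn_ee]; rfl
  | @set Γ V f i h1 =>
    refine ⟨i, fun n hn e he => ?_⟩
    obtain ⟨w, hw, h1⟩ := h1.word n e he
    exact ⟨_, Cod.setM (tn (n - i) (Om K)) hw, fun γ => by rw [h1, SetM_tn]; rfl⟩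
  | @lt Γ V f g i h1 h2 =>
    refine ⟨i, fun n hn e he => ?_⟩
    obtain ⟨w, hw, h1⟩ := h1.word n e he
    obtain ⟨w', hw', h2⟩ := h2.word n e he
    exact ⟨_, .less hw hw', fun γ => by rw [h1, h2, (tn_mono _).lt_iff_lt]; rfl⟩
  | imp _ _ h1 h2 =>
    obtain ⟨n1, h1⟩ := h1
    obtain ⟨n2, h2⟩ := h2
    refine ⟨max n1 n2, fun n hn e he => ?_⟩
    obtain ⟨Q, hQ, h1⟩ := h1 n ((le_max_left _ _).trans hn) e he
    obtain ⟨Q', hQ', h2⟩ := h2 n ((le_max_right _ _).trans hn) e he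
    exact ⟨_, hQ.imp hQ', fun γ => by rw [h1, h2]⟩
  | @all Γ V k R _ ih =>
    obtain ⟨n1, ih⟩ := ih
    refine ⟨max n1 (k+1), fun n hn e he => ?_⟩
    have hk : k + 1 ≤ n := (le_max_right _ _).trans hn
    obtain ⟨Q, hQ, h⟩ := ih n ((le_max_left _ _).trans hn) (fun p => pp (e p.1) (tn (n - k) p.2)) (by
      rintro f i (⟨g, hg, rfl⟩ | ⟨rfl, rfl⟩)
      · obtain ⟨w, hw, h⟩ := he _ _ hg
        exact ⟨_, hw.comp (.p1 .id), fun p => by simp [h]⟩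
      · exact ⟨_, .p2 .id, fun p => by simp⟩)
    refine ⟨_, Cod.ball (Q := fun t s => Q (pp t s)) (hQ.congr fun x => by simp) (.cst (tn (n - (k+1)) (Om K))), fun γ => ?_⟩
    have e : n - k = (n - (k+1)) + 1 := by omega
    constructor
    · intro h' x
      exact (h (γ, x)).1 (h' _ (lt_tnOm.2 ⟨x, by rw [e]⟩))
    · intro h' s hs
      obtain ⟨x, rfl⟩ := lt_tnOm.1 hs
      rw [← e]
      exact (h (γ, x)).2 (h' x)

instance : Mdl (DD K) where
  ne := inferInstance
  comp k P h := by
    obtain ⟨n0, h⟩ := h.cod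
    obtain ⟨Q, hQ, h⟩ := h (max n0 (k+1)) (le_max_left _ _) (fun p => tn (max n0 (k+1) - k) p.2) (by
      rintro f i (⟨g, hg, rfl⟩ | ⟨rfl, rfl⟩)
      · exact hg.elim
      · exact ⟨_, .id, fun _ => rfl⟩)
    generalize hm : max n0 (k+1) - (k+1) = m
    have e : max n0 (k+1) - k = m + 1 := by omega
    rw [e] at h
    obtain ⟨β', hβ⟩ := hQ.nott (tn m (Om K))
    obtain ⟨β0, h1, h2⟩ := cond_n m (ix 0 β' β' (tn m (Om K))) (fun x hx => (EE_nand.1 hx).1)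
    have h3 : ∀ x, EE (tau x) β0 ↔ P x := fun x => by
      have hl : tn (m+1) x < tn m (Om K) := lt_tnOm.2 ⟨x, rfl⟩
      rw [h2, EE_nand, hβ _ hl, ← h ((), x)]
      simp [hl]
    obtain ⟨y, h4, h5⟩ := IWO.least (K := K) (fun y => ∀ z, EE z y ↔ EE z β0) (k := 0) dd8 ⟨β0, fun _ => Iff.rfl⟩
    have hs : SetM (Om K) y := by
      refine ⟨fun z _ hz => h1 z ((h4 z).1 hz), fun x' hx => ?_⟩
      by_contra hc
      push Not at hc
      refine h5 x' hx fun z => ?_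
      rw [← h4]
      by_cases hz : z < y
      · exact (hc z hz).symm
      · exact iff_of_false (fun h => hz ((EE_lt h).trans hx)) fun h => hz (EE_lt h)
    exact ⟨y, hs, fun x => by rw [smem_iff, h4, h3]; simp [hs]⟩
  ext := by
    have key : ∀ x y : DD K, sset x → sset y → (∀ z, smem z x ↔ smem z y) → ¬ x < y := by
      intro x y hx hy h hl
      obtain ⟨z, hz, hn⟩ := hy.2 x hl
      refine hn ⟨fun h' => ?_, fun h' => ?_⟩
      · obtain ⟨z, rfl⟩ := lt_Om.1 (hy.1 z hz h')
        exact ((h z).2 ⟨hy, h'⟩).2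
      · obtain ⟨z, rfl⟩ := lt_Om.1 (hx.1 z (EE_lt h') h')
        exact ((h z).1 ⟨hx, h'⟩).2
    intro x y hx hy h
    exact le_antisymm (not_lt.1 (key y x hy hx fun z => (h z).symm)) (not_lt.1 (key x y hx hy h))
  pinj x y w z h := by
    rw [spair_eq, spair_eq] at h
    exact pp_inj h

theorem ac_DD : acHolds (DD K) := by
  intro X hX hne hdj
  obtain ⟨t, ht, h⟩ := compX (K := DD K) (k := 0) (fun z => ∃ y, smem y X ∧ smem z y ∧ ∀ z', smem z' y → ¬ HasLt.ltx z' z)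
    (.exX 1 (.and (DFn.smem .var0 (.cst X)) (.and (DFn.smem .var1 .var0)
      (.allX 0 (.imp (DFn.smem .var0 .var1) (.nott (DFn.ltx .var0 .var2)))))))
  refine ⟨t, ht, fun y hy => ?_⟩
  obtain ⟨z, h1, h2⟩ := IWO.least (K := K) (fun z : DD K => smem z y) (k := 0)
    (Def.and (.prop (SetM (Om K) y)) (DFn.ee (.tau .var0) (.cst y))) (hne y hy).2
  refine ⟨z, ⟨h1, (h z).2 ⟨y, hy, h1, fun z' hz' hl => h2 z' hl hz'⟩⟩, ?_⟩
  rintro z' ⟨hz, hz'⟩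
  obtain ⟨y', hy', h3, h4⟩ := (h z').1 hz'
  obtain rfl : y = y' := by
    by_contra hn
    exact hdj y y' hy hy' hn z' ⟨hz, h3⟩
  exact le_antisymm (not_lt.1 (h4 z h1)) (not_lt.1 fun hl => h2 z' hl h3)
end
end NFUweak

open FirstOrder Language
namespace NFUweak
set_option linter.unusedSectionVars false
set_option linter.unusedVariables false

section
variable {K : Type} [LNFU.Structure K] [HasLt K] [Mdl K]

/-! ## internal natural numbers -/
theorem zero_ex : ∃ z : K, isZeroCard z := compX (k := 1) (fun y => ∀ w, ¬ smem w y) dd2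
theorem succ_ex (x : K) : ∃ s, isSuccOf s x :=
  compX (k := 1) (fun y => ∃ z, smem z y ∧ ∃ d, sset d ∧ (∀ w, smem w d ↔ (smem w y ∧ w ≠ z)) ∧ smem d x) dd2
theorem zero_uniq {x y : K} (hx : isZeroCard x) (hy : isZeroCard y) : x = y :=
  Mdl.ext _ _ hx.1 hy.1 fun z => by rw [hx.2, hy.2]
theorem succ_uniq {x y n : K} (hx : isSuccOf x n) (hy : isSuccOf y n) : x = y :=
  Mdl.ext _ _ hx.1 hy.1 fun z => by rw [hx.2, hy.2]
theorem isNat.zero {z : K} (h : isZeroCard z) : isNat z := fun I hI => hI.2.1 z h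
theorem isNat.succ {n s : K} (h : isNat n) (hs : isSuccOf s n) : isNat s := fun I hI => hI.2.2 n s (h I hI) hs

section
variable {Γ : Type} {V : VS Γ K} {f g h : Γ → K} {i : ℕ}
theorem DFn.isZero (hf : DFn V f (i+2)) : Def V (fun γ => isZeroCard (f γ)) := by
  refine Def.c1 (P := fun x : K => isZeroCard x) ?_ hf
  unfold isZeroCard; exact dd2
theorem DFn.isSucc (hf : DFn V f (i+2)) (hg : DFn V g (i+2)) : Def V (fun γ => isSuccOf (f γ) (g γ)) := by
  refine Def.c2 (P := fun x y : K => isSuccOf x y) ?_ hf hg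
  unfold isSuccOf; exact dd2
theorem DFn.isInd (hf : DFn V f (i+3)) : Def V (fun γ => isInductiveSet (f γ)) := by
  refine Def.c1 (P := fun x : K => isInductiveSet x) ?_ hf
  unfold isInductiveSet
  exact .and dd2 (.and (.allX (i+2) (.imp (DFn.isZero .var0) dd2)) (.allX (i+2) (.allX (i+2) (.imp dd2 (.imp (DFn.isSucc .var0 .var1) dd2)))))
theorem DFn.isNat (hf : DFn V f (i+2)) : Def V (fun γ => isNat (f γ)) := by
  refine Def.c1 (P := fun x : K => NFUweak.isNat x) ?_ hf
  unfold NFUweak.isNat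
  exact .allX (i+3) (.imp (DFn.isInd .var0) dd2)
theorem DFn.cardAdd (hf : DFn V f (i+2)) (hg : DFn V g (i+2)) (hh : DFn V h (i+2)) :
    Def V (fun γ => cardAdd (f γ) (g γ) (h γ)) := by
  refine Def.c3 (P := fun x y z : K => NFUweak.cardAdd x y z) ?_ hf hg hh
  unfold NFUweak.cardAdd; exact dd2
theorem DFn.cardMul (hf : DFn V f (i+2)) (hg : DFn V g (i+2)) (hh : DFn V h (i+2)) :
    Def V (fun γ => cardMul (f γ) (g γ) (h γ)) := by
  refine Def.c3 (P := fun x y z : K => NFUweak.cardMul x y z) ?_ hf hg hh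
  unfold NFUweak.cardMul isProdOf; exact dd2
end
theorem da {P : Prop} (h : P := by
  (repeat' first
    | with_reducible apply DFn.var0
    | with_reducible apply DFn.var1
    | with_reducible apply DFn.var2
    | with_reducible apply DFn.var3
    | with_reducible apply DFn.var4
    | with_reducible apply DFn.var5
    | with_reducible apply DFn.var6
    | with_reducible apply DFn.cst
    | with_reducible apply Def.prop
    | (with_reducible apply isDef; apply_assumption -exfalso -symm)
    | (with_reducible apply isDFn; apply_assumption -exfalso -symm)
    | with_reducible apply DFn.isZero
    | with_reducible apply DFn.isSucc
    | with_reducible apply DFn.isNat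
    | with_reducible apply DFn.cardAdd
    | with_reducible apply DFn.cardMul
    | with_reducible apply DFn.cr
    | with_reducible apply DFn.lt
    | with_reducible apply DFn.le
    | with_reducible apply DFn.sval
    | with_reducible apply DFn.smk
    | with_reducible apply Def.and
    | with_reducible apply Def.or
    | with_reducible apply Def.iff
    | with_reducible apply Def.imp
    | with_reducible apply Def.nott
    | with_reducible apply Def.allX
    | with_reducible apply Def.exX
    | with_reducible apply DFn.smem
    | with_reducible apply DFn.sset
    | with_reducible apply DFn.eq
    | with_reducible apply DFn.spair
    | with_reducible apply DFn.pair
    | with_reducible apply DFn.fst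
    | with_reducible apply DFn.snd
    | with_reducible apply DFn.vl)
  all_goals exact 0) : P := h

theorem nat_ind (P : K → Prop) (hP : Def (C1 K K 2) (fun p => P p.2)) (h0 : ∀ z, isZeroCard z → P z)
    (hs : ∀ n, isNat n → P n → ∀ s, isSuccOf s n → P s) (n : K) (hn : isNat n) : P n := by
  obtain ⟨I, h1, h2⟩ := compX (k := 2) (fun n : K => isNat n ∧ P n) (.and (DFn.isNat .var0) hP)
  refine ((h2 n).1 (hn I ⟨h1, fun z hz => (h2 z).2 ⟨.zero hz, h0 z hz⟩, fun a b ha hb => ?_⟩)).2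
  obtain ⟨h3, h4⟩ := (h2 a).1 ha
  exact (h2 b).2 ⟨h3.succ hb, hs a h3 h4 b hb⟩

theorem nat_cases {n : K} (hn : isNat n) : isZeroCard n ∨ ∃ m, isNat m ∧ isSuccOf n m :=
  nat_ind (fun n => isZeroCard n ∨ ∃ m, isNat m ∧ isSuccOf n m) (.or (DFn.isZero .var0) (.exX 2 (.and (DFn.isNat .var0) (DFn.isSucc .var1 .var0))))
    (fun z h => .inl h) (fun n h _ s hs => .inr ⟨n, h, hs⟩) n hn

def Rem (d y z : K) : Prop := ∀ w, smem w d ↔ smem w y ∧ w ≠ z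
theorem rem_ex (y z : K) : ∃ d, sset d ∧ Rem d y z := compX (k := 0) (fun w => smem w y ∧ w ≠ z) dd2
theorem ins_ex (y z : K) : ∃ d : K, sset d ∧ ∀ w, smem w d ↔ smem w y ∨ w = z := compX (k := 0) (fun w => smem w y ∨ w = z) dd2
theorem emp_ex : ∃ d : K, sset d ∧ ∀ w, ¬ smem w d := by
  obtain ⟨d, h, h'⟩ := compX (K := K) (k := 0) (fun w => False) dd2
  exact ⟨d, h, fun w => by simp [h']⟩
theorem uni_ex (x y : K) : ∃ d : K, sset d ∧ ∀ w, smem w d ↔ smem w x ∨ smem w y := compX (k := 0) (fun w => smem w x ∨ smem w y) dd2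
theorem prod_ex (x y : K) : ∃ d : K, isProdOf d x y :=
  compX (k := 0) (fun p => ∃ a b, smem a x ∧ smem b y ∧ p = spair a b) dd2
theorem mem_succ {s n y : K} (hs : isSuccOf s n) (hy : smem y s) : ∃ z, smem z y ∧ ∃ d, sset d ∧ Rem d y z ∧ smem d n :=
  (hs.2 y).1 hy
theorem mk_succ {s n y z d : K} (hs : isSuccOf s n) (hz : smem z y) (hd : sset d) (hr : Rem d y z) (h : smem d n) : smem y s :=
  (hs.2 y).2 ⟨z, hz, d, hd, hr, h⟩

theorem nat_rem {n : K} (hn : isNat n) : ∀ s, isSuccOf s n → ∀ y, smem y s → ∀ w, smem w y → ∀ d, sset d → Rem d y w → smem d n := by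
  refine nat_ind (fun n => ∀ s, isSuccOf s n → ∀ y, smem y s → ∀ w, smem w y → ∀ d, sset d → Rem d y w → smem d n) ?_ ?_ ?_ n hn
  · unfold Rem
    refine .allX 2 (.imp (DFn.isSucc .var0 .var1) ?_)
    exact dd2
  · intro n hz s hs y hy w hw d hd hr
    obtain ⟨z, h1, e, h2, h3, h4⟩ := mem_succ hs hy
    rw [hz.2] at h4 ⊢
    intro u hu
    have h5 : ∀ u, smem u y → u = z := fun u hu => by
      by_contra hne
      exact h4 u ((h3 u).2 ⟨hu, hne⟩)
    obtain ⟨h6, h7⟩ := (hr u).1 hu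
    exact h7 ((h5 u h6).trans (h5 w hw).symm)
  · intro m hm ih n hn s hs y hy w hw d hd hr
    obtain ⟨z, h1, e, h2, h3, h4⟩ := mem_succ hs hy
    by_cases hwz : w = z
    · subst hwz
      obtain rfl : d = e := Mdl.ext _ _ hd h2 fun u => by rw [hr, h3]
      exact h4
    · obtain ⟨c, hc, hc'⟩ := rem_ex e w
      have h5 := ih n hn e h4 w ((h3 w).2 ⟨hw, hwz⟩) c hc hc'
      refine mk_succ hn ((hr z).2 ⟨h1, Ne.symm hwz⟩) hc (fun u => ?_) h5
      rw [hc', h3, hr]; tauto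

theorem nat_ext {n x y : K} (hn : isNat n) (hx : smem x n) (h : ∀ w, smem w x ↔ smem w y) : smem y n := by
  obtain hz | ⟨m, hm, hs⟩ := nat_cases hn
  · rw [hz.2] at hx ⊢
    exact fun w hw => hx w ((h w).2 hw)
  · obtain ⟨z, h1, e, h2, h3, h4⟩ := mem_succ hs hx
    exact mk_succ hs ((h z).1 h1) h2 (fun w => by rw [h3, h]) h4

theorem nat_disj {n : K} (hn : isNat n) : ∀ m, isNat m → ∀ y, smem y n → smem y m → n = m := by
  refine nat_ind (fun n => ∀ m, isNat m → ∀ y, smem y n → smem y m → n = m) ?_ ?_ ?_ n hn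
  · exact .allX 2 (.imp (DFn.isNat .var0) dd2)
  · intro n hz m hm y hy hy'
    rw [hz.2] at hy
    obtain hz' | ⟨m', hm', hs⟩ := nat_cases hm
    · exact zero_uniq hz hz'
    · obtain ⟨z, h1, e⟩ := mem_succ hs hy'
      exact absurd h1 (hy z)
  · intro n hn ih s hs m hm y hy hy'
    obtain ⟨w, h1, d, h2, h3, h4⟩ := mem_succ hs hy
    obtain hz' | ⟨m', hm', hs'⟩ := nat_cases hm
    · exact absurd h1 ((hz'.2 y).1 hy' w)
    · obtain rfl := ih m' hm' d h4 (nat_rem hm' m hs' y hy' w h1 d h2 h3)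
      exact succ_uniq hs hs'

theorem nat_sub {n : K} (hn : isNat n) : ∀ u v, smem u n → smem v n → (∀ w, smem w u → smem w v) → ∀ w, smem w v → smem w u := by
  refine nat_ind (fun n => ∀ u v, smem u n → smem v n → (∀ w, smem w u → smem w v) → ∀ w, smem w v → smem w u) dd2 ?_ ?_ n hn
  · intro n hz u v hu hv h w hw
    exact absurd hw ((hz.2 v).1 hv w)
  · intro n hn ih s hs u v hu hv h w hw
    obtain ⟨z, h1, d, h2, h3, h4⟩ := mem_succ hs hu
    obtain ⟨e, h5, h6⟩ := rem_ex v z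
    by_cases hwz : w = z
    · exact hwz ▸ h1
    · refine ((h3 w).1 (ih d e h4 (nat_rem hn s hs v hv z (h z h1) e h5 h6) (fun x hx => ?_) w ((h6 w).2 ⟨hw, hwz⟩))).1
      obtain ⟨h7, h8⟩ := (h3 x).1 hx
      exact (h6 x).2 ⟨h x h7, h8⟩

theorem nat_subset {n : K} (hn : isNat n) : ∀ y, smem y n → ∀ y', sset y' → (∀ w, smem w y' → smem w y) → ∃ m, isNat m ∧ smem y' m := by
  refine nat_ind (fun n => ∀ y, smem y n → ∀ y', sset y' → (∀ w, smem w y' → smem w y) → ∃ m, isNat m ∧ smem y' m) ?_ ?_ ?_ n hn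
  · exact .allX 1 (.imp dd2 (.allX 1 (.imp dd2 (.imp dd2 (.exX 2 (.and (DFn.isNat .var0) dd2))))))
  · intro n hz y hy y' hy' h
    exact ⟨n, .zero hz, (hz.2 _).2 fun w hw => (hz.2 y).1 hy w (h w hw)⟩
  · intro n hn ih s hs y hy y' hy' h
    obtain ⟨z, h1, d, h2, h3, h4⟩ := mem_succ hs hy
    by_cases hz : smem z y'
    · obtain ⟨e, h5, h6⟩ := rem_ex y' z
      obtain ⟨m, hm, h7⟩ := ih d h4 e h5 fun w hw => (h3 w).2 ⟨h w ((h6 w).1 hw).1, ((h6 w).1 hw).2⟩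
      obtain ⟨t, ht⟩ := succ_ex m
      exact ⟨t, hm.succ ht, mk_succ ht hz h5 h6 h7⟩
    · exact ih d h4 y' hy' fun w hw => (h3 w).2 ⟨h w hw, fun e => hz (e ▸ hw)⟩

theorem nat_pr {n : K} (hn : isNat n) (w : K) : ∀ x, smem x n → ∀ q, sset q → (∀ p, smem p q ↔ ∃ a, smem a x ∧ p = spair a w) → smem q n := by
  refine nat_ind (fun n => ∀ x, smem x n → ∀ q, sset q → (∀ p, smem p q ↔ ∃ a, smem a x ∧ p = spair a w) → smem q n) dd2 ?_ ?_ n hn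
  · intro n hz x hx q hq h
    rw [hz.2] at hx ⊢
    intro p hp
    obtain ⟨a, ha, _⟩ := (h p).1 hp
    exact hx a ha
  · intro n hn ih s hs x hx q hq h
    obtain ⟨z, h1, d, h2, h3, h4⟩ := mem_succ hs hx
    obtain ⟨e, h5, h6⟩ := rem_ex q (spair z w)
    refine mk_succ hs ((h _).2 ⟨z, h1, rfl⟩) h5 h6 (ih d h4 e h5 fun p => ?_)
    rw [h6, h]
    constructor
    · rintro ⟨⟨a, ha, rfl⟩, h7⟩
      exact ⟨a, (h3 a).2 ⟨ha, fun e => h7 (e ▸ rfl)⟩, rfl⟩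
    · rintro ⟨a, ha, rfl⟩
      obtain ⟨h7, h8⟩ := (h3 a).1 ha
      exact ⟨⟨a, h7, rfl⟩, fun e => h8 (Mdl.pinj _ _ _ _ e).1⟩

/-! addition -/
theorem add_zero' {a b c : K} (ha : isNat a) (hb : isZeroCard b) (hc : isNat c) (h : cardAdd a b c) : a = c := by
  obtain ⟨x, y, u, h1, h2, h3, h4, h5, h6⟩ := h
  rw [hb.2] at h2
  exact nat_disj ha c hc u (nat_ext ha h1 fun w => by rw [h5]; simp [h2]) h6
theorem zero_add' {a b x : K} (ha : isNat a) (hx : smem x a) (hb : isZeroCard b) : cardAdd a b a := by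
  obtain ⟨e, he, he'⟩ := emp_ex (K := K)
  obtain ⟨u, hu, hu'⟩ := uni_ex x e
  exact ⟨x, e, u, hx, (hb.2 e).2 he', fun w h => he' w h.2, hu, hu', nat_ext ha hx fun w => by rw [hu']; simp [he']⟩
theorem add_succ' {a b s c : K} (hb : isNat b) (hs : isSuccOf s b) (hc : isNat c) (h : cardAdd a s c) :
    ∃ c0, isNat c0 ∧ isSuccOf c c0 ∧ cardAdd a b c0 := by
  obtain ⟨x, y, u, h1, h2, h3, h4, h5, h6⟩ := h
  obtain ⟨z, h7, d, h8, h9, h10⟩ := mem_succ hs h2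
  obtain hz | ⟨m, hm, hm'⟩ := nat_cases hc
  · exact absurd ((h5 z).2 (.inr h7)) ((hz.2 u).1 h6 z)
  · obtain ⟨e, h11, h12⟩ := rem_ex u z
    refine ⟨m, hm, hm', x, d, e, h1, h10, fun w hw => h3 w ⟨hw.1, ((h9 w).1 hw.2).1⟩, h11, fun w => ?_,
      nat_rem hm c hm' u h6 z ((h5 z).2 (.inr h7)) e h11 h12⟩
    rw [h12, h5, h9]
    constructor
    · tauto
    · rintro (h | h)
      · exact ⟨.inl h, fun e => h3 z ⟨e ▸ h, h7⟩⟩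
      · tauto
theorem add_wd {b : K} (hb : isNat b) (a : K) (ha : isNat a) : ∀ c, isNat c → cardAdd a b c → ∀ x y u, smem x a → smem y b →
    (∀ w, ¬ (smem w x ∧ smem w y)) → sset u → (∀ w, smem w u ↔ (smem w x ∨ smem w y)) → smem u c := by
  refine nat_ind (fun b => ∀ c, isNat c → cardAdd a b c → ∀ x y u, smem x a → smem y b →
    (∀ w, ¬ (smem w x ∧ smem w y)) → sset u → (∀ w, smem w u ↔ (smem w x ∨ smem w y)) → smem u c) ?_ ?_ ?_ b hb
  · exact .allX 2 (.imp (DFn.isNat .var0) (.imp (DFn.cardAdd (i := 0) (.cst _) .var1 .var0) dd2))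
  · intro b hz c hc h x y u hx hy _ hu hu'
    obtain rfl := add_zero' ha hz hc h
    exact nat_ext ha hx fun w => by rw [hu']; simp [(hz.2 y).1 hy w]
  · intro b hb ih s hs c hc h x y u hx hy hxy hu hu'
    obtain ⟨c0, h1, h2, h3⟩ := add_succ' hb hs hc h
    obtain ⟨z, h7, d, h8, h9, h10⟩ := mem_succ hs hy
    obtain ⟨e, h11, h12⟩ := rem_ex u z
    refine mk_succ h2 ((hu' z).2 (.inr h7)) h11 h12 (ih c0 h1 h3 x d e hx h10 (fun w hw => hxy w ⟨hw.1, ((h9 w).1 hw.2).1⟩) h11 fun w => ?_)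
    rw [h12, hu', h9]
    constructor
    · tauto
    · rintro (h | h)
      · exact ⟨.inl h, fun e => hxy z ⟨e ▸ h, h7⟩⟩
      · tauto
theorem succ_add' {a b c s t : K} (hc : ∀ u, smem u c → ∃ w, ¬ smem w u) (hb : isNat b) (hn : isNat c) (hs : isSuccOf s b) (ht : isSuccOf t c)
    (h : cardAdd a b c) : cardAdd a s t := by
  obtain ⟨x, y, u, h1, h2, h3, h4, h5, h6⟩ := h
  obtain ⟨w, hw⟩ := hc u h6
  rw [h5, not_or] at hw
  obtain ⟨y', h7, h8⟩ := ins_ex y w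
  obtain ⟨u', h9, h10⟩ := uni_ex x y'
  obtain ⟨d, h11, h12⟩ := rem_ex y' w
  obtain ⟨e, h13, h14⟩ := rem_ex u' w
  refine ⟨x, y', u', h1, mk_succ hs ((h8 w).2 (.inr rfl)) h11 h12 (nat_ext hb h2 fun v => ?_), fun v hv => ?_, h9, h10,
    mk_succ ht ((h10 w).2 (.inr ((h8 w).2 (.inr rfl)))) h13 h14 (nat_ext hn h6 fun v => ?_)⟩
  · rw [h12, h8]
    exact ⟨fun h => ⟨.inl h, fun e => hw.2 (e ▸ h)⟩, fun h => h.1.resolve_right h.2⟩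
  · rcases (h8 v).1 hv.2 with h | h
    · exact h3 v ⟨hv.1, h⟩
    · exact hw.1 (h ▸ hv.1)
  · rw [h14, h10, h8, h5]
    constructor
    · rintro (h | h)
      · exact ⟨.inl h, fun e => hw.1 (e ▸ h)⟩
      · exact ⟨.inr (.inl h), fun e => hw.2 (e ▸ h)⟩
    · tauto

/-! multiplication -/
theorem mul_zero' {a b c : K} (hb : isZeroCard b) (hc : isNat c) (h : cardMul a b c) : isZeroCard c := by
  obtain ⟨x, y, P, h1, h2, h3, h4⟩ := h
  rw [hb.2] at h2
  obtain ⟨z, hz⟩ := zero_ex (K := K)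
  have : smem P z := (hz.2 P).2 fun p hp => by
    obtain ⟨a, b, _, h, _⟩ := (h3.2 p).1 hp
    exact h2 b h
  exact nat_disj hc z (.zero hz) P h4 this ▸ hz
theorem zero_mul' {a b x : K} (hx : smem x a) (hb : isZeroCard b) : cardMul a b b := by
  obtain ⟨e, he, he'⟩ := emp_ex (K := K)
  obtain ⟨P, hP⟩ := prod_ex x e
  refine ⟨x, e, P, hx, (hb.2 e).2 he', hP, (hb.2 P).2 fun p hp => ?_⟩
  obtain ⟨a, b, _, h, _⟩ := (hP.2 p).1 hp
  exact he' b h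
theorem mul_succ' {a b s c : K} (ha : isNat a) (hb : isNat b) (hs : isSuccOf s b) (hc : isNat c) (h : cardMul a s c) :
    ∃ c0, isNat c0 ∧ cardMul a b c0 ∧ cardAdd c0 a c := by
  obtain ⟨x, y, P, h1, h2, h3, h4⟩ := h
  obtain ⟨z, h7, d, h8, h9, h10⟩ := mem_succ hs h2
  obtain ⟨Q, hQ⟩ := prod_ex x d
  obtain ⟨c0, h11, h12⟩ := nat_subset hc P h4 Q hQ.1 fun p hp => by
    obtain ⟨u, v, hu, hv, rfl⟩ := (hQ.2 p).1 hp
    exact (h3.2 _).2 ⟨u, v, hu, ((h9 v).1 hv).1, rfl⟩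
  obtain ⟨R, hR, hR'⟩ := compX (K := K) (k := 0) (fun p => ∃ a, smem a x ∧ p = spair a z) dd2
  refine ⟨c0, h11, ⟨x, d, Q, h1, h10, hQ, h12⟩, Q, R, P, h12, nat_pr ha z x h1 R hR hR', ?_, h3.1, ?_, h4⟩
  · rintro w ⟨hw, hw'⟩
    obtain ⟨u, v, hu, hv, rfl⟩ := (hQ.2 w).1 hw
    obtain ⟨u', _, e⟩ := (hR' _).1 hw'
    exact ((h9 v).1 hv).2 (Mdl.pinj _ _ _ _ e).2
  · intro w
    rw [h3.2, hQ.2, hR']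
    constructor
    · rintro ⟨u, v, hu, hv, rfl⟩
      by_cases hvz : v = z
      · exact .inr ⟨u, hu, hvz ▸ rfl⟩
      · exact .inl ⟨u, v, hu, (h9 v).2 ⟨hv, hvz⟩, rfl⟩
    · rintro (⟨u, v, hu, hv, rfl⟩ | ⟨u, hu, rfl⟩)
      · exact ⟨u, v, hu, ((h9 v).1 hv).1, rfl⟩
      · exact ⟨u, z, hu, h7, rfl⟩
theorem succ_mul' {a b c s t : K} (hbu : ∀ u, smem u b → ∃ w, ¬ smem w u) (ha : isNat a) (hb : isNat b) (hc : isNat c) (ht : isNat t)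
    (hs : isSuccOf s b) (h : cardMul a b c) (h' : cardAdd c a t) : cardMul a s t := by
  obtain ⟨x, y, P, h1, h2, h3, h4⟩ := h
  obtain ⟨z, hz⟩ := hbu y h2
  obtain ⟨y', h7, h8⟩ := ins_ex y z
  obtain ⟨d, h11, h12⟩ := rem_ex y' z
  obtain ⟨Q, hQ⟩ := prod_ex x y'
  obtain ⟨R, hR, hR'⟩ := compX (K := K) (k := 0) (fun p => ∃ a, smem a x ∧ p = spair a z) dd2
  refine ⟨x, y', Q, h1, mk_succ hs ((h8 z).2 (.inr rfl)) h11 h12 (nat_ext hb h2 fun v => ?_), hQ,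
    add_wd ha c hc t ht h' P R Q h4 (nat_pr ha z x h1 R hR hR') ?_ hQ.1 fun w => ?_⟩
  · rw [h12, h8]
    exact ⟨fun h => ⟨.inl h, fun e => hz (e ▸ h)⟩, fun h => h.1.resolve_right h.2⟩
  · rintro w ⟨hw, hw'⟩
    obtain ⟨u, v, hu, hv, rfl⟩ := (h3.2 w).1 hw
    obtain ⟨u', _, e⟩ := (hR' _).1 hw'
    exact hz ((Mdl.pinj _ _ _ _ e).2 ▸ hv)
  · rw [h3.2, hQ.2, hR']
    constructor
    · rintro ⟨u, v, hu, hv, rfl⟩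
      rcases (h8 v).1 hv with hv | rfl
      · exact .inl ⟨u, v, hu, hv, rfl⟩
      · exact .inr ⟨u, hu, rfl⟩
    · rintro (⟨u, v, hu, hv, rfl⟩ | ⟨u, hu, rfl⟩)
      · exact ⟨u, v, hu, (h8 v).2 (.inl hv), rfl⟩
      · exact ⟨u, z, hu, (h8 z).2 (.inr rfl), rfl⟩
end
end NFUweak

open FirstOrder Language
namespace NFUweak
set_option linter.unusedSectionVars false
set_option linter.unusedVariables false

section
variable {K : Type} [LNFU.Structure K] [HasLt K] [Mdl K]

/-! ## definability over the inner model implies definability over `K` -/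
theorem Tm.down {Γ : Type} {W : VS Γ (DD K)} {f i} (h : Tm W f i) (V : VS Γ K)
    (hV : ∀ f i, W f i → DFn V f (2*i)) : DFn V f (2*i) := by
  induction h with
  | var h => exact hV _ _ h
  | cst c i => exact DFn.cst c
  | pair _ _ h1 h2 => exact DFn.pp h1 h2

theorem DFn.setM {Γ : Type} {V : VS Γ K} {f : Γ → DD K} {i} (c : DD K) (hf : DFn V f i) : Def V (fun γ => SetM c (f γ)) := by
  refine Def.c1 (P := fun x : DD K => SetM c x) ?_ hf
  unfold SetM; exact dd8

theorem Def.down {Γ : Type} {W : VS Γ (DD K)} {P : Γ → Prop} (h : Def W P) : ∀ V : VS Γ K,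
    (∀ f i, W f i → DFn V f (2*i)) → Def V P := by
  induction h with
  | fal => intro V hV; exact .fal
  | eq h1 h2 => intro V hV; exact DFn.eq (h1.down V hV) (h2.down V hV)
  | mem h1 h2 => intro V hV; exact .and (DFn.setM _ (h2.down V hV)) (DFn.ee (.tau (h1.down V hV)) (h2.down V hV))
  | set h1 => intro V hV; exact DFn.setM _ (h1.down V hV)
  | lt h1 h2 => intro V hV; exact DFn.lt (h1.down V hV) (h2.down V hV)
  | imp _ _ h1 h2 => intro V hV; exact .imp (h1 V hV) (h2 V hV)
  | @all Γ W k Q _ ih =>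
    intro V hV
    refine Def.allX (2*k) (ih _ ?_)
    rintro f i (⟨g, hg, rfl⟩ | ⟨rfl, rfl⟩)
    · exact .wk (hV _ _ hg)
    · exact .var0

instance : IWO (DD K) (DD K) where
  irel := IRel.mk (k := 0) ((Def.nott (DFn.ltx .var0 .var1)).congr fun γ => not_lt)
  wf P hP h := by
    obtain ⟨G, hG, h'⟩ := hP
    obtain ⟨x, h1, h2⟩ := IWO.least (K := K) P (k := 0) ((Def.and (.prop (SetM (Om K) G)) (DFn.ee (.tau .var0) (.cst G))).congr
      fun p => (IPred.iff h' p.2).symm) h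
    exact ⟨x, h1, fun y hy => not_lt.1 fun hl => h2 y hl hy⟩
end

/-! ## segments -/
section
variable {A : Type} [LNFU.Structure A] [HasLt A] [Mdl A] {D : Type} [ISet A D] [LinearOrder D] [IWO A D]

def IsSuc {D : Type} [LinearOrder D] (s x : D) : Prop := ∀ y, y < s ↔ y ≤ x
def IsBt {D : Type} [LinearOrder D] (x : D) : Prop := ∀ y, x ≤ y
def InOm {D : Type} [LinearOrder D] (x : D) : Prop := ∀ y, y ≤ x → IsBt y ∨ ∃ z, IsSuc y z
def IsSeg (u : A) (x : D) : Prop := sset u ∧ ∀ w, smem w u ↔ ∃ y, y < x ∧ w = vl y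
def Sg (n : A) (x : D) : Prop := ∃ u, IsSeg u x ∧ smem u n

section
variable {Γ : Type} {V : VS Γ A} {i : ℕ}
theorem DFn.inOm {f : Γ → D} (hf : DFn V f i) : Def V (fun γ => InOm (f γ)) := by
  refine Def.c1 (P := fun x : D => InOm x) ?_ hf
  unfold InOm IsBt IsSuc; exact dd2
theorem DFn.isSuc {f g : Γ → D} (hf : DFn V f i) (hg : DFn V g i) : Def V (fun γ => IsSuc (f γ) (g γ)) := by
  refine Def.c2 (P := fun x y : D => IsSuc x y) ?_ hf hg
  unfold IsSuc; exact dd2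
theorem DFn.isSeg {f : Γ → A} {g : Γ → D} (hf : DFn V f (i+1)) (hg : DFn V g i) : Def V (fun γ => IsSeg (f γ) (g γ)) := by
  refine Def.c2 (P := fun (x : A) (y : D) => IsSeg x y) ?_ hf hg
  unfold IsSeg; exact dd2
theorem DFn.sg {f : Γ → A} {g : Γ → D} (hf : DFn V f (i+2)) (hg : DFn V g i) : Def V (fun γ => Sg (f γ) (g γ)) := by
  refine Def.c2 (P := fun (x : A) (y : D) => Sg x y) ?_ hf hg
  unfold Sg
  exact .exX (i+1) (.and (DFn.isSeg .var0 .var1) dd2)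
end

theorem IsSuc.lt {s x : D} (h : IsSuc s x) : x < s := (h x).2 le_rfl
theorem InOm.suc {s x : D} (h : InOm x) (hs : IsSuc s x) : InOm s := fun y hy => by
  rcases hy.lt_or_eq with hl | rfl
  · exact h y ((hs y).1 hl)
  · exact .inr ⟨x, hs⟩
theorem InOm.le {s x : D} (h : InOm x) (hs : s ≤ x) : InOm s := fun y hy => h y (hy.trans hs)
theorem InOm.bt {x : D} (h : IsBt x) : InOm x := fun y hy => .inl fun z => hy.trans (h z)
theorem bt_ex (A : Type) [LNFU.Structure A] [HasLt A] [Mdl A] (D : Type) [ISet A D] [LinearOrder D] [IWO A D] [Nonempty D] :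
    ∃ x : D, IsBt x := by
  obtain ⟨x, _, h⟩ := IWO.least (K := A) (fun _ : D => True) (k := 0) (.prop True) ⟨Classical.arbitrary D, trivial⟩
  exact ⟨x, fun y => not_lt.1 fun hl => h y hl trivial⟩
theorem suc_ex (A : Type) [LNFU.Structure A] [HasLt A] [Mdl A] {D : Type} [ISet A D] [LinearOrder D] [IWO A D] [NoMaxOrder D] (x : D) :
    ∃ s : D, IsSuc s x := by
  obtain ⟨s, h1, h2⟩ := IWO.least (K := A) (fun y : D => x < y) (k := 0) dd2 (exists_gt x)
  exact ⟨s, fun y => ⟨fun hy => not_lt.1 (h2 y hy), fun hy => hy.trans_lt h1⟩⟩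
theorem suc_uniq {s t x : D} (hs : IsSuc s x) (ht : IsSuc t x) : s = t :=
  le_antisymm (not_lt.1 fun h => lt_irrefl t ((ht t).2 ((hs t).1 h))) (not_lt.1 fun h => lt_irrefl s ((hs s).2 ((ht s).1 h)))
theorem suc_inj {s x y : D} (hx : IsSuc s x) (hy : IsSuc s y) : x = y :=
  le_antisymm ((hy x).1 hx.lt) ((hx y).1 hy.lt)

theorem seg_ex (x : D) : ∃ u : A, IsSeg u x := compX (k := 0) (fun w => ∃ y, y < x ∧ w = vl y) dd2
theorem seg_uniq {u v : A} {x : D} (hu : IsSeg u x) (hv : IsSeg v x) : u = v :=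
  Mdl.ext _ _ hu.1 hv.1 fun w => by rw [hu.2, hv.2]
theorem seg_mem {u : A} {x y : D} (hu : IsSeg u x) : smem (vl y) u ↔ y < x := by
  rw [hu.2]
  exact ⟨fun ⟨z, h, e⟩ => vl_inj e ▸ h, fun h => ⟨y, h, rfl⟩⟩

theorem Sg.uniq {n : A} (hn : isNat n) {x y : D} (hx : Sg n x) (hy : Sg n y) : x = y := by
  have key : ∀ {x y : D}, Sg n x → Sg n y → ¬ x < y := by
    rintro x y ⟨u, hu, h1⟩ ⟨v, hv, h2⟩ hl
    refine lt_irrefl x ((seg_mem hu).1 (nat_sub hn u v h1 h2 (fun w hw => ?_) _ ((seg_mem hv).2 hl)))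
    obtain ⟨z, hz, rfl⟩ := (hu.2 w).1 hw
    exact (seg_mem hv).2 (hz.trans hl)
  exact le_antisymm (not_lt.1 (key hy hx)) (not_lt.1 (key hx hy))
theorem Sg.inj {n m : A} (hn : isNat n) (hm : isNat m) {x : D} (hx : Sg n x) (hy : Sg m x) : n = m := by
  obtain ⟨u, hu, h1⟩ := hx
  obtain ⟨v, hv, h2⟩ := hy
  obtain rfl := seg_uniq hu hv
  exact nat_disj hn m hm u h1 h2
theorem Sg.zero {n : A} (hn : isZeroCard n) {x : D} (hx : IsBt x) : Sg n x := by
  obtain ⟨u, hu⟩ := seg_ex (A := A) x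
  refine ⟨u, hu, (hn.2 u).2 fun w hw => ?_⟩
  obtain ⟨y, hy, _⟩ := (hu.2 w).1 hw
  exact absurd hy (not_lt.2 (hx y))
theorem Sg.succ {n m : A} (hm : isSuccOf m n) {x s : D} (hs : IsSuc s x) (h : Sg n x) : Sg m s := by
  obtain ⟨u, hu, h1⟩ := h
  obtain ⟨v, hv⟩ := seg_ex (A := A) s
  refine ⟨v, hv, mk_succ hm ((seg_mem hv).2 hs.lt) hu.1 (fun w => ?_) h1⟩
  rw [hu.2, hv.2]
  constructor
  · rintro ⟨y, hy, rfl⟩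
    exact ⟨⟨y, hy.trans hs.lt, rfl⟩, fun e => hy.ne (vl_inj e)⟩
  · rintro ⟨⟨y, hy, rfl⟩, hne⟩
    exact ⟨y, lt_of_le_of_ne ((hs y).1 hy) fun e => hne (e ▸ rfl), rfl⟩

variable [Nonempty D] [NoMaxOrder D]
theorem nat_seg (D : Type) [ISet A D] [LinearOrder D] [IWO A D] [Nonempty D] [NoMaxOrder D] {n : A} (hn : isNat n) : ∃ x : D, InOm x ∧ Sg n x := by
  refine nat_ind (fun n => ∃ x : D, InOm x ∧ Sg n x) ?_ ?_ ?_ n hn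
  · exact .exX 0 (.and (DFn.inOm .var0) (DFn.sg .var1 .var0))
  · intro z hz
    obtain ⟨x, hx⟩ := bt_ex A D
    exact ⟨x, .bt hx, .zero hz hx⟩
  · rintro n hn ⟨x, hx, h⟩ s hs
    obtain ⟨t, ht⟩ := suc_ex A x
    exact ⟨t, hx.suc ht, h.succ hs ht⟩
theorem seg_nat (A : Type) [LNFU.Structure A] [HasLt A] [Mdl A] {D : Type} [ISet A D] [LinearOrder D] [IWO A D] (x : D) : InOm x → ∃ n : A, isNat n ∧ Sg n x := by
  refine IWO.ind (K := A) (fun x : D => InOm x → ∃ n : A, isNat n ∧ Sg n x) (k := 0) ?_ ?_ x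
  · exact .imp (DFn.inOm .var0) (.exX 2 (.and (DFn.isNat .var0) (DFn.sg .var0 .var1)))
  · intro x ih hx
    obtain h | ⟨z, h⟩ := hx x le_rfl
    · obtain ⟨n, hn⟩ := zero_ex (K := A)
      exact ⟨n, .zero hn, .zero hn h⟩
    · obtain ⟨n, hn, h1⟩ := ih z h.lt (hx.le h.lt.le)
      obtain ⟨m, hm⟩ := succ_ex n
      exact ⟨m, hn.succ hm, h1.succ hm h⟩
theorem nat_out (D : Type) [ISet A D] [LinearOrder D] [IWO A D] [Nonempty D] [NoMaxOrder D] {n : A} (hn : isNat n) (u : A) (hu : smem u n) : ∃ w, ¬ smem w u := by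
  obtain ⟨x, hx, v, hv, h⟩ := nat_seg D hn
  by_contra hc
  push Not at hc
  exact lt_irrefl x ((seg_mem hv).1 (nat_sub hn v u h hu (fun w _ => hc w) _ (hc _)))
theorem zero_bt {n : A} {x : D} (hn : isNat n) (h : Sg n x) : isZeroCard n ↔ IsBt x := by
  constructor
  · intro hz
    obtain ⟨y, hy⟩ := bt_ex A D
    exact Sg.uniq hn h (.zero hz hy) ▸ hy
  · intro hx
    obtain ⟨m, hm⟩ := zero_ex (K := A)
    exact Sg.inj hn (.zero hm) h (.zero hm hx) ▸ hm

/-! ## arithmetic transferred to the order -/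
def AddD (A : Type) [LNFU.Structure A] {D : Type} [ISet A D] [LinearOrder D] (x y z : D) : Prop :=
  ∃ a b c : A, (isNat a ∧ isNat b ∧ isNat c) ∧ (Sg a x ∧ Sg b y ∧ Sg c z) ∧ cardAdd a b c
def MulD (A : Type) [LNFU.Structure A] {D : Type} [ISet A D] [LinearOrder D] (x y z : D) : Prop :=
  ∃ a b c : A, (isNat a ∧ isNat b ∧ isNat c) ∧ (Sg a x ∧ Sg b y ∧ Sg c z) ∧ cardMul a b c
theorem DFn.addD {Γ : Type} {V : VS Γ A} {f g h : Γ → D} {i} (hf : DFn V f i) (hg : DFn V g i) (hh : DFn V h i) :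
    Def V (fun γ => AddD A (f γ) (g γ) (h γ)) := by
  refine Def.c3 (P := fun x y z : D => AddD A x y z) ?_ hf hg hh
  exact .exX (i+2) (.exX (i+2) (.exX (i+2) (.and (.and (DFn.isNat .var2) (.and (DFn.isNat .var1) (DFn.isNat .var0)))
    (.and (.and (DFn.sg .var2 .var5) (.and (DFn.sg .var1 .var4) (DFn.sg .var0 .var3))) (DFn.cardAdd .var2 .var1 .var0)))))
theorem DFn.mulD {Γ : Type} {V : VS Γ A} {f g h : Γ → D} {i} (hf : DFn V f i) (hg : DFn V g i) (hh : DFn V h i) :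
    Def V (fun γ => MulD A (f γ) (g γ) (h γ)) := by
  refine Def.c3 (P := fun x y z : D => MulD A x y z) ?_ hf hg hh
  exact .exX (i+2) (.exX (i+2) (.exX (i+2) (.and (.and (DFn.isNat .var2) (.and (DFn.isNat .var1) (DFn.isNat .var0)))
    (.and (.and (DFn.sg .var2 .var5) (.and (DFn.sg .var1 .var4) (DFn.sg .var0 .var3))) (DFn.cardMul .var2 .var1 .var0)))))

theorem AddD.bt {x y z : D} (hx : InOm x) (hy : IsBt y) : AddD A x y z ↔ x = z := by
  constructor
  · rintro ⟨a, b, c, ⟨ha, hb, hc⟩, ⟨h1, h2, h3⟩, h⟩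
    obtain rfl := add_zero' ha ((zero_bt hb h2).2 hy) hc h
    exact Sg.uniq ha h1 h3
  · rintro rfl
    obtain ⟨a, ha, h1⟩ := seg_nat A x hx
    obtain ⟨b, hb⟩ := zero_ex (K := A)
    obtain ⟨u, _, hu⟩ := id h1
    exact ⟨a, b, a, ⟨ha, .zero hb, ha⟩, ⟨h1, .zero hb hy, h1⟩, zero_add' ha hu hb⟩
theorem AddD.suc {x y y0 z : D} (hx : InOm x) (hy0 : InOm y0) (hy : IsSuc y y0) :
    AddD A x y z ↔ ∃ z0, InOm z0 ∧ IsSuc z z0 ∧ AddD A x y0 z0 := by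
  constructor
  · rintro ⟨a, b, c, ⟨ha, hb, hc⟩, ⟨h1, h2, h3⟩, h⟩
    obtain ⟨b0, hb0, h4⟩ := seg_nat A y0 hy0
    obtain ⟨s, hs⟩ := succ_ex b0
    obtain rfl := Sg.inj hb (hb0.succ hs) h2 (h4.succ hs hy)
    obtain ⟨c0, hc0, h5, h6⟩ := add_succ' hb0 hs hc h
    obtain ⟨z0, hz0, h7⟩ := nat_seg D hc0
    obtain ⟨z', hz'⟩ := suc_ex A z0
    obtain rfl := Sg.uniq hc h3 (h7.succ h5 hz')
    exact ⟨z0, hz0, hz', a, b0, c0, ⟨ha, hb0, hc0⟩, ⟨h1, h4, h7⟩, h6⟩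
  · rintro ⟨z0, hz0, hz, a, b, c, ⟨ha, hb, hc⟩, ⟨h1, h2, h3⟩, h⟩
    obtain ⟨s, hs⟩ := succ_ex b
    obtain ⟨t, ht⟩ := succ_ex c
    exact ⟨a, s, t, ⟨ha, hb.succ hs, hc.succ ht⟩, ⟨h1, h2.succ hs hy, h3.succ ht hz⟩, succ_add' (nat_out D hc) hb hc hs ht h⟩
theorem MulD.bt {x y z : D} (hx : InOm x) (hy : IsBt y) : MulD A x y z ↔ IsBt z := by
  constructor
  · rintro ⟨a, b, c, ⟨ha, hb, hc⟩, ⟨h1, h2, h3⟩, h⟩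
    exact (zero_bt hc h3).1 (mul_zero' ((zero_bt hb h2).2 hy) hc h)
  · intro hz
    obtain ⟨a, ha, h1⟩ := seg_nat A x hx
    obtain ⟨b, hb⟩ := zero_ex (K := A)
    obtain ⟨u, _, hu⟩ := id h1
    exact ⟨a, b, b, ⟨ha, .zero hb, .zero hb⟩, ⟨h1, .zero hb hy, .zero hb hz⟩, zero_mul' hu hb⟩
theorem MulD.suc {x y y0 z : D} (hx : InOm x) (hy0 : InOm y0) (hy : IsSuc y y0) :
    MulD A x y z ↔ ∃ z0, InOm z0 ∧ MulD A x y0 z0 ∧ AddD A z0 x z := by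
  constructor
  · rintro ⟨a, b, c, ⟨ha, hb, hc⟩, ⟨h1, h2, h3⟩, h⟩
    obtain ⟨b0, hb0, h4⟩ := seg_nat A y0 hy0
    obtain ⟨s, hs⟩ := succ_ex b0
    obtain rfl := Sg.inj hb (hb0.succ hs) h2 (h4.succ hs hy)
    obtain ⟨c0, hc0, h5, h6⟩ := mul_succ' ha hb0 hs hc h
    obtain ⟨z0, hz0, h7⟩ := nat_seg D hc0
    exact ⟨z0, hz0, ⟨a, b0, c0, ⟨ha, hb0, hc0⟩, ⟨h1, h4, h7⟩, h5⟩, ⟨c0, a, c, ⟨hc0, ha, hc⟩, ⟨h7, h1, h3⟩, h6⟩⟩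
  · rintro ⟨z0, hz0, ⟨a, b, c, ⟨ha, hb, hc⟩, ⟨h1, h2, h3⟩, h⟩, ⟨c', a', t, ⟨hc', ha', ht⟩, ⟨h4, h5, h6⟩, h'⟩⟩
    obtain rfl := Sg.inj ha ha' h1 h5
    obtain rfl := Sg.inj hc hc' h3 h4
    obtain ⟨s, hs⟩ := succ_ex b
    exact ⟨a, s, t, ⟨ha, hb.succ hs, ht⟩, ⟨h1, h2.succ hs hy, h6⟩, succ_mul' (nat_out D hb) ha hb hc ht hs h h'⟩

theorem natX (D : Type) [ISet A D] [LinearOrder D] [IWO A D] [Nonempty D] [NoMaxOrder D] :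
    ∃ e : NatSub A ≃ {x : D // InOm x}, ∀ n, Sg n.1 (e n).1 := by
  choose f hf using fun n : NatSub A => nat_seg D n.2
  refine ⟨Equiv.ofBijective (fun n => ⟨f n, (hf n).1⟩) ⟨?_, ?_⟩, fun n => (hf n).2⟩
  · intro n m h
    refine Subtype.ext (Sg.inj n.2 m.2 (hf n).2 ?_)
    rw [show f n = f m from congrArg Subtype.val h]
    exact (hf m).2
  · rintro ⟨x, hx⟩
    obtain ⟨n, hn, h⟩ := seg_nat A x hx
    exact ⟨⟨n, hn⟩, Subtype.ext (Sg.uniq hn (hf ⟨n, hn⟩).2 h)⟩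
end

/-! ## comparison -/
section
variable {K : Type} [LNFU.Structure K] [HasLt K] [Mdl K]
theorem c1_down {k} : ∀ f i, C1 (DD K) (DD K) k f i → DFn (C1 K (DD K) (2*k)) f (2*i) := by
  rintro f i (⟨g, hg, rfl⟩ | ⟨rfl, rfl⟩)
  · exact hg.elim
  · exact .var0
theorem add_iff {x : DD K} (hx : InOm x) (y : DD K) : InOm y → ∀ z, AddD K x y z ↔ AddD (DD K) x y z := by
  refine IWO.ind (K := K) (fun y => InOm y → ∀ z, AddD K x y z ↔ AddD (DD K) x y z) (k := 0) ?_ ?_ y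
  · refine .imp (DFn.inOm .var0) (.allX 0 (.iff (DFn.addD (.cst x) .var1 .var0) ?_))
    have : Def (C2 (DD K) (DD K) 0 (DD K) 0) (fun p => AddD (DD K) x p.1.2 p.2) := DFn.addD (i := 0) (.cst x) .var1 .var0
    refine this.down _ ?_
    rintro f i (⟨g, ⟨g, hg, rfl⟩ | ⟨rfl, rfl⟩, rfl⟩ | ⟨rfl, rfl⟩)
    · exact hg.elim
    · exact .var1
    · exact .var0
  · intro y ih hy z
    obtain h | ⟨y0, h⟩ := hy y le_rfl
    · rw [AddD.bt hx h, AddD.bt hx h]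
    · have hy0 : InOm y0 := hy.le h.lt.le
      rw [AddD.suc hx hy0 h, AddD.suc hx hy0 h]
      exact exists_congr fun z0 => and_congr_right fun _ => and_congr_right fun _ => ih y0 h.lt hy0 z0
theorem mul_iff {x : DD K} (hx : InOm x) (y : DD K) : InOm y → ∀ z, MulD K x y z ↔ MulD (DD K) x y z := by
  refine IWO.ind (K := K) (fun y => InOm y → ∀ z, MulD K x y z ↔ MulD (DD K) x y z) (k := 0) ?_ ?_ y
  · refine .imp (DFn.inOm .var0) (.allX 0 (.iff (DFn.mulD (.cst x) .var1 .var0) ?_))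
    have : Def (C2 (DD K) (DD K) 0 (DD K) 0) (fun p => MulD (DD K) x p.1.2 p.2) := DFn.mulD (i := 0) (.cst x) .var1 .var0
    refine this.down _ ?_
    rintro f i (⟨g, ⟨g, hg, rfl⟩ | ⟨rfl, rfl⟩, rfl⟩ | ⟨rfl, rfl⟩)
    · exact hg.elim
    · exact .var1
    · exact .var0
  · intro y ih hy z
    obtain h | ⟨y0, h⟩ := hy y le_rfl
    · rw [MulD.bt hx h, MulD.bt hx h]
    · have hy0 : InOm y0 := hy.le h.lt.le
      rw [MulD.suc hx hy0 h, MulD.suc hx hy0 h]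
      exact exists_congr fun z0 => and_congr_right fun hz0 => and_congr (ih y0 h.lt hy0 z0) (add_iff hz0 x hx z)
end
end NFUweak

open FirstOrder Language
namespace NFUweak
set_option linter.unusedSectionVars false
set_option linter.unusedVariables false

section
variable {K : Type} [LNFU.Structure K] [HasLt K] [Mdl K]

theorem arith_transfer (φ : LPA.Sentence) (h : internalPASat (DD K) φ) : internalPASat K φ := by
  intro S hS
  obtain ⟨e, he⟩ := natX (A := K) (DD K)
  obtain ⟨e', he'⟩ := natX (A := DD K) (DD K)
  let g : NatSub K ≃ NatSub (DD K) := e.trans e'.symm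
  have hg : ∀ n, Sg (g n).1 (e n).1 := fun n => by
    have := he' (g n)
    simpa [g] using this
  let S' : LPA.Structure (NatSub (DD K)) := g.inducedStructure
  have key := h S' ?_
  · exact (StrongHomClass.realize_sentence (@FirstOrder.Language.Equiv.refl LPA _ S) φ).1
      ((StrongHomClass.realize_sentence (L := LPA) g.inducedStructureEquiv φ).2 key)
  obtain ⟨h0, h1, h2, h3⟩ := hS
  have hz : ∀ n : NatSub K, isZeroCard n.1 → isZeroCard (g n).1 := fun n hn =>
    (zero_bt (g n).2 (hg n)).2 ((zero_bt n.2 (he n)).1 hn)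
  refine ⟨?_, ?_, ?_, ?_⟩
  · have e0 : S'.funMap PAFunc.zero ![] = g (S.funMap PAFunc.zero ![]) := by
      show g (S.funMap PAFunc.zero _) = _
      congr 2; exact Subsingleton.elim _ _
    rw [e0]; exact hz _ h0
  · have e0 : S'.funMap PAFunc.one ![] = g (S.funMap PAFunc.one ![]) := by
      show g (S.funMap PAFunc.one _) = _
      congr 2; exact Subsingleton.elim _ _
    rw [e0]
    generalize S.funMap PAFunc.one ![] = o at h1
    obtain ⟨z, hz1, hz2⟩ := h1
    have hzn : isNat z := .zero hz1
    let zn : NatSub K := ⟨z, hzn⟩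
    obtain ⟨t, ht⟩ := succ_ex (g zn).1
    obtain ⟨s, hs⟩ := suc_ex K (e zn).1
    have h5 : Sg t s := (hg zn).succ ht hs
    have h6 : Sg o.1 s := (he zn).succ hz2 hs
    have h7 : (e o).1 = s := Sg.uniq o.2 (he o) h6
    have h8 : t = (g o).1 := Sg.inj ((g zn).2.succ ht) (g o).2 h5 (h7 ▸ hg o)
    exact ⟨(g zn).1, hz zn hz1, h8 ▸ ht⟩
  · intro a b
    obtain ⟨a, rfl⟩ := g.surjective a
    obtain ⟨b, rfl⟩ := g.surjective b
    have e0 : S'.funMap PAFunc.add ![g a, g b] = g (S.funMap PAFunc.add ![a, b]) := by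
      show g (S.funMap PAFunc.add _) = _
      congr 2; funext i; fin_cases i <;> simp
    rw [e0]
    have := h2 a b
    generalize S.funMap PAFunc.add ![a, b] = c at this
    have h4 : AddD K (e a).1 (e b).1 (e c).1 := ⟨_, _, _, ⟨a.2, b.2, c.2⟩, ⟨he a, he b, he c⟩, this⟩
    rw [add_iff (e a).2 _ (e b).2] at h4
    obtain ⟨a', b', c', ⟨ha, hb, hc⟩, ⟨h5, h6, h7⟩, h8⟩ := h4
    rw [Sg.inj (g a).2 ha (hg a) h5, Sg.inj (g b).2 hb (hg b) h6, Sg.inj (g c).2 hc (hg c) h7]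
    exact h8
  · intro a b
    obtain ⟨a, rfl⟩ := g.surjective a
    obtain ⟨b, rfl⟩ := g.surjective b
    have e0 : S'.funMap PAFunc.mul ![g a, g b] = g (S.funMap PAFunc.mul ![a, b]) := by
      show g (S.funMap PAFunc.mul _) = _
      congr 2; funext i; fin_cases i <;> simp
    rw [e0]
    have := h3 a b
    generalize S.funMap PAFunc.mul ![a, b] = c at this
    have h4 : MulD K (e a).1 (e b).1 (e c).1 := ⟨_, _, _, ⟨a.2, b.2, c.2⟩, ⟨he a, he b, he c⟩, this⟩
    rw [mul_iff (e a).2 _ (e b).2] at h4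
    obtain ⟨a', b', c', ⟨ha, hb, hc⟩, ⟨h5, h6, h7⟩, h8⟩ := h4
    rw [Sg.inj (g a).2 ha (hg a) h5, Sg.inj (g b).2 hb (hg b) h6, Sg.inj (g c).2 hc (hg c) h7]
    exact h8
end

theorem main_aux (M : Type) (S : LNFU.Structure M) (hne : Nonempty M) (hM : @Theory.Model LNFU M S NFUmAC) :
    ∃ (N : Type) (S' : LNFU.Structure N), Nonempty N ∧ @Theory.Model LNFU N S' NFUmAC ∧ @acHolds N S' ∧
      ∀ φ, @internalPASat N S' φ → @internalPASat M S φ := by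
  letI : HasLt M := ⟨fun _ _ => False⟩
  haveI : Mdl M := mdl_of_model (fun _ _ h => h) hne hM
  exact ⟨DD M, inferInstance, inferInstance, model_of_mdl, ac_DD, fun φ => arith_transfer φ⟩

theorem stmt3 :
    ((∃ (M : Type) (S : LNFU.Structure M), Nonempty M ∧ @Theory.Model LNFU M S NFUmAC) ↔
      (∃ (M : Type) (S : LNFU.Structure M), Nonempty M ∧ @Theory.Model LNFU M S NFUmAC ∧
        @acHolds M S)) ∧
    ∀ φ : LPA.Sentence,
      ((∀ (M : Type) (S : LNFU.Structure M), Nonempty M → @Theory.Model LNFU M S NFUmAC →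
          @internalPASat M S φ) ↔
        (∀ (M : Type) (S : LNFU.Structure M), Nonempty M → @Theory.Model LNFU M S NFUmAC →
          @acHolds M S → @internalPASat M S φ)) := by
  refine ⟨⟨?_, ?_⟩, fun φ => ⟨fun h M S h1 h2 _ => h M S h1 h2, fun h M S h1 h2 => ?_⟩⟩
  · rintro ⟨M, S, h1, h2⟩
    obtain ⟨N, S', h3, h4, h5, _⟩ := main_aux M S h1 h2
    exact ⟨N, S', h3, h4, h5⟩
  · rintro ⟨M, S, h1, h2, _⟩
    exact ⟨M, S, h1, h2⟩
  · obtain ⟨N, S', h3, h4, h5, h6⟩ := main_aux M S h1 h2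
    exact h6 φ (h N S' h3 h4 h5)

end NFUweak
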